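/- arXiv:0904.1916 — 2 statements merged into one kernel-verified Lean document; each statement's English description precedes it below -/
import Mathlib

section
/- Let N ≥ 1 and c ∈ ℝ, c ≠ 0. There exists a constant k_N(c) ∈ ℂ, depending only on N and c, such that for all real diagonal matrices X = diag(x₁,…,x_N) and Y = diag(y₁,…,y_N) with the x_i pairwise distinct and the y_j pairwise distinct, ∫_{U(N)} exp(c · tr(X U Y U^{-1})) dU = k_N(c) · [ Σ_{w ∈ S_N} sgn(w) exp(c Σ_{i=1}^N x_i y_{w(i)}) ] / ( V(x₁,…,x_N) V(y₁,…,y_N) ), where the integral is with respect to the normalized Haar probability measure on the unitary group U(N), S_N is the symmetric group on N letters, and V(z₁,…,z_N) = ∏_{1≤i<j≤N}(z_j − z_i) is the Vandermonde determinant. -/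
open MeasureTheory Matrix

/-- The Vandermonde determinant `V(z₁,…,z_N) = ∏_{i<j} (z_j − z_i)`. -/
def vdm (N : ℕ) (z : Fin N → ℝ) : ℝ :=
  ∏ i : Fin N, ∏ j ∈ Finset.Ioi i, (z j - z i)

namespace HarishChandra

open MvPolynomial

section DiffOp

variable {σ : Type*}

lemma pderiv_commute (i j : σ) (p : MvPolynomial σ ℂ) :
    pderiv i (pderiv j p) = pderiv j (pderiv i p) := by
  classical
  have h : ⁅pderiv (R := ℂ) i, pderiv (R := ℂ) j⁆ = 0 := by
    apply MvPolynomial.derivation_ext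
    intro k
    simp only [Derivation.commutator_apply, pderiv_X, Derivation.coe_zero, Pi.zero_apply]
    rw [Pi.single_apply, Pi.single_apply]
    split_ifs <;> simp
  have := DFunLike.congr_fun h p
  simpa [Derivation.commutator_apply, sub_eq_zero] using this

/-- The partial derivatives, as a set of endomorphisms. -/
def pderivSet (σ : Type*) : Set (Module.End ℂ (MvPolynomial σ ℂ)) :=
  Set.range fun s : σ => (pderiv (R := ℂ) s).toLinearMap

lemma pderivSet_comm : ∀ a ∈ pderivSet σ, ∀ b ∈ pderivSet σ, a * b = b * a := by
  rintro _ ⟨i, rfl⟩ _ ⟨j, rfl⟩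
  ext1 p
  exact LinearMap.ext fun _ => pderiv_commute _ _ _

open scoped IsMulCommutative in
/-- Constant coefficient differential operators: `diffOp P` is `P(∂)`. -/
noncomputable def diffOp : MvPolynomial σ ℂ →ₐ[ℂ] Module.End ℂ (MvPolynomial σ ℂ) :=
  haveI := Algebra.isMulCommutative_adjoin ℂ (pderivSet_comm (σ := σ))
  (Algebra.adjoin ℂ (pderivSet σ)).val.comp
    (aeval fun s : σ => (⟨(pderiv s).toLinearMap, Algebra.subset_adjoin ⟨s, rfl⟩⟩ :
      Algebra.adjoin ℂ (pderivSet σ)))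

lemma diffOp_X (s : σ) (p : MvPolynomial σ ℂ) : diffOp (X s) p = pderiv s p := by
  simp [diffOp]

lemma diffOp_C (a : ℂ) (p : MvPolynomial σ ℂ) : diffOp (C a) p = a • p := by
  have : (C a : MvPolynomial σ ℂ) = algebraMap ℂ _ a := rfl
  rw [this, AlgHom.commutes]
  rfl

lemma diffOp_mul (P Q p : MvPolynomial σ ℂ) : diffOp (P * Q) p = diffOp P (diffOp Q p) := by
  rw [map_mul]; rfl

lemma diffOp_comm (P Q p : MvPolynomial σ ℂ) :
    diffOp P (diffOp Q p) = diffOp Q (diffOp P p) := by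
  rw [← diffOp_mul, mul_comm, diffOp_mul]

/-- If the commutators of `T` with the partial derivatives are given by a derivation on symbols,
so are the commutators of `T` with all constant coefficient operators. -/
lemma diffOp_commutator (T : Module.End ℂ (MvPolynomial σ ℂ))
    (δ : Derivation ℂ (MvPolynomial σ ℂ) (MvPolynomial σ ℂ))
    (h : ∀ s p, diffOp (X s) (T p) = T (diffOp (X s) p) + diffOp (δ (X s)) p)
    (P p : MvPolynomial σ ℂ) :
    diffOp P (T p) = T (diffOp P p) + diffOp (δ P) p := by
  induction P using MvPolynomial.induction_on generalizing p with
  | C a => simp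
  | add P Q hP hQ => simp only [map_add, LinearMap.add_apply, hP, hQ]; abel
  | mul_X P s hP =>
    rw [diffOp_mul, h, map_add, hP, diffOp_mul, Derivation.leibniz, map_add, smul_eq_mul,
      smul_eq_mul, LinearMap.add_apply, diffOp_mul, diffOp_mul, diffOp_comm (X s)]
    abel

lemma diffOp_X_mul (P : MvPolynomial σ ℂ) (s : σ) (p : MvPolynomial σ ℂ) :
    diffOp P (X s * p) = X s * diffOp P p + diffOp (pderiv s P) p := by
  classical
  refine diffOp_commutator (LinearMap.mulLeft ℂ (X s)) (pderiv s) (fun t q => ?_) P p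
  simp only [diffOp_X, LinearMap.mulLeft_apply, Derivation.leibniz, pderiv_X, smul_eq_mul]
  by_cases hst : s = t
  · subst hst; simp [add_comm]
  · simp [hst, Ne.symm hst]

lemma diffOp_rename (w : Equiv.Perm σ) (P p : MvPolynomial σ ℂ) :
    diffOp (rename w P) (rename w p) = rename w (diffOp P p) := by
  induction P using MvPolynomial.induction_on generalizing p with
  | C a => simp
  | add P Q hP hQ => simp [hP, hQ]
  | mul_X P s hP =>
    rw [map_mul, diffOp_mul, rename_X, diffOp_X, pderiv_rename w.injective, hP, diffOp_mul,
      diffOp_X]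

lemma isHomogeneous_diffOp {P p : MvPolynomial σ ℂ} {a b : ℕ} (hP : P.IsHomogeneous a)
    (hp : p.IsHomogeneous b) : (diffOp P p).IsHomogeneous (b - a) := by
  have key : ∀ m : σ →₀ ℕ, (diffOp (monomial m (1 : ℂ)) p).IsHomogeneous (b - m.degree) := by
    intro m
    induction m using Finsupp.induction_linear generalizing p b with
    | zero =>
      have : (monomial 0 1 : MvPolynomial σ ℂ) = 1 := rfl
      rw [this, map_one]
      simpa using hp
    | add f g hf hg =>
      have : (monomial (f + g) 1 : MvPolynomial σ ℂ) = monomial f 1 * monomial g 1 := by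
        rw [monomial_mul, one_mul]
      rw [this, diffOp_mul, map_add, add_comm, ← Nat.sub_sub]
      exact hf (hg hp)
    | single s k =>
      rw [Finsupp.degree_single, ← X_pow_eq_monomial]
      clear hP
      induction k with
      | zero => simpa using hp
      | succ k ih =>
        rw [pow_succ', diffOp_mul, diffOp_X, ← Nat.sub_sub]
        exact ih.pderiv
  rw [P.as_sum, map_sum, LinearMap.sum_apply]
  apply IsHomogeneous.sum
  intro m hm
  have hd : m.degree = a := by
    have := hP (mem_support_iff.mp hm)
    rwa [Finsupp.degree_eq_weight_one]
  have : (monomial m (coeff m P)) = C (coeff m P) * monomial m (1 : ℂ) := by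
    rw [C_mul_monomial, mul_one]
  rw [this, diffOp_mul, diffOp_C, smul_eq_C_mul, ← hd]
  simpa using (isHomogeneous_C σ (coeff m P)).mul (key m)

end DiffOp

section Vandermonde

variable {N : ℕ}

/-- The pairs `i < j` indexing the factors of the Vandermonde product. -/
def vdmPairs (N : ℕ) : Finset (Fin N × Fin N) := Finset.univ.filter fun p => p.1 < p.2

/-- The Vandermonde product as a polynomial. -/
noncomputable def vdmPoly (N : ℕ) : MvPolynomial (Fin N) ℂ :=
  ∏ p ∈ vdmPairs N, (X p.2 - X p.1)

/-- The Vandermonde product with one factor left out. -/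
noncomputable def vdmCofactor (p : Fin N × Fin N) : MvPolynomial (Fin N) ℂ :=
  ∏ q ∈ (vdmPairs N).erase p, (X q.2 - X q.1)

lemma vdmPoly_eq (N : ℕ) : vdmPoly N = ∏ i : Fin N, ∏ j ∈ Finset.Ioi i, (X j - X i) := by
  rw [vdmPoly, Finset.prod_sigma']
  refine Finset.prod_bij' (fun p _ => ⟨p.1, p.2⟩) (fun q _ => (q.1, q.2)) ?_ ?_ ?_ ?_ ?_ <;>
    simp [vdmPairs]

lemma eval_vdmPoly (z : Fin N → ℝ) :
    eval (fun i => (z i : ℂ)) (vdmPoly N) = (vdm N z : ℂ) := by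
  simp [vdmPoly_eq, vdm, map_prod]

lemma mul_vdmCofactor {p : Fin N × Fin N} (hp : p ∈ vdmPairs N) :
    (X p.2 - X p.1) * vdmCofactor p = vdmPoly N :=
  Finset.mul_prod_erase _ _ hp

lemma derivation_prod {ι A : Type*} [DecidableEq ι] [CommRing A] [Algebra ℂ A]
    (D : Derivation ℂ A A) (s : Finset ι) (f : ι → A) :
    D (∏ p ∈ s, f p) = ∑ p ∈ s, (∏ q ∈ s.erase p, f q) * D (f p) := by
  induction s using Finset.induction_on with
  | empty => simp
  | insert a s ha ih =>
    rw [Finset.prod_insert ha, Derivation.leibniz, ih, Finset.sum_insert ha,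
      Finset.erase_insert ha, smul_eq_mul, smul_eq_mul, add_comm, Finset.mul_sum]
    refine congrArg _ (Finset.sum_congr rfl fun p hp => ?_)
    have hpa : p ≠ a := fun h => ha (h ▸ hp)
    rw [Finset.erase_insert_of_ne hpa.symm,
      Finset.prod_insert fun h => ha (Finset.mem_of_mem_erase h), mul_assoc]

lemma pderiv_vdmPoly (i : Fin N) :
    pderiv i (vdmPoly N) = ∑ p ∈ vdmPairs N,
      vdmCofactor p * pderiv i (X p.2 - X p.1) := by
  exact derivation_prod _ _ _

lemma rename_vdmPoly (w : Equiv.Perm (Fin N)) :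
    rename w (vdmPoly N) = ((Equiv.Perm.sign w : ℤ) : ℂ) • vdmPoly N := by
  have h : vdmPoly N = (Matrix.vandermonde (X : Fin N → MvPolynomial (Fin N) ℂ)).det := by
    rw [Matrix.det_vandermonde, vdmPoly_eq]
  rw [h, AlgHom.map_det]
  have h2 : (rename (R := ℂ) w).mapMatrix (Matrix.vandermonde X)
      = (Matrix.vandermonde (X : Fin N → MvPolynomial (Fin N) ℂ)).submatrix w id := by
    ext i j
    simp [Matrix.vandermonde]
  rw [h2, Matrix.det_permute]
  simp [smul_eq_C_mul]

lemma isHomogeneous_vdmPoly : (vdmPoly N).IsHomogeneous (vdmPairs N).card := by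
  have := IsHomogeneous.prod (vdmPairs N) (fun p => (X p.2 - X p.1 : MvPolynomial (Fin N) ℂ))
    (fun _ => 1) fun p _ => (isHomogeneous_X ℂ p.2).sub (isHomogeneous_X ℂ p.1)
  simpa [vdmPoly] using this

/-- Setting `x_j := x_i`. -/
noncomputable def identify (i j : Fin N) : MvPolynomial (Fin N) ℂ →ₐ[ℂ] MvPolynomial (Fin N) ℂ :=
  aeval fun k => if k = j then X i else X k

lemma X_sub_X_dvd_iff {i j : Fin N} (h : MvPolynomial (Fin N) ℂ) :
    X j - X i ∣ h ↔ identify i j h = 0 := by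
  constructor
  · rintro ⟨q, rfl⟩
    rw [map_mul, map_sub]
    by_cases hij : i = j
    · simp [hij]
    · simp [identify, hij]
  · intro h0
    have key : (Ideal.Quotient.mkₐ ℂ (Ideal.span {(X j - X i : MvPolynomial (Fin N) ℂ)})).comp
        (identify i j) = Ideal.Quotient.mkₐ ℂ _ := by
      apply MvPolynomial.algHom_ext
      intro k
      simp only [identify, AlgHom.comp_apply, aeval_X, Ideal.Quotient.mkₐ_eq_mk]
      split_ifs with hk
      · subst hk
        rw [Ideal.Quotient.eq, Ideal.mem_span_singleton, ← neg_sub, neg_dvd.symm, neg_neg]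
      · rfl
    have := DFunLike.congr_fun key h
    rw [AlgHom.comp_apply, h0, map_zero] at this
    rw [← Ideal.mem_span_singleton]
    exact Ideal.Quotient.eq_zero_iff_mem.mp this.symm

lemma prime_X_sub_X {i j : Fin N} (hij : i ≠ j) :
    Prime (X j - X i : MvPolynomial (Fin N) ℂ) := by
  refine ⟨sub_ne_zero.mpr fun h => hij (X_injective h).symm, fun hu => ?_, fun a b hab => ?_⟩
  · have := (X_sub_X_dvd_iff (i := i) (j := j) 1).mp hu.dvd
    simp at this
  · rw [X_sub_X_dvd_iff, map_mul, mul_eq_zero] at hab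
    simpa only [X_sub_X_dvd_iff] using hab

lemma isRelPrime_X_sub_X {p q : Fin N × Fin N} (hp : p ∈ vdmPairs N) (hq : q ∈ vdmPairs N)
    (hpq : p ≠ q) : IsRelPrime (X p.2 - X p.1 : MvPolynomial (Fin N) ℂ) (X q.2 - X q.1) := by
  obtain ⟨i, j⟩ := p
  obtain ⟨k, l⟩ := q
  simp only [vdmPairs, Finset.mem_filter, Finset.mem_univ, true_and] at hp hq
  rw [(prime_X_sub_X hp.ne).irreducible.isRelPrime_iff_not_dvd, X_sub_X_dvd_iff]
  simp only [identify, map_sub, aeval_X, sub_eq_zero]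
  have hX : ∀ a b : Fin N, (X a : MvPolynomial (Fin N) ℂ) = X b ↔ a = b := fun a b =>
    X_injective.eq_iff
  rw [← apply_ite (X : Fin N → MvPolynomial (Fin N) ℂ),
    ← apply_ite (X : Fin N → MvPolynomial (Fin N) ℂ), hX]
  simp only [ne_eq, Prod.mk.injEq] at hpq
  split_ifs <;> omega

/-- A polynomial is alternating if permuting the variables multiplies it by the sign. -/
def IsAlternating (h : MvPolynomial (Fin N) ℂ) : Prop :=
  ∀ w : Equiv.Perm (Fin N), rename w h = ((Equiv.Perm.sign w : ℤ) : ℂ) • h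

lemma IsAlternating.exists_eq_vdmPoly_mul {h : MvPolynomial (Fin N) ℂ} (hh : IsAlternating h) :
    ∃ s : MvPolynomial (Fin N) ℂ, s.IsSymmetric ∧ h = vdmPoly N * s := by
  have hdvd : vdmPoly N ∣ h := by
    refine Finset.prod_dvd_of_isRelPrime (fun p hp q hq hpq => isRelPrime_X_sub_X hp hq hpq) ?_
    rintro ⟨i, j⟩ hij
    simp only [vdmPairs, Finset.mem_filter, Finset.mem_univ, true_and] at hij
    rw [X_sub_X_dvd_iff]
    have h1 : (identify i j).comp (rename (Equiv.swap i j)) = identify i j := by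
      apply MvPolynomial.algHom_ext
      intro k
      simp only [identify, AlgHom.comp_apply, rename_X, aeval_X, Equiv.swap_apply_def]
      split_ifs <;> simp_all
    have h2 := DFunLike.congr_fun h1 h
    rw [AlgHom.comp_apply, hh, Equiv.Perm.sign_swap hij.ne] at h2
    simp only [Units.val_neg, Units.val_one, Int.cast_neg, Int.cast_one, neg_smul, one_smul,
      map_neg] at h2
    exact self_eq_neg.mp h2.symm
  obtain ⟨s, rfl⟩ := hdvd
  refine ⟨s, fun w => ?_, rfl⟩
  have hV : vdmPoly N ≠ 0 := Finset.prod_ne_zero_iff.mpr fun p hp =>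
    (prime_X_sub_X (by simp [vdmPairs] at hp; exact hp.ne)).ne_zero
  have := hh w
  rw [map_mul, rename_vdmPoly, smul_mul_assoc] at this
  have hs : ((Equiv.Perm.sign w : ℤ) : ℂ) ≠ 0 := by
    rcases Int.units_eq_one_or (Equiv.Perm.sign w) with h | h <;> simp [h]
  exact mul_left_cancel₀ hV (smul_right_injective _ hs this)

lemma vdmPoly_harmonic : ∑ i, pderiv i (pderiv i (vdmPoly N)) = 0 := by
  set L := ∑ i, pderiv i (pderiv i (vdmPoly N)) with hL
  set d := (vdmPairs N).card
  have halt : IsAlternating L := by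
    intro w
    rw [hL, map_sum, Finset.smul_sum,
      ← Equiv.sum_comp w fun i => ((Equiv.Perm.sign w : ℤ) : ℂ) • pderiv i (pderiv i (vdmPoly N))]
    simp_rw [← pderiv_rename w.injective, rename_vdmPoly]
    simp
  obtain ⟨s, -, hs⟩ := halt.exists_eq_vdmPoly_mul
  have hLhom : L.IsHomogeneous (d - 1 - 1) :=
    IsHomogeneous.sum _ _ _ fun i _ => isHomogeneous_vdmPoly.pderiv.pderiv
  by_contra hne
  have hV : vdmPoly N ≠ 0 := fun h => hne (by rw [hs, h, zero_mul])
  have hs0 : s ≠ 0 := fun h => hne (by rw [hs, h, mul_zero])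
  have hdeg := totalDegree_mul_of_isDomain hV hs0
  rw [← hs, hLhom.totalDegree hne, isHomogeneous_vdmPoly.totalDegree hV] at hdeg
  have hd0 : d = 0 := by omega
  apply hne
  have h1 : vdmPoly N = 1 := by
    rw [vdmPoly, Finset.card_eq_zero.mp hd0, Finset.prod_empty]
  simp [hL, h1]

end Vandermonde

section Commutators

variable {E : Type*} [Ring E]

/-- The commutator with a fixed element. -/
def commutator (r : E) : E →+ E := AddMonoidHom.mulLeft r - AddMonoidHom.mulRight r

lemma commutator_apply (r a : E) : commutator r a = r * a - a * r := rfl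

lemma commutator_mul (r a b : E) :
    commutator r (a * b) = commutator r a * b + a * commutator r b := by
  simp only [commutator_apply]; noncomm_ring

lemma commutator_iterate_mul {r a : E} (ha : commutator r (commutator r a) = 0) (b : E) (j : ℕ) :
    (commutator r)^[j + 1] (a * b) =
      (j + 1) • (commutator r a * (commutator r)^[j] b) + a * (commutator r)^[j + 1] b := by
  induction j with
  | zero => simp [commutator_mul]
  | succ j ih =>
    rw [Function.iterate_succ_apply', ih, map_add, map_nsmul, commutator_mul, commutator_mul, ha,
      zero_mul, zero_add, ← Function.iterate_succ_apply' (commutator r),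
      ← Function.iterate_succ_apply' (commutator r), ← add_assoc, ← succ_nsmul]

/-- `b` is, up to the factor `k!`, the `k`-fold commutator of `r` with `a`, and commutes
with `r`. -/
def HasTopCommutator (r : E) (k : ℕ) (a b : E) : Prop :=
  (commutator r)^[k] a = k.factorial • b ∧ commutator r b = 0

lemma HasTopCommutator.one (r : E) : HasTopCommutator r 0 1 1 := by
  simp [HasTopCommutator, commutator_apply]

lemma HasTopCommutator.zero (r : E) (k : ℕ) : HasTopCommutator r k 0 0 := by
  simp [HasTopCommutator, iterate_map_zero]

lemma HasTopCommutator.mul {r a₁ b₁ a b : E} {k : ℕ} (h₁ : commutator r a₁ = b₁)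
    (hb₁ : commutator r b₁ = 0) (h : HasTopCommutator r k a b) :
    HasTopCommutator r (k + 1) (a₁ * a) (b₁ * b) := by
  refine ⟨?_, by rw [commutator_mul, hb₁, h.2, zero_mul, mul_zero, add_zero]⟩
  rw [commutator_iterate_mul (by rw [h₁, hb₁]), Function.iterate_succ_apply', h.1, h₁, map_nsmul,
    h.2, nsmul_zero, mul_zero, add_zero, mul_smul_comm, smul_smul, Nat.factorial_succ]

lemma HasTopCommutator.sum {ι : Type*} (s : Finset ι) {r : E} {k : ℕ} {a b : ι → E}
    (h : ∀ i ∈ s, HasTopCommutator r k (a i) (b i)) :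
    HasTopCommutator r k (∑ i ∈ s, a i) (∑ i ∈ s, b i) := by
  refine ⟨?_, by rw [map_sum]; exact Finset.sum_eq_zero fun i hi => (h i hi).2⟩
  have : (commutator r)^[k] (∑ i ∈ s, a i) = ∑ i ∈ s, (commutator r)^[k] (a i) := by
    clear h
    induction k with
    | zero => rfl
    | succ k ih => simp only [Function.iterate_succ_apply', ih, map_sum]
  rw [this, Finset.smul_sum]
  exact Finset.sum_congr rfl fun i hi => (h i hi).1

end Commutators

section MatrixPolynomials

variable {N : ℕ}

/-- Polynomials in the entries of an `N × N` matrix. -/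
abbrev MatPoly (N : ℕ) := MvPolynomial (Fin N × Fin N) ℂ

/-- The infinitesimal conjugation action: the derivation with `X ↦ [A, X]`. -/
noncomputable def adDer (A : Matrix (Fin N) (Fin N) ℂ) :
    Derivation ℂ (MatPoly N) (MatPoly N) :=
  mkDerivation ℂ fun p =>
    (A.map C * mvPolynomialX (Fin N) (Fin N) ℂ - mvPolynomialX (Fin N) (Fin N) ℂ * A.map C :
      Matrix (Fin N) (Fin N) (MatPoly N)) p.1 p.2

lemma adDer_X (A : Matrix (Fin N) (Fin N) ℂ) (p : Fin N × Fin N) :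
    adDer A (X p) = (∑ a, C (A p.1 a) * X (a, p.2)) - ∑ b, C (A b p.2) * X (p.1, b) := by
  simp [adDer, mkDerivation_X, Matrix.mul_apply, mul_comm]

lemma map_adDer_pow (A : Matrix (Fin N) (Fin N) ℂ) (k : ℕ) :
    (mvPolynomialX (Fin N) (Fin N) ℂ ^ k).map (adDer A) =
      A.map C * mvPolynomialX (Fin N) (Fin N) ℂ ^ k -
        mvPolynomialX (Fin N) (Fin N) ℂ ^ k * A.map C := by
  have hmul : ∀ S T : Matrix (Fin N) (Fin N) (MatPoly N),
      (S * T).map (adDer A) = S.map (adDer A) * T + S * T.map (adDer A) := by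
    intro S T
    ext i j
    simp only [Matrix.map_apply, Matrix.mul_apply, Matrix.add_apply, map_sum, Derivation.leibniz,
      smul_eq_mul, ← Finset.sum_add_distrib]
    exact congrArg _ (Finset.sum_congr rfl fun _ _ => by ring)
  have h1 : (mvPolynomialX (Fin N) (Fin N) ℂ).map (adDer A) =
      A.map C * mvPolynomialX (Fin N) (Fin N) ℂ - mvPolynomialX (Fin N) (Fin N) ℂ * A.map C := by
    ext1 i j
    simp [adDer, mkDerivation_X]
  induction k with
  | zero =>
    ext i j
    simp only [pow_zero, mul_one, one_mul, sub_self, Matrix.map_apply, Matrix.one_apply]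
    split_ifs <;> simp
  | succ k ih =>
    rw [pow_succ, hmul, ih, h1]
    noncomm_ring

/-- The class function `tr Xᵏ`. -/
noncomputable def tracePow (N k : ℕ) : MatPoly N :=
  (mvPolynomialX (Fin N) (Fin N) ℂ ^ k).trace

lemma adDer_tracePow (A : Matrix (Fin N) (Fin N) ℂ) (k : ℕ) : adDer A (tracePow N k) = 0 := by
  have : adDer A (tracePow N k) =
      ((mvPolynomialX (Fin N) (Fin N) ℂ ^ k).map (adDer A)).trace := by
    simp [tracePow, Matrix.trace]
  rw [this, map_adDer_pow, Matrix.trace_sub, Matrix.trace_mul_comm, sub_self]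

lemma derivation_sum_apply {ι A : Type*} [CommRing A] [Algebra ℂ A] (s : Finset ι)
    (D : ι → Derivation ℂ A A) (a : A) : (∑ i ∈ s, D i) a = ∑ i ∈ s, D i a := by
  classical
  induction s using Finset.induction_on with
  | empty => simp
  | insert i s hi ih => rw [Finset.sum_insert hi, Finset.sum_insert hi, Derivation.add_apply, ih]

lemma diffOp_adDer (A : Matrix (Fin N) (Fin N) ℂ) (P p : MatPoly N) :
    diffOp P (adDer A p) = adDer A (diffOp P p) + diffOp (adDer Aᵀ P) p := by
  refine diffOp_commutator (adDer A).toLinearMap (adDer Aᵀ) (fun s q => ?_) P p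
  have h : ⁅pderiv (R := ℂ) s, adDer A⁆ =
      (∑ a, A a s.1 • pderiv (R := ℂ) (a, s.2)) - ∑ b, A s.2 b • pderiv (R := ℂ) (s.1, b) := by
    apply MvPolynomial.derivation_ext
    rintro ⟨a, b⟩
    obtain ⟨k, l⟩ := s
    have hz : adDer A (pderiv (k, l) (X (a, b))) = 0 := by
      rw [pderiv_X, Pi.single_apply]; split_ifs <;> simp
    rw [Derivation.commutator_apply, hz, adDer_X]
    simp only [map_sub, map_sum, Derivation.leibniz, pderiv_X, pderiv_C, Pi.single_apply,
      Derivation.coe_sub, Pi.sub_apply, derivation_sum_apply, Derivation.coe_smul,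
      Pi.smul_apply, Prod.mk.injEq, smul_eq_C_mul, smul_eq_mul]
    by_cases hak : a = k <;> by_cases hbl : b = l <;>
      simp [hak, hbl, eq_comm, Finset.sum_ite_eq]
  have h2 := DFunLike.congr_fun h q
  rw [Derivation.commutator_apply, sub_eq_iff_eq_add'] at h2
  simp only [diffOp_X, Derivation.coeFn_coe, h2, adDer_X, map_sub, map_sum, diffOp_mul,
    LinearMap.sub_apply, LinearMap.sum_apply, Derivation.coe_sub, Pi.sub_apply,
    derivation_sum_apply, Derivation.coe_smul, Pi.smul_apply, diffOp_C,
    Matrix.transpose_apply]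

/-- Polynomials in the diagonal entries, as polynomials in all entries. -/
noncomputable def diagIncl (N : ℕ) : MvPolynomial (Fin N) ℂ →ₐ[ℂ] MatPoly N :=
  rename fun i => (i, i)

/-- Restriction of polynomials to diagonal matrices. -/
noncomputable def diagRestr (N : ℕ) : MatPoly N →ₐ[ℂ] MvPolynomial (Fin N) ℂ :=
  aeval fun p => if p.1 = p.2 then X p.1 else 0

lemma diagRestr_tracePow (k : ℕ) : diagRestr N (tracePow N k) = psum (Fin N) ℂ k := by
  have h : (diagRestr N).mapMatrix (mvPolynomialX (Fin N) (Fin N) ℂ) = Matrix.diagonal X := by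
    ext1 i j
    by_cases hij : i = j <;> simp [diagRestr, hij]
  have h2 : diagRestr N (tracePow N k) =
      ((diagRestr N).mapMatrix (mvPolynomialX (Fin N) (Fin N) ℂ ^ k)).trace := by
    simp [tracePow, Matrix.trace]
  rw [h2, map_pow, h, Matrix.diagonal_pow, Matrix.trace_diagonal]
  rfl

lemma pderiv_diagIncl (p : Fin N × Fin N) (g : MvPolynomial (Fin N) ℂ) :
    pderiv p (diagIncl N g) = if p.1 = p.2 then diagIncl N (pderiv p.1 g) else 0 := by
  obtain ⟨i, j⟩ := p
  split_ifs with h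
  · simp only at h
    subst h
    exact pderiv_rename (fun a b hab => (Prod.mk.inj hab).1) i g
  · induction g using MvPolynomial.induction_on with
    | C a => simp [diagIncl]
    | add p q hp hq => simp [hp, hq]
    | mul_X p k hp =>
      have : (k, k) ≠ (i, j) := by rintro ⟨⟩; exact h rfl
      simp only [map_mul, Derivation.leibniz, hp, smul_zero, add_zero]
      simp [diagIncl, pderiv_X_of_ne this]

lemma diffOp_diagIncl (P : MatPoly N) (g : MvPolynomial (Fin N) ℂ) :
    diffOp P (diagIncl N g) = diagIncl N (diffOp (diagRestr N P) g) := by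
  induction P using MvPolynomial.induction_on generalizing g with
  | C a => simp [← MvPolynomial.algebraMap_eq]
  | add P Q hP hQ => simp [hP, hQ]
  | mul_X P s hP =>
    rw [diffOp_mul, diffOp_X, pderiv_diagIncl, map_mul, diffOp_mul]
    split_ifs with h
    · rw [hP]; simp [diagRestr, h, diffOp_X]
    · simp [diagRestr, h]

end MatrixPolynomials

section InvariantFunctionals

variable {N : ℕ}

/-- Linear functionals annihilated by the infinitesimal conjugation action. -/
def IsInvariant (φ : MatPoly N →ₗ[ℂ] ℂ) : Prop :=
  ∀ (A : Matrix (Fin N) (Fin N) ℂ) (P : MatPoly N), φ (adDer A P) = 0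

lemma adDer_single_X (i j : Fin N) (p : Fin N × Fin N) :
    adDer (Matrix.single i j 1) (X p) =
      (if i = p.1 then X (j, p.2) else 0) - if j = p.2 then X (p.1, i) else 0 := by
  rw [adDer_X]
  congr 1
  · by_cases h : i = p.1 <;> simp [Matrix.single_apply, h, apply_ite C, ite_mul]
  · by_cases h : j = p.2 <;> simp [Matrix.single_apply, h, apply_ite C, ite_mul]

lemma adDer_single_diagIncl (i j : Fin N) (g : MvPolynomial (Fin N) ℂ) :
    adDer (Matrix.single i j 1) (diagIncl N g) =
      X (j, i) * diagIncl N (pderiv i g - pderiv j g) := by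
  induction g using MvPolynomial.induction_on with
  | C a => simp [diagIncl]
  | add p q hp hq => simp only [map_add, hp, hq, ← mul_add]; congr 2; simp; ring
  | mul_X p k hp =>
    have hk : diagIncl N (X k) = X (k, k) := by simp [diagIncl]
    have hs : adDer (Matrix.single i j 1) (X (k, k)) =
        X (j, i) * diagIncl N (pderiv i (X k) - pderiv j (X k)) := by
      rw [adDer_single_X, pderiv_X, pderiv_X, Pi.single_apply, Pi.single_apply]
      dsimp only
      simp only [@eq_comm _ k]
      by_cases h1 : i = k <;> by_cases h2 : j = k <;> simp [h1, h2]
    rw [map_mul, Derivation.leibniz, hk, hs, hp, Derivation.leibniz, Derivation.leibniz]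
    simp only [smul_eq_mul, map_add, map_sub, map_mul, hk]
    ring

lemma IsInvariant.offDiag {φ : MatPoly N →ₗ[ℂ] ℂ} (hφ : IsInvariant φ) (i j : Fin N)
    (g : MvPolynomial (Fin N) ℂ) :
    φ (X (i, j) * X (j, i) * diagIncl N (pderiv i g - pderiv j g)) =
      φ (diagIncl N ((X i - X j) * g)) := by
  have h := hφ (Matrix.single i j 1) (X (i, j) * diagIncl N g)
  have h2 : adDer (Matrix.single i j 1) (X (i, j) * diagIncl N g) =
      X (i, j) * X (j, i) * diagIncl N (pderiv i g - pderiv j g) -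
        diagIncl N ((X i - X j) * g) := by
    rw [Derivation.leibniz, adDer_single_diagIncl, adDer_single_X, map_mul, map_sub]
    simp [diagIncl]
    ring
  rwa [h2, map_sub, sub_eq_zero] at h

lemma tracePow_two : tracePow N 2 = ∑ i, ∑ j, X (i, j) * X (j, i) := by
  simp [tracePow, pow_two, Matrix.trace, Matrix.mul_apply]

lemma sum_sum_eq_diag_add_vdmPairs (f : Fin N → Fin N → ℂ) (hf : ∀ i j, f i j = f j i) :
    ∑ i, ∑ j, f i j = ∑ i, f i i + 2 * ∑ p ∈ vdmPairs N, f p.1 p.2 := by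
  have h1 : ∀ i j, f i j = (if i = j then f i i else 0) + (if i < j then f i j else 0) +
      if j < i then f j i else 0 := by
    intro i j
    rcases lt_trichotomy i j with h | h | h
    · simp [h, h.ne, h.not_gt]
    · simp [h]
    · simp [h, h.ne', h.not_gt, hf i j]
  have h2 : ∑ p ∈ vdmPairs N, f p.1 p.2 = ∑ i, ∑ j, if i < j then f i j else 0 := by
    rw [vdmPairs, Finset.sum_filter, Fintype.sum_prod_type]
  rw [h2, Finset.sum_congr rfl fun i _ => Finset.sum_congr rfl fun j _ => h1 i j]
  simp only [Finset.sum_add_distrib, Finset.sum_ite_eq, Finset.mem_univ, if_true]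
  rw [Finset.sum_comm (f := fun i j => if j < i then f j i else 0)]
  ring

lemma diffOp_vdmPoly_psum_two_mul (h : MvPolynomial (Fin N) ℂ) :
    diffOp (vdmPoly N) (psum (Fin N) ℂ 2 * h) = ∑ i, X i * X i * diffOp (vdmPoly N) h +
      2 * ∑ p ∈ vdmPairs N, (X p.2 - X p.1) * diffOp (vdmCofactor p) h := by
  have h1 : ∑ p ∈ vdmPairs N, (X p.2 - X p.1) * diffOp (vdmCofactor p) h =
      ∑ i, X i * diffOp (pderiv i (vdmPoly N)) h := by
    simp_rw [pderiv_vdmPoly, map_sum, LinearMap.sum_apply, Finset.mul_sum]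
    rw [Finset.sum_comm]
    refine Finset.sum_congr rfl fun p _ => ?_
    have : ∀ i, X i * diffOp (vdmCofactor p * pderiv i (X p.2 - X p.1)) h =
        (if p.2 = i then X i * diffOp (vdmCofactor p) h else 0) -
          if p.1 = i then X i * diffOp (vdmCofactor p) h else 0 := by
      intro i
      rw [map_sub, pderiv_X, pderiv_X, Pi.single_apply, Pi.single_apply]
      split_ifs <;> simp
    simp only [this, Finset.sum_sub_distrib, Finset.sum_ite_eq, Finset.mem_univ, if_true, sub_mul]
  have h2 : ∀ i, diffOp (vdmPoly N) (X i * (X i * h)) = X i * X i * diffOp (vdmPoly N) h +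
      2 * (X i * diffOp (pderiv i (vdmPoly N)) h) +
      diffOp (pderiv i (pderiv i (vdmPoly N))) h := by
    intro i
    rw [diffOp_X_mul, diffOp_X_mul, diffOp_X_mul]
    ring
  have h3 : ∑ i, diffOp (pderiv i (pderiv i (vdmPoly N))) h = 0 := by
    rw [← LinearMap.sum_apply, ← map_sum, vdmPoly_harmonic, map_zero, LinearMap.zero_apply]
  have h4 : psum (Fin N) ℂ 2 * h = ∑ i, X i * (X i * h) := by
    simp [psum, pow_two, Finset.sum_mul, mul_assoc]
  rw [h4, map_sum, Finset.sum_congr rfl fun i _ => h2 i, Finset.sum_add_distrib,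
    Finset.sum_add_distrib, h3, h1, add_zero, Finset.mul_sum]

/-- The radial part of multiplication by `tr X²`. -/
lemma IsInvariant.radial_tracePow_two {φ : MatPoly N →ₗ[ℂ] ℂ} (hφ : IsInvariant φ)
    (h : MvPolynomial (Fin N) ℂ) :
    φ (tracePow N 2 * diagIncl N (diffOp (vdmPoly N) h)) =
      φ (diagIncl N (diffOp (vdmPoly N) (psum (Fin N) ℂ 2 * h))) := by
  set F := diffOp (vdmPoly N) h with hF
  have h1 : φ (tracePow N 2 * diagIncl N F) =
      ∑ i, ∑ j, φ (X (i, j) * X (j, i) * diagIncl N F) := by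
    simp only [tracePow_two, Finset.sum_mul, map_sum]
  have h2 : ∀ p ∈ vdmPairs N, φ (X (p.1, p.2) * X (p.2, p.1) * diagIncl N F) =
      φ (diagIncl N ((X p.2 - X p.1) * diffOp (vdmCofactor p) h)) := by
    intro p hp
    have := hφ.offDiag p.1 p.2 (-diffOp (vdmCofactor p) h)
    have hF2 : F = pderiv p.1 (-diffOp (vdmCofactor p) h) -
        pderiv p.2 (-diffOp (vdmCofactor p) h) := by
      rw [hF, ← mul_vdmCofactor hp, diffOp_mul, map_sub, LinearMap.sub_apply, diffOp_X, diffOp_X,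
        map_neg, map_neg]
      ring
    rw [← hF2] at this
    rw [this]
    congr 2
    ring
  rw [h1, sum_sum_eq_diag_add_vdmPairs _ fun i j => by rw [mul_comm (X (i, j))],
    diffOp_vdmPoly_psum_two_mul, Finset.sum_congr rfl h2, two_mul, two_mul]
  simp only [map_add, map_sum, map_mul]
  simp [diagIncl, hF]

/-- The second operator is the radial part of the first. -/
structure HasRadialPart (S : Module.End ℂ (MatPoly N))
    (S' : Module.End ℂ (MvPolynomial (Fin N) ℂ)) : Prop where
  isInvariant : ∀ φ : MatPoly N →ₗ[ℂ] ℂ, IsInvariant φ → IsInvariant (φ ∘ₗ S)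
  apply_eq : ∀ φ : MatPoly N →ₗ[ℂ] ℂ, IsInvariant φ → ∀ h,
    φ (S (diagIncl N (diffOp (vdmPoly N) h))) = φ (diagIncl N (diffOp (vdmPoly N) (S' h)))

lemma HasRadialPart.mul {S R : Module.End ℂ (MatPoly N)}
    {S' R' : Module.End ℂ (MvPolynomial (Fin N) ℂ)} (hS : HasRadialPart S S')
    (hR : HasRadialPart R R') : HasRadialPart (S * R) (S' * R') where
  isInvariant φ hφ := hR.isInvariant _ (hS.isInvariant φ hφ)
  apply_eq φ hφ h := by
    rw [Module.End.mul_apply, Module.End.mul_apply, ← hS.apply_eq φ hφ]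
    exact hR.apply_eq _ (hS.isInvariant φ hφ) h

lemma HasRadialPart.sub {S R : Module.End ℂ (MatPoly N)}
    {S' R' : Module.End ℂ (MvPolynomial (Fin N) ℂ)} (hS : HasRadialPart S S')
    (hR : HasRadialPart R R') : HasRadialPart (S - R) (S' - R') where
  isInvariant φ hφ A P := by
    have h1 := hS.isInvariant φ hφ A P
    have h2 := hR.isInvariant φ hφ A P
    simp only [LinearMap.comp_apply] at h1 h2
    simp [h1, h2]
  apply_eq φ hφ h := by
    simp only [LinearMap.sub_apply, map_sub, hS.apply_eq φ hφ, hR.apply_eq φ hφ]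

lemma HasRadialPart.commutator_iterate {S R : Module.End ℂ (MatPoly N)}
    {S' R' : Module.End ℂ (MvPolynomial (Fin N) ℂ)} (hS : HasRadialPart S S')
    (hR : HasRadialPart R R') (k : ℕ) :
    HasRadialPart ((commutator S)^[k] R) ((commutator S')^[k] R') := by
  induction k with
  | zero => exact hR
  | succ k ih =>
    rw [Function.iterate_succ_apply', Function.iterate_succ_apply', commutator_apply,
      commutator_apply]
    exact (hS.mul ih).sub (ih.mul hS)

lemma hasRadialPart_lmul_tracePow_two : HasRadialPart
    (Algebra.lmul ℂ (MatPoly N) (tracePow N 2))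
    (Algebra.lmul ℂ (MvPolynomial (Fin N) ℂ) (psum (Fin N) ℂ 2)) where
  isInvariant φ hφ A P := by
    have := hφ A (tracePow N 2 * P)
    rw [Derivation.leibniz, adDer_tracePow, smul_zero, add_zero] at this
    exact this
  apply_eq φ hφ h := hφ.radial_tracePow_two h

lemma hasRadialPart_diffOp_tracePow (k : ℕ) :
    HasRadialPart (diffOp (tracePow N k)) (diffOp (psum (Fin N) ℂ k)) where
  isInvariant φ hφ A P := by
    rw [LinearMap.comp_apply, diffOp_adDer, adDer_tracePow, map_zero, LinearMap.zero_apply,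
      add_zero, hφ]
  apply_eq φ hφ h := by
    rw [diffOp_diagIncl, diagRestr_tracePow, diffOp_comm]

lemma lmul_apply {σ : Type*} (P p : MvPolynomial σ ℂ) :
    Algebra.lmul ℂ (MvPolynomial σ ℂ) P p = P * p := rfl

lemma commutator_lmul_diffOp_X {σ : Type*} (T : MvPolynomial σ ℂ) (s : σ) :
    commutator (Algebra.lmul ℂ (MvPolynomial σ ℂ) T) (diffOp (X s)) =
      Algebra.lmul ℂ _ (-pderiv s T) := by
  apply LinearMap.ext
  intro p
  simp only [commutator_apply, LinearMap.sub_apply, Module.End.mul_apply, diffOp_X,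
    lmul_apply, Derivation.leibniz, smul_eq_mul]
  ring

lemma commutator_lmul_lmul {σ : Type*} (T P : MvPolynomial σ ℂ) :
    commutator (Algebra.lmul ℂ (MvPolynomial σ ℂ) T) (Algebra.lmul ℂ _ P) = 0 := by
  rw [commutator_apply, ← map_mul, ← map_mul, mul_comm, sub_self]

lemma pderiv_tracePow_two (i j : Fin N) :
    pderiv (i, j) (tracePow N 2) = 2 * X (j, i) := by
  have h : ∀ a b : Fin N, pderiv (i, j) (X (a, b) * X (b, a) : MatPoly N) =
      (if a = i then if b = j then X (j, i) else 0 else 0) +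
        if a = j then if b = i then X (j, i) else 0 else 0 := by
    intro a b
    rw [Derivation.leibniz, pderiv_X, pderiv_X, Pi.single_apply, Pi.single_apply]
    by_cases h1 : a = i <;> by_cases h2 : b = j <;> by_cases h3 : a = j <;>
      by_cases h4 : b = i <;> simp_all
  simp only [tracePow_two, map_sum, h, Finset.sum_add_distrib]
  simp [two_mul]

lemma hasTopCommutator_pow_apply (k : ℕ) (i j : Fin N) :
    HasTopCommutator (Algebra.lmul ℂ (MatPoly N) (tracePow N 2)) k
      (diffOp ((mvPolynomialX (Fin N) (Fin N) ℂ ^ k) i j))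
      (Algebra.lmul ℂ _ (C ((-2) ^ k) * (mvPolynomialX (Fin N) (Fin N) ℂ ^ k) j i)) := by
  induction k generalizing i j with
  | zero =>
    by_cases hij : i = j
    · subst hij
      simpa [-Algebra.coe_lmul_eq_mul] using HasTopCommutator.one (Algebra.lmul ℂ (MatPoly N) (tracePow N 2))
    · simpa [hij, Ne.symm hij] using
        HasTopCommutator.zero (Algebra.lmul ℂ (MatPoly N) (tracePow N 2)) 0
  | succ k ih =>
    have := HasTopCommutator.sum Finset.univ fun a _ =>
      (ih a j).mul (commutator_lmul_diffOp_X (tracePow N 2) (i, a)) (commutator_lmul_lmul _ _)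
    convert this using 1
    · simp [pow_succ', Matrix.mul_apply, map_sum, map_mul]
    · simp only [← map_mul, ← map_sum, pderiv_tracePow_two]
      congr 1
      rw [pow_succ (mvPolynomialX _ _ _), Matrix.mul_apply, Finset.mul_sum]
      refine Finset.sum_congr rfl fun a _ => ?_
      rw [pow_succ, map_mul, map_neg, mvPolynomialX_apply]
      simp only [map_ofNat]
      ring

lemma hasTopCommutator_X_pow (k : ℕ) (i : Fin N) :
    HasTopCommutator (Algebra.lmul ℂ (MvPolynomial (Fin N) ℂ) (psum (Fin N) ℂ 2)) k
      (diffOp (X i ^ k)) (Algebra.lmul ℂ _ (C ((-2) ^ k) * X i ^ k)) := by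
  induction k with
  | zero => simpa [-Algebra.coe_lmul_eq_mul] using HasTopCommutator.one (Algebra.lmul ℂ _ (psum (Fin N) ℂ 2))
  | succ k ih =>
    have := ih.mul (commutator_lmul_diffOp_X (psum (Fin N) ℂ 2) i) (commutator_lmul_lmul _ _)
    convert this using 1
    · rw [pow_succ', map_mul]
    · rw [← map_mul]
      have h2 : pderiv i (psum (Fin N) ℂ 2) = 2 * X i := by
        simp [psum, pderiv_X, Pi.single_apply]
      congr 1
      rw [h2, pow_succ, pow_succ, map_mul, map_neg]
      simp only [map_ofNat]
      ring

/-- The radial part of multiplication by `tr Xᵏ`. -/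
lemma IsInvariant.radial_tracePow {φ : MatPoly N →ₗ[ℂ] ℂ} (hφ : IsInvariant φ) (k : ℕ)
    (h : MvPolynomial (Fin N) ℂ) :
    φ (tracePow N k * diagIncl N (diffOp (vdmPoly N) h)) =
      φ (diagIncl N (diffOp (vdmPoly N) (psum (Fin N) ℂ k * h))) := by
  have h1 := ((hasRadialPart_lmul_tracePow_two (N := N)).commutator_iterate
    (hasRadialPart_diffOp_tracePow k) k).apply_eq φ hφ h
  have h2 := HasTopCommutator.sum Finset.univ fun i _ => hasTopCommutator_pow_apply (N := N) k i i
  have h3 := HasTopCommutator.sum Finset.univ fun i _ => hasTopCommutator_X_pow (N := N) k i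
  simp only [← map_sum, ← Finset.mul_sum] at h2 h3
  have h4 : tracePow N k = ∑ i, (mvPolynomialX (Fin N) (Fin N) ℂ ^ k) i i := rfl
  have h5 : psum (Fin N) ℂ k = ∑ i, X i ^ k := rfl
  rw [← h4] at h2
  rw [← h5] at h3
  rw [h2.1, h3.1] at h1
  simp only [LinearMap.smul_apply, map_nsmul, lmul_apply, C_mul', map_smul] at h1
  have hne : ((k.factorial : ℂ) * (-2) ^ k) ≠ 0 :=
    mul_ne_zero (Nat.cast_ne_zero.mpr k.factorial_ne_zero) (pow_ne_zero _ (by norm_num))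
  simp only [nsmul_eq_mul, smul_eq_mul, ← mul_assoc] at h1
  exact mul_left_cancel₀ hne h1

end InvariantFunctionals

section Orbital

variable {N : ℕ}

/-- The algebraic properties of integration over the conjugation orbit of `diag y`. -/
structure IsOrbital (y : Fin N → ℂ) (φ : MatPoly N →ₗ[ℂ] ℂ) : Prop where
  isInvariant : IsInvariant φ
  tracePow_mul : ∀ k P, φ (tracePow N k * P) = (∑ i, y i ^ k) * φ P
  map_rename : ∀ (w : Equiv.Perm (Fin N)) g, φ (diagIncl N (rename w g)) = φ (diagIncl N g)
  map_one : φ 1 = 1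

/-- The functional `h ↦ φ (V(∂) h)` on polynomials in the diagonal entries. -/
noncomputable def vdmFunctional (φ : MatPoly N →ₗ[ℂ] ℂ) : MvPolynomial (Fin N) ℂ →ₗ[ℂ] ℂ :=
  φ ∘ₗ (diagIncl N).toLinearMap ∘ₗ diffOp (vdmPoly N)

lemma vdmFunctional_apply (φ : MatPoly N →ₗ[ℂ] ℂ) (h : MvPolynomial (Fin N) ℂ) :
    vdmFunctional φ h = φ (diagIncl N (diffOp (vdmPoly N) h)) := rfl

/-- The polynomials by which multiplication acts on a functional as evaluation at `y`. -/
noncomputable def evalSubalgebra (y : Fin N → ℂ) (ℓ : MvPolynomial (Fin N) ℂ →ₗ[ℂ] ℂ) :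
    Subalgebra ℂ (MvPolynomial (Fin N) ℂ) where
  carrier := {s | ∀ h, ℓ (s * h) = eval y s * ℓ h}
  mul_mem' {s t} hs ht h := by rw [mul_assoc, hs, ht, map_mul, mul_assoc]
  add_mem' {s t} hs ht h := by rw [add_mul, map_add, hs, ht, map_add, add_mul]
  algebraMap_mem' a h := by
    rw [MvPolynomial.algebraMap_eq, C_mul', LinearMap.map_smul, eval_C, smul_eq_mul]

lemma esymm_mem_of_psum_mem (S : Subalgebra ℂ (MvPolynomial (Fin N) ℂ))
    (hS : ∀ k, psum (Fin N) ℂ k ∈ S) (k : ℕ) : esymm (Fin N) ℂ k ∈ S := by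
  induction k using Nat.strong_induction_on with
  | _ k ih =>
    rcases Nat.eq_zero_or_pos k with rfl | hk
    · rw [esymm_zero]; exact S.one_mem
    have hneg : (-1 : MvPolynomial (Fin N) ℂ) ∈ S := S.neg_mem S.one_mem
    have h1 : (k : MvPolynomial (Fin N) ℂ) * esymm (Fin N) ℂ k ∈ S := by
      rw [mul_esymm_eq_sum]
      refine S.mul_mem (S.pow_mem hneg _) (S.sum_mem fun a ha => ?_)
      exact S.mul_mem (S.mul_mem (S.pow_mem hneg _) (ih _ (Finset.mem_filter.mp ha).2)) (hS _)
    have h2 : esymm (Fin N) ℂ k =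
        (k : ℂ)⁻¹ • ((k : MvPolynomial (Fin N) ℂ) * esymm (Fin N) ℂ k) := by
      rw [← nsmul_eq_mul, ← Nat.cast_smul_eq_nsmul ℂ, smul_smul,
        inv_mul_cancel₀ (Nat.cast_ne_zero.mpr hk.ne'), one_smul]
    rw [h2]
    exact S.smul_mem h1 _

lemma isSymmetric_mem_of_psum_mem (S : Subalgebra ℂ (MvPolynomial (Fin N) ℂ))
    (hS : ∀ k, psum (Fin N) ℂ k ∈ S) {s : MvPolynomial (Fin N) ℂ} (hs : s.IsSymmetric) :
    s ∈ S := by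
  obtain ⟨q, hq⟩ := esymmAlgHom_fin_surjective ℂ (le_refl N) ⟨s, hs⟩
  have hq' : s = aeval (fun i : Fin N => esymm (Fin N) ℂ (i + 1)) q := by
    rw [← esymmAlgHom_apply, hq]
  rw [hq']
  clear hq hq' hs
  induction q using MvPolynomial.induction_on with
  | C a => rw [aeval_C]; exact S.algebraMap_mem a
  | add p q hp hq => rw [map_add]; exact S.add_mem hp hq
  | mul_X p i hp =>
    rw [map_mul, aeval_X]
    exact S.mul_mem hp (esymm_mem_of_psum_mem S hS _)

lemma IsOrbital.vdmFunctional_symm_mul {y : Fin N → ℂ} {φ : MatPoly N →ₗ[ℂ] ℂ}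
    (hφ : IsOrbital y φ) {s : MvPolynomial (Fin N) ℂ} (hs : s.IsSymmetric)
    (h : MvPolynomial (Fin N) ℂ) :
    vdmFunctional φ (s * h) = eval y s * vdmFunctional φ h := by
  refine isSymmetric_mem_of_psum_mem (evalSubalgebra y (vdmFunctional φ)) (fun k h => ?_) hs h
  rw [vdmFunctional_apply, ← hφ.isInvariant.radial_tracePow, hφ.tracePow_mul,
    vdmFunctional_apply]
  simp [psum]

lemma IsOrbital.vdmFunctional_rename {y : Fin N → ℂ} {φ : MatPoly N →ₗ[ℂ] ℂ}
    (hφ : IsOrbital y φ) (w : Equiv.Perm (Fin N)) (h : MvPolynomial (Fin N) ℂ) :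
    vdmFunctional φ (rename w h) = ((Equiv.Perm.sign w : ℤ) : ℂ) * vdmFunctional φ h := by
  have hs : ((Equiv.Perm.sign w : ℤ) : ℂ) * ((Equiv.Perm.sign w : ℤ) : ℂ) = 1 := by
    rcases Int.units_eq_one_or (Equiv.Perm.sign w) with h | h <;> simp [h]
  have h1 : vdmPoly N = ((Equiv.Perm.sign w : ℤ) : ℂ) • rename w (vdmPoly N) := by
    rw [rename_vdmPoly, smul_smul, hs, one_smul]
  rw [vdmFunctional_apply, vdmFunctional_apply]
  nth_rw 1 [h1]
  rw [map_smul, LinearMap.smul_apply, diffOp_rename, map_smul, map_smul, hφ.map_rename,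
    smul_eq_mul]

/-- The alternating sum over permutations of the variables. -/
noncomputable def altSum (h : MvPolynomial (Fin N) ℂ) : MvPolynomial (Fin N) ℂ :=
  ∑ w : Equiv.Perm (Fin N), ((Equiv.Perm.sign w : ℤ) : ℂ) • rename w h

lemma isAlternating_altSum (h : MvPolynomial (Fin N) ℂ) : IsAlternating (altSum h) := by
  intro v
  rw [altSum, map_sum, Finset.smul_sum,
    ← Equiv.sum_comp (Equiv.mulLeft v) (fun w => ((Equiv.Perm.sign v : ℤ) : ℂ) •
    ((Equiv.Perm.sign w : ℤ) : ℂ) • rename w h)]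
  refine Finset.sum_congr rfl fun w _ => ?_
  have hs : ((Equiv.Perm.sign v : ℤ) : ℂ) * ((Equiv.Perm.sign v : ℤ) : ℂ) = 1 := by
    rcases Int.units_eq_one_or (Equiv.Perm.sign v) with h | h <;> simp [h]
  rw [map_smul, rename_rename, smul_smul, Equiv.coe_mulLeft, Equiv.Perm.sign_mul, Units.val_mul,
    Int.cast_mul, ← mul_assoc, hs, one_mul, Equiv.Perm.coe_mul]

lemma IsOrbital.eval_vdmPoly_mul_vdmFunctional {y : Fin N → ℂ} {φ : MatPoly N →ₗ[ℂ] ℂ}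
    (hφ : IsOrbital y φ) (h : MvPolynomial (Fin N) ℂ) :
    eval y (vdmPoly N) * (N.factorial * vdmFunctional φ h) = vdmFunctional φ (vdmPoly N) *
      ∑ w : Equiv.Perm (Fin N), ((Equiv.Perm.sign w : ℤ) : ℂ) * eval (y ∘ w) h := by
  obtain ⟨s, hs, hsum⟩ := (isAlternating_altSum h).exists_eq_vdmPoly_mul
  have h1 : vdmFunctional φ (altSum h) = N.factorial * vdmFunctional φ h := by
    have : ∀ w : Equiv.Perm (Fin N),
        vdmFunctional φ (((Equiv.Perm.sign w : ℤ) : ℂ) • rename w h) = vdmFunctional φ h := by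
      intro w
      rw [map_smul, hφ.vdmFunctional_rename, smul_eq_mul, ← mul_assoc]
      rcases Int.units_eq_one_or (Equiv.Perm.sign w) with h | h <;> simp [h]
    simp [altSum, map_sum, this, Finset.card_univ, Fintype.card_perm]
  have h2 : eval y (altSum h) =
      ∑ w : Equiv.Perm (Fin N), ((Equiv.Perm.sign w : ℤ) : ℂ) * eval (y ∘ w) h := by
    simp [altSum, map_sum, smul_eval, eval_rename]
  rw [← h1, ← h2, hsum, mul_comm (vdmPoly N) s, hφ.vdmFunctional_symm_mul hs, map_mul]
  ring

/-- The constant polynomial `V(∂) V`, as a complex number. -/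
noncomputable def vdmConst (N : ℕ) : ℂ := coeff 0 (diffOp (vdmPoly N) (vdmPoly N))

lemma IsOrbital.vdmFunctional_vdmPoly {y : Fin N → ℂ} {φ : MatPoly N →ₗ[ℂ] ℂ}
    (hφ : IsOrbital y φ) : vdmFunctional φ (vdmPoly N) = vdmConst N := by
  have h := isHomogeneous_diffOp (isHomogeneous_vdmPoly (N := N)) isHomogeneous_vdmPoly
  rw [Nat.sub_self, ← totalDegree_zero_iff_isHomogeneous, totalDegree_eq_zero_iff_eq_C] at h
  rw [vdmFunctional_apply, h, ← vdmConst, ← MvPolynomial.algebraMap_eq, AlgHom.commutes,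
    Algebra.algebraMap_eq_smul_one, map_smul, hφ.map_one, smul_eq_mul, mul_one]

end Orbital

section Conjugation

variable {N : ℕ}

/-- Evaluation of a matrix polynomial at a matrix. -/
noncomputable def evalAt (B : Matrix (Fin N) (Fin N) ℂ) : MatPoly N →+* ℂ :=
  eval fun p => B p.1 p.2

/-- The substitution `X ↦ g X h`. -/
noncomputable def conjSubst (g h : Matrix (Fin N) (Fin N) ℂ) : MatPoly N →ₐ[ℂ] MatPoly N :=
  aeval fun p => ∑ b, ∑ a, C (g p.1 a * h b p.2) * X (a, b)

lemma evalAt_conjSubst (B g h : Matrix (Fin N) (Fin N) ℂ) (P : MatPoly N) :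
    evalAt B (conjSubst g h P) = evalAt (g * B * h) P := by
  induction P using MvPolynomial.induction_on with
  | C a => simp [evalAt, conjSubst]
  | add P Q hP hQ => simp [hP, hQ]
  | mul_X P p hP =>
    rw [map_mul, map_mul, hP, map_mul]
    congr 1
    simp only [conjSubst, evalAt, aeval_X, map_sum, map_mul, eval_C, eval_X, Matrix.mul_apply,
      Finset.sum_mul]
    exact Finset.sum_congr rfl fun b _ => Finset.sum_congr rfl fun a _ => by ring

lemma conjSubst_one (P : MatPoly N) : conjSubst 1 1 P = P := by
  have : conjSubst (1 : Matrix (Fin N) (Fin N) ℂ) 1 = AlgHom.id ℂ (MatPoly N) := by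
    apply MvPolynomial.algHom_ext
    intro p
    simp [conjSubst, Matrix.one_apply, ite_mul, apply_ite C]
  rw [this, AlgHom.id_apply]

lemma adDer_X_eq_sum (A : Matrix (Fin N) (Fin N) ℂ) (p : Fin N × Fin N) :
    adDer A (X p) = ∑ b, ∑ a, C (A p.1 a * (1 : Matrix (Fin N) (Fin N) ℂ) b p.2 +
      (1 : Matrix (Fin N) (Fin N) ℂ) p.1 a * (-A) b p.2) * X (a, b) := by
  rw [adDer_X]
  simp [Matrix.one_apply, add_mul, Finset.sum_add_distrib, apply_ite C, ite_mul, sub_eq_add_neg]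

/-- The infinitesimal conjugation action is the derivative of conjugation along a curve. -/
lemma hasDerivAt_conjSubst {A : Matrix (Fin N) (Fin N) ℂ} {g h : ℝ → Matrix (Fin N) (Fin N) ℂ}
    (hg : g 0 = 1) (hh : h 0 = 1) (hg' : ∀ i j, HasDerivAt (fun s => g s i j) (A i j) 0)
    (hh' : ∀ i j, HasDerivAt (fun s => h s i j) ((-A) i j) 0) (φ : MatPoly N →ₗ[ℂ] ℂ)
    (P : MatPoly N) :
    HasDerivAt (fun s => φ (conjSubst (g s) (h s) P)) (φ (adDer A P)) 0 := by
  induction P using MvPolynomial.induction_on generalizing φ with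
  | C a => simpa [conjSubst] using hasDerivAt_const (0 : ℝ) (φ (C a))
  | add P Q hP hQ => simpa using (hP φ).fun_add (hQ φ)
  | mul_X P p hP =>
    have h1 : ∀ s, φ (conjSubst (g s) (h s) (P * X p)) =
        ∑ b, ∑ a, g s p.1 a * h s b p.2 *
          (φ ∘ₗ LinearMap.mulRight ℂ (X (a, b))) (conjSubst (g s) (h s) P) := by
      intro s
      have : conjSubst (g s) (h s) (X p) =
          ∑ b, ∑ a, (g s p.1 a * h s b p.2) • (X (a, b) : MatPoly N) := by
        simp [conjSubst, smul_eq_C_mul]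
      rw [map_mul, this]
      simp only [Finset.mul_sum, map_sum, mul_smul_comm, map_smul, smul_eq_mul,
        LinearMap.comp_apply, LinearMap.mulRight_apply]
    have h2 := HasDerivAt.fun_sum (u := Finset.univ) fun b _ =>
      HasDerivAt.fun_sum (u := Finset.univ) fun a _ =>
        ((hg' p.1 a).mul (hh' b p.2)).mul (hP (φ ∘ₗ LinearMap.mulRight ℂ (X (a, b))))
    simp only [funext h1]
    refine h2.congr_deriv ?_
    simp only [Pi.mul_apply, hg, hh, conjSubst_one]
    have h3 : ∑ b, ∑ a, (1 : Matrix (Fin N) (Fin N) ℂ) p.1 a *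
        (1 : Matrix (Fin N) (Fin N) ℂ) b p.2 *
          (φ ∘ₗ LinearMap.mulRight ℂ (X (a, b))) (adDer A P) = φ (adDer A P * X p) := by
      simp [Matrix.one_apply]
    have h4 : φ (P * adDer A (X p)) = ∑ b, ∑ a,
        (A p.1 a * (1 : Matrix (Fin N) (Fin N) ℂ) b p.2 +
          (1 : Matrix (Fin N) (Fin N) ℂ) p.1 a * (-A) b p.2) *
            (φ ∘ₗ LinearMap.mulRight ℂ (X (a, b))) P := by
      rw [adDer_X_eq_sum]
      simp only [C_mul', Finset.mul_sum, map_sum, mul_smul_comm, map_smul, smul_eq_mul,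
        LinearMap.comp_apply, LinearMap.mulRight_apply]
    rw [Derivation.leibniz, map_add, smul_eq_mul, smul_eq_mul, h4, mul_comm (X p), ← h3]
    simp only [Finset.sum_add_distrib]

lemma adDer_add_smul (S T : Matrix (Fin N) (Fin N) ℂ) (c : ℂ) :
    adDer (S + c • T) = adDer S + c • adDer T := by
  apply MvPolynomial.derivation_ext
  intro p
  simp only [adDer_X, Derivation.add_apply, Derivation.smul_apply, Matrix.add_apply,
    Matrix.smul_apply, smul_eq_mul, map_add, map_mul, add_mul, Finset.sum_add_distrib,
    smul_eq_C_mul, mul_sub, Finset.mul_sum, mul_assoc]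
  ring

open scoped Matrix.Norms.Operator in
lemma hasDerivAt_exp_smul_apply (A : Matrix (Fin N) (Fin N) ℂ) (i j : Fin N) :
    HasDerivAt (fun s : ℝ => NormedSpace.exp (s • A) i j) (A i j) 0 := by
  have h := hasDerivAt_exp_smul_const (𝕂 := ℝ) A 0
  rw [zero_smul, NormedSpace.exp_zero, one_mul] at h
  exact hasDerivAt_pi.mp (hasDerivAt_pi.mp h i) j

lemma exp_smul_mem_unitaryGroup {A : Matrix (Fin N) (Fin N) ℂ} (hA : Aᴴ = -A) (s : ℝ) :
    NormedSpace.exp (s • A) ∈ Matrix.unitaryGroup (Fin N) ℂ ∧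
      star (NormedSpace.exp (s • A)) = NormedSpace.exp (s • -A) := by
  have h1 : star (NormedSpace.exp (s • A)) = NormedSpace.exp (s • -A) := by
    rw [Matrix.star_eq_conjTranspose, ← Matrix.exp_conjTranspose, Matrix.conjTranspose_smul, hA]
    simp
  refine ⟨?_, h1⟩
  rw [Matrix.mem_unitaryGroup_iff, h1,
    ← Matrix.exp_add_of_commute _ _ (((Commute.refl A).neg_right.smul_left s).smul_right s)]
  simp

/-- A functional invariant under unitary conjugation is infinitesimally invariant. -/
lemma isInvariant_of_unitary {φ : MatPoly N →ₗ[ℂ] ℂ}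
    (hφ : ∀ (g : Matrix.unitaryGroup (Fin N) ℂ) P,
      φ (conjSubst (g : Matrix (Fin N) (Fin N) ℂ) (star (g : Matrix (Fin N) (Fin N) ℂ)) P) = φ P) :
    IsInvariant φ := by
  have hskew : ∀ A : Matrix (Fin N) (Fin N) ℂ, Aᴴ = -A → ∀ P, φ (adDer A P) = 0 := by
    intro A hA P
    have h1 := hasDerivAt_conjSubst (g := fun s => NormedSpace.exp (s • A))
      (h := fun s => NormedSpace.exp (s • -A)) (by simp) (by simp)
      (hasDerivAt_exp_smul_apply A) (hasDerivAt_exp_smul_apply (-A)) φ P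
    have h2 : ∀ s : ℝ, φ (conjSubst (NormedSpace.exp (s • A)) (NormedSpace.exp (s • -A)) P) =
        φ P := by
      intro s
      obtain ⟨hs, hs'⟩ := exp_smul_mem_unitaryGroup hA s
      rw [← hs']
      exact hφ ⟨_, hs⟩ P
    simp only [h2] at h1
    exact h1.unique (hasDerivAt_const _ _)
  intro A P
  have hA : A = (1 / 2 : ℂ) • (A - Aᴴ) + Complex.I • ((-Complex.I / 2) • (A + Aᴴ)) := by
    rw [smul_smul]
    have : Complex.I * (-Complex.I / 2) = 1 / 2 := by
      linear_combination (-1 / 2 : ℂ) * Complex.I_mul_I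
    rw [this]
    module
  rw [hA, adDer_add_smul, Derivation.add_apply, Derivation.smul_apply, map_add, map_smul,
    hskew _ _ P, hskew _ _ P, smul_zero, add_zero]
  · simp [Matrix.conjTranspose_smul, ← smul_neg, add_comm, neg_div]
  · simp [Matrix.conjTranspose_smul, ← smul_neg]

end Conjugation

section ExponentialSeries

variable {N : ℕ}

/-- The degree `j` part of the Taylor series of `exp (∑ zᵢ xᵢ)`. -/
noncomputable def expTerm (z : Fin N → ℂ) (j : ℕ) : MvPolynomial (Fin N) ℂ :=
  C ((j.factorial : ℂ)⁻¹) * (∑ i, C (z i) * X i) ^ j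

lemma eval_expTerm (z y : Fin N → ℂ) (j : ℕ) :
    eval y (expTerm z j) = (∑ i, z i * y i) ^ j / j.factorial := by
  simp [expTerm, div_eq_inv_mul]

lemma pderiv_expTerm_zero (z : Fin N → ℂ) (i : Fin N) : pderiv i (expTerm z 0) = 0 := by
  simp [expTerm]

lemma pderiv_expTerm_succ (z : Fin N → ℂ) (i : Fin N) (j : ℕ) :
    pderiv i (expTerm z (j + 1)) = z i • expTerm z j := by
  have h1 : pderiv i (∑ k, C (z k) * X k : MvPolynomial (Fin N) ℂ) = C (z i) := by
    simp [pderiv_X, Pi.single_apply]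
  have h2 : C (((j + 1).factorial : ℂ)⁻¹) * ((j + 1 : ℕ) : MvPolynomial (Fin N) ℂ) =
      C ((j.factorial : ℂ)⁻¹) := by
    rw [← map_natCast (C : ℂ →+* MvPolynomial (Fin N) ℂ), ← map_mul]
    congr 1
    rw [Nat.factorial_succ]
    push_cast
    field_simp
  rw [expTerm, expTerm, Derivation.leibniz, pderiv_C, smul_zero, add_zero, Derivation.leibniz_pow,
    h1, Nat.add_sub_cancel, smul_eq_mul, smul_eq_mul, nsmul_eq_mul, ← mul_assoc, h2,
    smul_eq_C_mul]
  ring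

lemma hasSum_diffOp_expTerm {φ : MatPoly N →ₗ[ℂ] ℂ} {z : Fin N → ℂ} {F : ℂ}
    (hF : HasSum (fun j => φ (diagIncl N (expTerm z j))) F) (P : MvPolynomial (Fin N) ℂ) :
    HasSum (fun j => φ (diagIncl N (diffOp P (expTerm z j)))) (eval z P * F) := by
  induction P using MvPolynomial.induction_on with
  | C a => simpa [diffOp_C] using hF.mul_left a
  | add P Q hP hQ => simpa [add_mul] using hP.add hQ
  | mul_X P i hP =>
    rw [← hasSum_nat_add_iff' 1]
    have h : ∀ j, φ (diagIncl N (diffOp (P * X i) (expTerm z (j + 1)))) =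
        z i * φ (diagIncl N (diffOp P (expTerm z j))) := by
      intro j
      rw [diffOp_mul, diffOp_X, pderiv_expTerm_succ, map_smul, map_smul, map_smul, smul_eq_mul]
    have h0 : φ (diagIncl N (diffOp (P * X i) (expTerm z 0))) = 0 := by
      rw [diffOp_mul, diffOp_X, pderiv_expTerm_zero, map_zero, map_zero, map_zero]
    have h2 : eval z (P * X i) * F = z i * (eval z P * F) := by
      rw [map_mul, eval_X]; ring
    rw [Finset.sum_range_one, h0, sub_zero, h2]
    simpa only [h] using hP.mul_left (z i)

lemma IsOrbital.exp_formula {y z : Fin N → ℂ} {φ : MatPoly N →ₗ[ℂ] ℂ} (hφ : IsOrbital y φ) {F : ℂ}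
    (hF : HasSum (fun j => φ (diagIncl N (expTerm z j))) F) :
    eval y (vdmPoly N) * (N.factorial * (eval z (vdmPoly N) * F)) = vdmConst N *
      ∑ w : Equiv.Perm (Fin N), ((Equiv.Perm.sign w : ℤ) : ℂ) *
        Complex.exp (∑ i, z i * y (w i)) := by
  have h1 := ((hasSum_diffOp_expTerm hF (vdmPoly N)).mul_left (N.factorial : ℂ)).mul_left
    (eval y (vdmPoly N))
  have h2 : HasSum (fun j => vdmConst N * ∑ w : Equiv.Perm (Fin N),
      ((Equiv.Perm.sign w : ℤ) : ℂ) * ((∑ i, z i * y (w i)) ^ j / j.factorial))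
      (vdmConst N * ∑ w : Equiv.Perm (Fin N), ((Equiv.Perm.sign w : ℤ) : ℂ) *
        Complex.exp (∑ i, z i * y (w i))) := by
    refine (hasSum_sum fun w _ => HasSum.mul_left _ ?_).mul_left _
    rw [Complex.exp_eq_exp_ℂ]
    exact NormedSpace.expSeries_div_hasSum_exp _
  simp only [← vdmFunctional_apply, hφ.eval_vdmPoly_mul_vdmFunctional,
    hφ.vdmFunctional_vdmPoly, eval_expTerm, Function.comp_apply] at h1
  exact h1.unique h2

end ExponentialSeries

section UnitaryIntegral

variable {N : ℕ}

lemma compactSpace_unitaryGroup : CompactSpace (Matrix.unitaryGroup (Fin N) ℂ) := by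
  have h : IsCompact (Set.univ.pi fun _ : Fin N => Set.univ.pi fun _ : Fin N =>
      Metric.closedBall (0 : ℂ) 1) :=
    isCompact_univ_pi fun _ => isCompact_univ_pi fun _ => isCompact_closedBall _ _
  refine isCompact_iff_compactSpace.mp
    (h.of_isClosed_subset (isClosed_unitary (R := Matrix (Fin N) (Fin N) ℂ)) ?_)
  intro U hU i _ j _
  simpa using entry_norm_bound_of_unitary hU i j

/-- The point `U diag(y) U⁻¹` of the conjugation orbit of `diag y`. -/
def orbitPoint (y : Fin N → ℂ) (U : Matrix.unitaryGroup (Fin N) ℂ) : Matrix (Fin N) (Fin N) ℂ :=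
  (U : Matrix (Fin N) (Fin N) ℂ) * Matrix.diagonal y * star (U : Matrix (Fin N) (Fin N) ℂ)

lemma orbitPoint_mul (y : Fin N → ℂ) (g U : Matrix.unitaryGroup (Fin N) ℂ) :
    orbitPoint y (g * U) = (g : Matrix (Fin N) (Fin N) ℂ) * orbitPoint y U *
      star (g : Matrix (Fin N) (Fin N) ℂ) := by
  simp [orbitPoint, mul_assoc]

lemma continuous_orbitPoint (y : Fin N → ℂ) : Continuous (orbitPoint y) := by
  unfold orbitPoint
  fun_prop

lemma continuous_evalAt_orbitPoint (y : Fin N → ℂ) (P : MatPoly N) :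
    Continuous fun U => evalAt (orbitPoint y U) P := by
  have h : Continuous fun U : Matrix.unitaryGroup (Fin N) ℂ =>
      (fun p : Fin N × Fin N => orbitPoint y U p.1 p.2) :=
    continuous_pi fun p => (continuous_orbitPoint y).matrix_elem p.1 p.2
  exact (MvPolynomial.continuous_eval P).comp h

lemma evalAt_orbitPoint_tracePow (y : Fin N → ℂ) (U : Matrix.unitaryGroup (Fin N) ℂ) (k : ℕ) :
    evalAt (orbitPoint y U) (tracePow N k) = ∑ i, y i ^ k := by
  have h1 : ∀ B : Matrix (Fin N) (Fin N) ℂ, evalAt B (tracePow N k) = (B ^ k).trace := by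
    intro B
    have h : (evalAt B).mapMatrix (mvPolynomialX (Fin N) (Fin N) ℂ) = B := by
      ext1 i j
      simp [evalAt]
    have h2 : evalAt B (tracePow N k) =
        ((evalAt B).mapMatrix (mvPolynomialX (Fin N) (Fin N) ℂ ^ k)).trace := by
      simp [tracePow, Matrix.trace]
    rw [h2, map_pow, h]
  have hU : star (U : Matrix (Fin N) (Fin N) ℂ) * U = 1 := Matrix.UnitaryGroup.star_mul_self U
  have h2 : orbitPoint y U ^ k = (U : Matrix (Fin N) (Fin N) ℂ) * Matrix.diagonal y ^ k *
      star (U : Matrix (Fin N) (Fin N) ℂ) := by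
    clear h1
    induction k with
    | zero => simp
    | succ k ih =>
      rw [pow_succ, ih, orbitPoint, pow_succ]
      simp only [mul_assoc]
      rw [← mul_assoc (star (U : Matrix (Fin N) (Fin N) ℂ)) U, hU, one_mul]
  rw [h1, h2, Matrix.trace_mul_comm, ← mul_assoc, hU, one_mul, Matrix.diagonal_pow,
    Matrix.trace_diagonal]
  rfl

lemma evalAt_diagIncl (B : Matrix (Fin N) (Fin N) ℂ) (g : MvPolynomial (Fin N) ℂ) :
    evalAt B (diagIncl N g) = eval (fun i => B i i) g := by
  simp [evalAt, diagIncl, eval_rename, Function.comp_def]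

/-- A permutation matrix as a unitary matrix. -/
def permUnitary (w : Equiv.Perm (Fin N)) : Matrix.unitaryGroup (Fin N) ℂ :=
  ⟨w.permMatrix ℂ, by
    rw [Matrix.mem_unitaryGroup_iff, Matrix.star_eq_conjTranspose,
      Matrix.conjTranspose_permMatrix, ← Matrix.permMatrix_mul, inv_mul_cancel,
      Matrix.permMatrix_one]⟩

lemma permUnitary_conj_apply_self (w : Equiv.Perm (Fin N)) (B : Matrix (Fin N) (Fin N) ℂ)
    (i : Fin N) :
    ((permUnitary w : Matrix (Fin N) (Fin N) ℂ) * B *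
      star (permUnitary w : Matrix (Fin N) (Fin N) ℂ)) i i = B (w i) (w i) := by
  simp [permUnitary, Matrix.mul_apply, Equiv.Perm.permMatrix, PEquiv.toMatrix_apply,
    Matrix.star_apply]

variable [MeasurableSpace (Matrix.unitaryGroup (Fin N) ℂ)]
  [BorelSpace (Matrix.unitaryGroup (Fin N) ℂ)] (μ : Measure (Matrix.unitaryGroup (Fin N) ℂ))
  [μ.IsHaarMeasure]

lemma integrable_of_continuous {f : Matrix.unitaryGroup (Fin N) ℂ → ℂ} (hf : Continuous f) :
    Integrable f μ := by
  have := compactSpace_unitaryGroup (N := N)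
  rw [← integrableOn_univ]
  exact hf.continuousOn.integrableOn_compact isCompact_univ

/-- Integration over the conjugation orbit of `diag y`. -/
noncomputable def orbitIntegral (y : Fin N → ℂ) : MatPoly N →ₗ[ℂ] ℂ where
  toFun P := ∫ U, evalAt (orbitPoint y U) P ∂μ
  map_add' P Q := by
    simp only [map_add]
    exact integral_add (integrable_of_continuous μ (continuous_evalAt_orbitPoint y P))
      (integrable_of_continuous μ (continuous_evalAt_orbitPoint y Q))
  map_smul' a P := by
    simp only [smul_eq_C_mul, map_mul]
    have : ∀ B : Matrix (Fin N) (Fin N) ℂ, evalAt B (C a) = a := fun B => by simp [evalAt]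
    simp only [this, RingHom.id_apply, smul_eq_mul]
    exact integral_const_mul _ _

lemma orbitIntegral_apply (y : Fin N → ℂ) (P : MatPoly N) :
    orbitIntegral μ y P = ∫ U, evalAt (orbitPoint y U) P ∂μ := rfl

lemma orbitIntegral_conjSubst (y : Fin N → ℂ) (g : Matrix.unitaryGroup (Fin N) ℂ)
    (P : MatPoly N) :
    orbitIntegral μ y (conjSubst (g : Matrix (Fin N) (Fin N) ℂ)
      (star (g : Matrix (Fin N) (Fin N) ℂ)) P) = orbitIntegral μ y P := by
  rw [orbitIntegral_apply, orbitIntegral_apply]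
  simp only [evalAt_conjSubst, ← orbitPoint_mul]
  exact integral_mul_left_eq_self (fun U => evalAt (orbitPoint y U) P) g

variable [IsProbabilityMeasure μ]

lemma isOrbital_orbitIntegral (y : Fin N → ℂ) : IsOrbital y (orbitIntegral μ y) where
  isInvariant := isInvariant_of_unitary (orbitIntegral_conjSubst μ y)
  tracePow_mul k P := by
    simp only [orbitIntegral_apply, map_mul, evalAt_orbitPoint_tracePow]
    exact integral_const_mul _ _
  map_rename w g := by
    rw [← orbitIntegral_conjSubst μ y (permUnitary w) (diagIncl N g)]
    simp only [orbitIntegral_apply, evalAt_conjSubst, evalAt_diagIncl,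
      permUnitary_conj_apply_self, eval_rename, Function.comp_def]
  map_one := by simp [orbitIntegral_apply]

lemma hasSum_orbitIntegral_expTerm (y z : Fin N → ℂ) :
    HasSum (fun j => orbitIntegral μ y (diagIncl N (expTerm z j)))
      (∫ U, Complex.exp (∑ i, z i * orbitPoint y U i i) ∂μ) := by
  have := compactSpace_unitaryGroup (N := N)
  have hc : Continuous fun U => ∑ i, z i * orbitPoint y U i i :=
    continuous_finsetSum _ fun i _ =>
      continuous_const.mul ((continuous_orbitPoint y).matrix_elem i i)
  obtain ⟨M, hM⟩ := isCompact_univ.exists_bound_of_continuousOn hc.continuousOn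
  simp only [orbitIntegral_apply, evalAt_diagIncl, eval_expTerm]
  refine hasSum_integral_of_dominated_convergence (fun j _ => M ^ j / j.factorial)
    (fun j => ((hc.pow j).div_const _).aestronglyMeasurable) (fun j => ?_) ?_ ?_ ?_
  · refine Filter.Eventually.of_forall fun U => ?_
    rw [norm_div, norm_pow, Complex.norm_natCast]
    gcongr
    exact hM U trivial
  · exact Filter.Eventually.of_forall fun _ => Real.summable_pow_div_factorial M
  · exact integrable_const _
  · refine Filter.Eventually.of_forall fun U => ?_
    rw [Complex.exp_eq_exp_ℂ]
    exact NormedSpace.expSeries_div_hasSum_exp _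

end UnitaryIntegral

lemma vdm_ne_zero {N : ℕ} {z : Fin N → ℝ} (hz : Function.Injective z) : vdm N z ≠ 0 :=
  Finset.prod_ne_zero_iff.mpr fun _ _ => Finset.prod_ne_zero_iff.mpr fun _ hj =>
    sub_ne_zero.mpr fun h => (Finset.mem_Ioi.mp hj).ne' (hz h)

lemma vdm_const_mul (N : ℕ) (c : ℝ) (z : Fin N → ℝ) :
    vdm N (fun i => c * z i) = c ^ (vdmPairs N).card * vdm N z := by
  have h : ∀ z : Fin N → ℝ, vdm N z = ∏ p ∈ vdmPairs N, (z p.2 - z p.1) := by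
    intro z
    rw [vdm, Finset.prod_sigma']
    refine Finset.prod_bij' (fun q _ => (q.1, q.2)) (fun p _ => ⟨p.1, p.2⟩) ?_ ?_ ?_ ?_ ?_ <;>
      simp [vdmPairs]
  rw [h, h, ← Finset.prod_const, ← Finset.prod_mul_distrib]
  exact Finset.prod_congr rfl fun p _ => (mul_sub _ _ _).symm

lemma const_mul_trace_eq {N : ℕ} (c : ℂ) (x y : Fin N → ℂ) (U : Matrix.unitaryGroup (Fin N) ℂ) :
    c * (Matrix.diagonal x * (U : Matrix (Fin N) (Fin N) ℂ) * Matrix.diagonal y *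
      ((U⁻¹ : Matrix.unitaryGroup (Fin N) ℂ) : Matrix (Fin N) (Fin N) ℂ)).trace =
      ∑ i, x i * orbitPoint (fun i => c * y i) U i i := by
  have h1 : Matrix.diagonal x * (U : Matrix (Fin N) (Fin N) ℂ) * Matrix.diagonal y *
      ((U⁻¹ : Matrix.unitaryGroup (Fin N) ℂ) : Matrix (Fin N) (Fin N) ℂ) =
      Matrix.diagonal x * orbitPoint y U := by
    simp [orbitPoint, mul_assoc]
  have h2 : orbitPoint (fun i => c * y i) U = c • orbitPoint y U := by
    have : Matrix.diagonal (fun i => c * y i) = c • Matrix.diagonal y := by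
      rw [← Matrix.diagonal_smul]; rfl
    rw [orbitPoint, this, orbitPoint, Matrix.mul_smul, Matrix.smul_mul]
  rw [h1, h2, Matrix.trace, Finset.mul_sum]
  refine Finset.sum_congr rfl fun i _ => ?_
  rw [Matrix.diag_apply, Matrix.diagonal_mul, Matrix.smul_apply, smul_eq_mul]
  ring

end HarishChandra

/-- (Harish-Chandra/Itzykson–Zuber formula over `U(N)`.)
For `N ≥ 1` and `c ≠ 0` there is a constant `k_N(c)` such that for all real diagonal
matrices `X = diag(x)`, `Y = diag(y)` with pairwise distinct entries,
`∫_{U(N)} e^{c·tr(X U Y U⁻¹)} dU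
  = k_N(c) · [Σ_{w∈S_N} sgn(w) e^{c Σ_i x_i y_{w(i)}}] / (V(x) V(y))`,
the integral being over the normalized Haar probability measure on the (Borel) compact
unitary group `U(N)`. -/
theorem harish_chandra_itzykson_zuber (N : ℕ) (hN : 1 ≤ N) (c : ℝ) (hc : c ≠ 0) :
    ∃ kN : ℂ,
      ∀ (inst : MeasurableSpace (Matrix.unitaryGroup (Fin N) ℂ)),
        @BorelSpace (Matrix.unitaryGroup (Fin N) ℂ) _ inst →
        ∀ (μ : @Measure (Matrix.unitaryGroup (Fin N) ℂ) inst),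
          @Measure.IsHaarMeasure (Matrix.unitaryGroup (Fin N) ℂ) _ _ inst μ →
          @IsProbabilityMeasure (Matrix.unitaryGroup (Fin N) ℂ) inst μ →
          ∀ x y : Fin N → ℝ, Function.Injective x → Function.Injective y →
            (∫ U, Complex.exp ((c : ℂ) *
                ((Matrix.diagonal fun i => (x i : ℂ)) * (U : Matrix (Fin N) (Fin N) ℂ) *
                  (Matrix.diagonal fun i => (y i : ℂ)) *
                  ((U⁻¹ : Matrix.unitaryGroup (Fin N) ℂ) : Matrix (Fin N) (Fin N) ℂ)).trace) ∂μ)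
            = kN *
                (∑ w : Equiv.Perm (Fin N), ((Equiv.Perm.sign w : ℤ) : ℂ) *
                  Complex.exp ((c : ℂ) * ∑ i, (x i : ℂ) * (y (w i) : ℂ))) /
                ((vdm N x : ℂ) * (vdm N y : ℂ)) := by
  refine ⟨HarishChandra.vdmConst N /
    ((N.factorial : ℂ) * (c : ℂ) ^ (HarishChandra.vdmPairs N).card), ?_⟩
  intro inst hB μ hμ hμ1 x y hx hy
  have h := (HarishChandra.isOrbital_orbitIntegral μ fun i => ((c * y i : ℝ) : ℂ)).exp_formula
    (HarishChandra.hasSum_orbitIntegral_expTerm μ _ fun i => (x i : ℂ))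
  rw [HarishChandra.eval_vdmPoly, HarishChandra.eval_vdmPoly, HarishChandra.vdm_const_mul] at h
  simp only [HarishChandra.const_mul_trace_eq]
  push_cast at h
  have hsum : ∀ w : Equiv.Perm (Fin N), ∑ i, (x i : ℂ) * ((c : ℂ) * (y (w i) : ℂ)) =
      (c : ℂ) * ∑ i, (x i : ℂ) * (y (w i) : ℂ) := by
    intro w
    rw [Finset.mul_sum]
    exact Finset.sum_congr rfl fun i _ => by ring
  simp only [hsum] at h
  have hx0 : (vdm N x : ℂ) ≠ 0 := Complex.ofReal_ne_zero.mpr (HarishChandra.vdm_ne_zero hx)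
  have hy0 : (vdm N y : ℂ) ≠ 0 := Complex.ofReal_ne_zero.mpr (HarishChandra.vdm_ne_zero hy)
  have hc0 : (c : ℂ) ≠ 0 := Complex.ofReal_ne_zero.mpr hc
  have hN0 : (N.factorial : ℂ) ≠ 0 := Nat.cast_ne_zero.mpr N.factorial_ne_zero
  rw [eq_div_iff (mul_ne_zero hx0 hy0), div_mul_eq_mul_div,
    eq_div_iff (mul_ne_zero hN0 (pow_ne_zero _ hc0)), ← h]
  ring
end

section
/- Let N ≥ 1. There exists a constant c_N ∈ ℂ, depending only on N, with the following property. Let H_N denote the real vector space of N×N complex Hermitian matrices, equipped with the Lebesgue measure dX obtained by identifying a Hermitian matrix X with the real coordinates (X_{ii})_{1≤i≤N} and (Re X_{ij}, Im X_{ij})_{1≤i<j≤N}. Let Φ : H_N → ℂ be a measurable function invariant under unitary conjugation, and let Λ = diag(λ₁,…,λ_N) with λ₁,…,λ_N positive and pairwise distinct. Assume X ↦ Φ(X) e^{−(1/2) tr(ΛX²)} is integrable on H_N and the right-hand integrand below is integrable on ℝ^N. Then ∫_{H_N} Φ(X) e^{−(1/2) tr(ΛX²)} dX = c_N ∫_{ℝ^N}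 Φ(diag(D₁,…,D_N)) V(D) · [ Σ_{w ∈ S_N} sgn(w) exp(−(1/2) Σ_{i=1}^N λ_i D_{w(i)}²) ] / ( V(λ₁,…,λ_N) ∏_{1≤i<j≤N}(D_i + D_j) ) dD₁⋯dD_N, where V(z₁,…,z_N) = ∏_{1≤i<j≤N}(z_j − z_i) is the Vandermonde determinant (the right-hand integrand is defined off the null set where some D_i + D_j = 0). -/
open MeasureTheory Matrix

/-- The Hermitian `N×N` matrix with diagonal entries `v.1 i` and, for `i < j`, entry
`(i,j)` equal to `Re + Im·I` given by the pair `v.2 ⟨(i,j), _⟩`.  This identifies the real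
vector space `H_N` of Hermitian matrices with the coordinates `(X_{ii})_i`,
`(Re X_{ij}, Im X_{ij})_{i<j}`, and thereby endows `H_N` with Lebesgue measure. -/
noncomputable def hermMat (N : ℕ)
    (v : (Fin N → ℝ) × ({ p : Fin N × Fin N // p.1 < p.2 } → ℝ × ℝ)) :
    Matrix (Fin N) (Fin N) ℂ :=
  Matrix.of fun i j =>
    if h : i < j then ((v.2 ⟨(i, j), h⟩).1 : ℂ) + (v.2 ⟨(i, j), h⟩).2 * Complex.I
    else if h' : j < i then ((v.2 ⟨(j, i), h'⟩).1 : ℂ) - (v.2 ⟨(j, i), h'⟩).2 * Complex.I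
    else (v.1 i : ℂ)

open Polynomial in
/-- Monic split polynomials of degree `N + 1` whose roots have the same sum agree up to degree `< N`. -/
theorem degree_prod_X_sub_C_sub_lt {N : ℕ} {R : Type*} [CommRing R] [IsDomain R]
    (D D' : Fin (N + 1) → R) (h : ∑ j, D j = ∑ j, D' j) :
    (∏ j, (X - C (D j)) - ∏ j, (X - C (D' j))).degree < (N : WithBot ℕ) := by
  have hd : ∀ D : Fin (N + 1) → R, (∏ j, (X - C (D j))).natDegree = N + 1 := fun D => by
    rw [natDegree_prod_of_monic _ _ fun i _ => monic_X_sub_C _]; simp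
  have hm : ∀ D : Fin (N + 1) → R, (∏ j, (X - C (D j))).Monic := fun D =>
    monic_prod_of_monic _ _ fun i _ => monic_X_sub_C _
  have hc : ∀ D : Fin (N + 1) → R, (∏ j, (X - C (D j))).coeff N = - ∑ j, D j := fun D => by
    have := prod_X_sub_C_coeff_card_pred (Finset.univ) D (by simp)
    simpa using this
  rw [degree_lt_iff_coeff_zero]
  intro m hmN
  rw [coeff_sub]
  rcases hmN.eq_or_lt with rfl | hlt
  · rw [hc, hc, h, sub_self]
  · rcases (Nat.succ_le_of_lt hlt).eq_or_lt with rfl | hlt'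
    · have h1 := (hm D).coeff_natDegree
      have h2 := (hm D').coeff_natDegree
      rw [hd] at h1 h2
      rw [Nat.succ_eq_add_one, h1, h2, sub_self]
    · rw [coeff_eq_zero_of_natDegree_lt (by rw [hd]; exact hlt'),
        coeff_eq_zero_of_natDegree_lt (by rw [hd]; exact hlt'), sub_self]

/-- `a` strictly interlaces `D`. -/
def Interlaces {N : ℕ} (a : Fin N → ℝ) (D : Fin (N + 1) → ℝ) : Prop :=
  ∀ i, D i.castSucc < a i ∧ a i < D i.succ

theorem Interlaces.strictMono_right {N : ℕ} {a : Fin N → ℝ} {D : Fin (N + 1) → ℝ}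
    (h : Interlaces a D) : StrictMono D :=
  Fin.strictMono_iff_lt_succ.2 fun i => (h i).1.trans (h i).2

theorem Interlaces.strictMono_left {N : ℕ} {a : Fin N → ℝ} {D : Fin (N + 1) → ℝ}
    (h : Interlaces a D) : StrictMono a := by
  cases N with
  | zero => exact fun i => i.elim0
  | succ n =>
    refine Fin.strictMono_iff_lt_succ.2 fun i => (h _).2.trans ?_
    have := (h i.succ).1
    rwa [← Fin.succ_castSucc] at this

/-- The coordinates `(c, t)` of the arrowhead matrix with diagonal block `diag a` and
eigenvalues `D`: the corner entry `c` and the squared moduli `t` of the border. -/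
noncomputable def arrowCoord {N : ℕ} (a : Fin N → ℝ) (D : Fin (N + 1) → ℝ) : Fin (N + 1) → ℝ :=
  Fin.cons (∑ j, D j - ∑ i, a i)
    fun i => -(∏ j, (a i - D j)) / ∏ k ∈ Finset.univ.erase i, (a i - a k)

theorem prod_erase_sub_ne_zero {N : ℕ} {a : Fin N → ℝ} (ha : Function.Injective a) (i : Fin N) :
    ∏ k ∈ Finset.univ.erase i, (a i - a k) ≠ 0 :=
  Finset.prod_ne_zero_iff.2 fun _ hk => sub_ne_zero.2 fun h =>
    (Finset.ne_of_mem_erase hk) (ha h).symm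

open Polynomial in
theorem degree_sum_C_mul_prod_erase_lt {N : ℕ} (t a : Fin N → ℝ) :
    (∑ i, C (t i) * ∏ k ∈ Finset.univ.erase i, (X - C (a k))).degree < (N : WithBot ℕ) := by
  refine (degree_sum_le _ _).trans_lt ?_
  rw [Finset.sup_lt_iff (by simp [bot_lt_iff_ne_bot])]
  intro i _
  refine (degree_mul_le _ _).trans_lt ?_
  refine (add_le_add_left degree_C_le _).trans_lt ?_
  rw [zero_add, degree_prod]
  simp only [degree_X_sub_C, Finset.sum_const, Finset.card_erase_of_mem (Finset.mem_univ i)]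
  simp only [Finset.card_univ, Fintype.card_fin, nsmul_eq_mul, mul_one]
  have := i.pos
  exact_mod_cast (by omega : N - 1 < N)

/-- The secular polynomial identity of an arrowhead matrix. -/
theorem prod_sub_eq_secular {N : ℕ} {a : Fin N → ℝ} (ha : Function.Injective a)
    (D : Fin (N + 1) → ℝ) (x : ℝ) :
    ∏ j, (x - D j) = (x - arrowCoord a D 0) * ∏ i, (x - a i)
      - ∑ i, arrowCoord a D i.succ * ∏ k ∈ Finset.univ.erase i, (x - a k) := by
  open Polynomial in
  have key : (∏ j, (X - C (D j)) - ∏ j, (X - C ((Fin.cons (arrowCoord a D 0) a : Fin (N+1) → ℝ) j)))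
      = - ∑ i, C (arrowCoord a D i.succ) * ∏ k ∈ Finset.univ.erase i, (X - C (a k)) := by
    refine eq_of_degrees_lt_of_eval_index_eq (v := a) Finset.univ ha.injOn ?_ ?_ ?_
    · simpa using degree_prod_X_sub_C_sub_lt D (Fin.cons (arrowCoord a D 0) a)
        (by simp [Fin.sum_univ_succ, arrowCoord])
    · rw [degree_neg]
      simpa using degree_sum_C_mul_prod_erase_lt (fun i => arrowCoord a D i.succ) a
    · intro i _
      simp only [eval_sub, eval_prod, eval_X, eval_C, eval_neg, eval_finsetSum, eval_mul]
      rw [Fin.prod_univ_succ (fun j => a i - (Fin.cons (arrowCoord a D 0) a : Fin (N+1) → ℝ) j)]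
      simp only [Fin.cons_zero, Fin.cons_succ]
      rw [Finset.prod_eq_zero (Finset.mem_univ i) (sub_self _), mul_zero, sub_zero,
        Finset.sum_eq_single i]
      · rw [arrowCoord, Fin.cons_succ, div_mul_cancel₀ _ (prod_erase_sub_ne_zero ha i), neg_neg]
      · intro k _ hk
        rw [Finset.prod_eq_zero (Finset.mem_erase.2 ⟨hk.symm, Finset.mem_univ i⟩) (sub_self _),
          mul_zero]
      · simp
  have := congrArg (Polynomial.eval x) key
  simp only [Polynomial.eval_sub, Polynomial.eval_prod, Polynomial.eval_X, Polynomial.eval_C,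
    Polynomial.eval_neg, Polynomial.eval_finsetSum, Polynomial.eval_mul] at this
  rw [Fin.prod_univ_succ (fun j => x - (Fin.cons (arrowCoord a D 0) a : Fin (N+1) → ℝ) j)] at this
  simp only [Fin.cons_zero, Fin.cons_succ] at this
  linarith

theorem strictMono_eq_of_prod_sub_eq {N : ℕ} {D D' : Fin N → ℝ} (hD : StrictMono D)
    (hD' : StrictMono D') (h : ∀ x, ∏ j, (x - D j) = ∏ j, (x - D' j)) : D = D' := by
  refine StrictMono.range_inj hD hD' |>.1 ?_
  ext x
  have h1 : ∀ D : Fin N → ℝ, x ∈ Set.range D ↔ ∏ j, (x - D j) = 0 := fun D => by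
    rw [Finset.prod_eq_zero_iff]
    simp [sub_eq_zero, eq_comm]
  rw [h1, h1, h]

theorem arrowCoord_injOn {N : ℕ} {a : Fin N → ℝ} (ha : StrictMono a) :
    Set.InjOn (arrowCoord a) {D | Interlaces a D} := by
  intro D hD D' hD' h
  refine strictMono_eq_of_prod_sub_eq hD.strictMono_right hD'.strictMono_right fun x => ?_
  rw [prod_sub_eq_secular ha.injective, prod_sub_eq_secular ha.injective, h]

theorem arrowCoord_succ_pos {N : ℕ} {a : Fin N → ℝ} {D : Fin (N + 1) → ℝ}
    (h : Interlaces a D) (i : Fin N) : 0 < arrowCoord a D i.succ := by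
  have ha := h.strictMono_left
  rw [arrowCoord, Fin.cons_succ, Fin.prod_univ_succAbove _ i.succ, ← neg_mul, neg_sub,
    ← Finset.mul_prod_erase _ _ (Finset.mem_univ i), mul_div_assoc, mul_div_assoc,
    ← Finset.prod_div_distrib]
  refine mul_pos (sub_pos.2 (h i).2) (mul_pos ?_ (Finset.prod_pos fun k hk => ?_))
  · rw [Fin.succAbove_succ_of_le _ _ le_rfl]
    exact sub_pos.2 (h i).1
  · rcases lt_or_gt_of_ne (Finset.ne_of_mem_erase hk) with hki | hki
    · rw [Fin.succAbove_succ_of_le _ _ hki.le]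
      exact div_pos (sub_pos.2 ((h k).1.trans (ha hki))) (sub_pos.2 (ha hki))
    · rw [Fin.succAbove_succ_of_lt _ _ hki]
      exact div_pos_of_neg_of_neg (sub_neg.2 ((ha hki).trans (h k).2)) (sub_neg.2 (ha hki))

theorem neg_one_pow_card_filter_mul_prod_sub_pos {ι : Type*} (s : Finset ι) (a : ι → ℝ) (x : ℝ)
    (h : ∀ k ∈ s, x ≠ a k) :
    0 < (-1) ^ (s.filter fun k => x < a k).card * ∏ k ∈ s, (x - a k) := by
  have : (-1 : ℝ) ^ (s.filter fun k => x < a k).card = ∏ k ∈ s, if x < a k then -1 else 1 := by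
    rw [Finset.prod_ite]; simp
  rw [this, ← Finset.prod_mul_distrib]
  refine Finset.prod_pos fun k hk => ?_
  split_ifs with hlt
  · linarith
  · have := lt_of_le_of_ne (not_lt.1 hlt) (h k hk).symm
    linarith

/-- The secular function of an arrowhead matrix with corner `c`, diagonal `a` and squared border
moduli `t`. -/
noncomputable def secular {N : ℕ} (c : ℝ) (t a : Fin N → ℝ) (x : ℝ) : ℝ :=
  (x - c) * ∏ i, (x - a i) - ∑ i, t i * ∏ k ∈ Finset.univ.erase i, (x - a k)

theorem secular_apply_self {N : ℕ} (c : ℝ) (t a : Fin N → ℝ) (i : Fin N) :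
    secular c t a (a i) = -(t i * ∏ k ∈ Finset.univ.erase i, (a i - a k)) := by
  rw [secular, Finset.prod_eq_zero (Finset.mem_univ i) (sub_self _), Finset.sum_eq_single i]
  · ring
  · intro k _ hk
    rw [Finset.prod_eq_zero (Finset.mem_erase.2 ⟨hk.symm, Finset.mem_univ i⟩) (sub_self _),
      mul_zero]
  · simp

theorem secular_eq_mul {N : ℕ} (c : ℝ) (t a : Fin N → ℝ) {x : ℝ} (hx : ∀ i, x ≠ a i) :
    secular c t a x = (x - c - ∑ i, t i / (x - a i)) * ∏ i, (x - a i) := by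
  rw [secular, sub_mul (x - c), Finset.sum_mul]
  congr 1
  refine Finset.sum_congr rfl fun i _ => ?_
  rw [← Finset.mul_prod_erase _ _ (Finset.mem_univ i)]
  field_simp [sub_ne_zero.2 (hx i)]

theorem secular_sign_self {N : ℕ} {c : ℝ} {t a : Fin N → ℝ} (ha : StrictMono a)
    (ht : ∀ i, 0 < t i) (i : Fin N) : 0 < (-1) ^ (N - i : ℕ) * secular c t a (a i) := by
  have h := neg_one_pow_card_filter_mul_prod_sub_pos (Finset.univ.erase i) a (a i)
    fun k hk h => Finset.ne_of_mem_erase hk (ha.injective h).symm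
  have hf : ((Finset.univ.erase i).filter fun k => a i < a k) = Finset.Ioi i := by
    ext k
    simp only [Finset.mem_filter, Finset.mem_erase, Finset.mem_univ, and_true, ha.lt_iff_lt,
      Finset.mem_Ioi, and_iff_right_iff_imp]
    exact fun h => h.ne'
  rw [hf, Fin.card_Ioi] at h
  rw [secular_apply_self, show N - (i : ℕ) = (N - 1 - i) + 1 by have := i.2; omega, pow_succ]
  nlinarith [mul_pos (ht i) h]

theorem exists_secular_sign {N : ℕ} (c : ℝ) (t a : Fin N → ℝ) (ht : ∀ i, 0 < t i) :
    ∃ R, 0 < R ∧ (∀ i, -R < a i ∧ a i < R) ∧ 0 < secular c t a R ∧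
      0 < (-1) ^ (N + 1) * secular c t a (-R) := by
  set R := 1 + |c| + ∑ i, t i + ∑ i, |a i| with hR
  have hs : 0 ≤ ∑ i, t i := Finset.sum_nonneg fun i _ => (ht i).le
  have haR : ∀ i, |a i| + 1 ≤ R := fun i => by
    have := Finset.single_le_sum (f := fun i => |a i|) (fun i _ => abs_nonneg _) (Finset.mem_univ i)
    have := abs_nonneg c
    linarith
  have hRpos : 0 < R := by positivity
  have hsa : 0 ≤ ∑ i, |a i| := Finset.sum_nonneg fun i _ => abs_nonneg _
  refine ⟨R, hRpos, fun i => ?_, ?_, ?_⟩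
  · have := abs_le.1 (le_refl |a i|); constructor <;> linarith [haR i]
  · rw [secular_eq_mul _ _ _ fun i => by have := (abs_le.1 (le_refl |a i|)).2; linarith [haR i]]
    refine mul_pos ?_ (Finset.prod_pos fun i _ => by
      have := (abs_le.1 (le_refl |a i|)).2; linarith [haR i])
    have : ∑ i, t i / (R - a i) ≤ ∑ i, t i := Finset.sum_le_sum fun i _ =>
      div_le_self (ht i).le (by have := (abs_le.1 (le_refl |a i|)).2; linarith [haR i])
    linarith [le_abs_self c]
  · have hlt : ∀ i, -R < a i := fun i => by
      have := (abs_le.1 (le_refl |a i|)).1; linarith [haR i]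
    rw [secular_eq_mul _ _ _ fun i => (hlt i).ne]
    have h := neg_one_pow_card_filter_mul_prod_sub_pos Finset.univ a (-R) fun i _ => (hlt i).ne
    rw [Finset.filter_true_of_mem fun i _ => hlt i, Finset.card_univ, Fintype.card_fin] at h
    have : ∑ i, t i / (a i - -R) ≤ ∑ i, t i := Finset.sum_le_sum fun i _ =>
      div_le_self (ht i).le (by have := (abs_le.1 (le_refl |a i|)).1; linarith [haR i])
    have h2 : ∑ i, t i / (-R - a i) = - ∑ i, t i / (a i - -R) := by
      rw [← Finset.sum_neg_distrib]
      refine Finset.sum_congr rfl fun i _ => ?_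
      rw [← div_neg, neg_sub]
    have h3 : 0 < R + c - ∑ i, t i / (a i - -R) := by linarith [neg_abs_le c]
    rw [h2, pow_succ]
    have := mul_pos h3 h
    linarith

theorem exists_interlaces_secular_eq_zero {N : ℕ} {c : ℝ} {t a : Fin N → ℝ} (ha : StrictMono a)
    (ht : ∀ i, 0 < t i) : ∃ D, Interlaces a D ∧ ∀ j, secular c t a (D j) = 0 := by
  obtain ⟨R, hR, haR, hpos, hneg⟩ := exists_secular_sign c t a ht
  have hcont : Continuous (secular c t a) := by unfold secular; fun_prop
  have hL : ∀ g : Fin (N + 1),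
      0 < (-1) ^ (N + 1 - g : ℕ) * secular c t a ((Fin.cons (-R) a : Fin (N + 1) → ℝ) g) := by
    refine Fin.cases (by simpa using hneg) fun i => ?_
    simpa using secular_sign_self ha ht i
  have hU : ∀ g : Fin (N + 1),
      0 < (-1) ^ (N - g : ℕ) * secular c t a ((Fin.snoc a R : Fin (N + 1) → ℝ) g) := by
    refine Fin.lastCases (by simpa using hpos) fun i => ?_
    simpa using secular_sign_self ha ht i
  have hLU : ∀ g : Fin (N + 1), (Fin.cons (-R) a : Fin (N + 1) → ℝ) g
      < (Fin.snoc a R : Fin (N + 1) → ℝ) g := by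
    refine Fin.cases ?_ fun i => ?_
    · rw [Fin.cons_zero]
      refine Fin.lastCases (motive := fun g => -R < (Fin.snoc a R : Fin (N + 1) → ℝ) g) ?_ ?_ 0
      · simp; linarith
      · intro i; simpa using (haR i).1
    · rw [Fin.cons_succ]
      refine Fin.lastCases (motive := fun g : Fin (N + 1) => i.castSucc < g →
        a i < (Fin.snoc a R : Fin (N + 1) → ℝ) g) ?_ ?_ i.succ Fin.castSucc_lt_succ
      · intro _; simpa using (haR i).2
      · intro k hk; simpa using ha (Fin.castSucc_lt_castSucc_iff.1 hk)
  have hroot : ∀ g : Fin (N + 1), ∃ x, (Fin.cons (-R) a : Fin (N + 1) → ℝ) g < x ∧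
      x < (Fin.snoc a R : Fin (N + 1) → ℝ) g ∧ secular c t a x = 0 := by
    intro g
    have h1 := hL g
    rw [show N + 1 - (g : ℕ) = (N - g) + 1 by have := g.2; omega, pow_succ] at h1
    obtain ⟨x, hx, hx0⟩ := intermediate_value_Ioo
      (f := fun x => (-1) ^ (N - g : ℕ) * secular c t a x) (hLU g).le
      (by fun_prop) ⟨by linarith, hU g⟩
    exact ⟨x, hx.1, hx.2, by simpa using hx0⟩
  choose D hD1 hD2 hD3 using hroot
  refine ⟨D, fun i => ⟨?_, ?_⟩, hD3⟩
  · simpa using hD2 i.castSucc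
  · simpa using hD1 i.succ

theorem arrowCoord_image {N : ℕ} {a : Fin N → ℝ} (ha : StrictMono a) :
    arrowCoord a '' {D | Interlaces a D} = {y | ∀ i : Fin N, 0 < y i.succ} := by
  ext y
  constructor
  · rintro ⟨D, hD, rfl⟩
    exact arrowCoord_succ_pos hD
  intro hy
  obtain ⟨D, hD, hroot⟩ := exists_interlaces_secular_eq_zero (c := y 0) (t := fun i => y i.succ) ha hy
  refine ⟨D, hD, ?_⟩
  have key := by
    open Polynomial in
    exact eq_of_degrees_lt_of_eval_index_eq (v := D) Finset.univ
      (f := ∏ j, (X - C ((Fin.cons (y 0) a : Fin (N + 1) → ℝ) j)) - ∏ j, (X - C (D j)))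
      (g := ∑ i, C (y (Fin.succ i)) * ∏ k ∈ Finset.univ.erase i, (X - C (a k)))
      hD.strictMono_right.injective.injOn
      (by
        have hm : ∀ D : Fin (N + 1) → ℝ, (∏ j, (X - C (D j))).Monic := fun D =>
          monic_prod_of_monic _ _ fun i _ => monic_X_sub_C _
        have hd : ∀ D : Fin (N + 1) → ℝ,
            (∏ j, (X - C (D j))).degree = ((N + 1 : ℕ) : WithBot ℕ) := fun D => by
          rw [degree_prod]; simp
        have := degree_sub_lt_left ((hd (Fin.cons (y 0) a)).trans (hd D).symm) (hm _).ne_zero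
          ((hm _).leadingCoeff.trans (hm _).leadingCoeff.symm)
        rw [hd] at this
        simpa using this)
      (by
        refine (degree_sum_C_mul_prod_erase_lt (fun i => y (Fin.succ i)) a).trans ?_
        simp only [Finset.card_univ, Fintype.card_fin]
        exact_mod_cast N.lt_succ_self)
      (fun j _ => by
        have h := hroot j
        simp only [secular] at h
        rw [Polynomial.eval_sub, eval_prod, eval_prod, Fin.prod_univ_succ,
          Finset.prod_eq_zero (Finset.mem_univ j) (by simp)]
        simp only [eval_sub, eval_prod, eval_X, eval_C, eval_finsetSum, eval_mul, Fin.cons_zero,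
          Fin.cons_succ]
        linarith)
  refine funext (Fin.cases ?_ fun i => ?_)
  · open Polynomial in
    have hc : ∀ D : Fin (N + 1) → ℝ, (∏ j, (X - C (D j))).coeff N = - ∑ j, D j := fun D => by
      simpa using prod_X_sub_C_coeff_card_pred Finset.univ D (by simp)
    have h := congrArg (fun p => Polynomial.coeff p N) key
    simp only [Polynomial.coeff_sub, hc] at h
    rw [Polynomial.coeff_eq_zero_of_degree_lt
      (degree_sum_C_mul_prod_erase_lt (fun i => y (Fin.succ i)) a), Fin.sum_univ_succ (Fin.cons _ _)] at h
    simp only [Fin.cons_zero, Fin.cons_succ] at h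
    rw [arrowCoord, Fin.cons_zero]
    linarith
  · have h := congrArg (Polynomial.eval (a i)) key
    have h2 := secular_apply_self (y 0) (fun i => y i.succ) a i
    rw [secular] at h2
    simp only [Polynomial.eval_sub, Polynomial.eval_prod, Polynomial.eval_X, Polynomial.eval_C,
      Polynomial.eval_finsetSum, Polynomial.eval_mul] at h
    rw [Fin.prod_univ_succ (fun j => a i - (Fin.cons (y 0) a : Fin (N+1) → ℝ) j)] at h
    simp only [Fin.cons_zero, Fin.cons_succ] at h
    rw [arrowCoord, Fin.cons_succ, div_eq_iff (prod_erase_sub_ne_zero ha.injective i)]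
    linarith

theorem vdm_eq_det (N : ℕ) (z : Fin N → ℝ) : vdm N z = (vandermonde z).det :=
  (det_vandermonde z).symm

theorem vdm_pos {N : ℕ} {z : Fin N → ℝ} (hz : StrictMono z) : 0 < vdm N z :=
  Finset.prod_pos fun _ _ => Finset.prod_pos fun _ hj => sub_pos.2 (hz (Finset.mem_Ioi.1 hj))

theorem vdm_ne_zero_iff {N : ℕ} {z : Fin N → ℝ} : vdm N z ≠ 0 ↔ Function.Injective z := by
  rw [vdm_eq_det]; exact det_vandermonde_ne_zero_iff

theorem abs_prod_prod_erase_sub {N : ℕ} (z : Fin N → ℝ) :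
    |∏ i, ∏ k ∈ Finset.univ.erase i, (z i - z k)| = vdm N z ^ 2 := by
  have h := Finset.prod_prod_Ioi_mul_eq_prod_prod_off_diag (fun i j => |z i - z j|)
  simp only [Finset.abs_prod]
  have he : ∀ i : Fin N, Finset.univ.erase i = ({i}ᶜ : Finset (Fin N)) := fun i => by
    ext; simp
  simp only [he]
  rw [Finset.prod_congr rfl fun i _ => Finset.prod_congr rfl fun j _ => abs_sub_comm (z i) (z j),
    ← h, vdm, ← sq_abs, Finset.abs_prod, ← Finset.prod_pow]
  refine Finset.prod_congr rfl fun i _ => ?_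
  rw [Finset.abs_prod, ← Finset.prod_pow]
  refine Finset.prod_congr rfl fun j _ => ?_
  rw [abs_sub_comm (z i) (z j), sq]

/-- The Jacobian matrix of `arrowCoord a`. -/
noncomputable def arrowJacobian {N : ℕ} (a : Fin N → ℝ) (D : Fin (N + 1) → ℝ) :
    Matrix (Fin (N + 1)) (Fin (N + 1)) ℝ :=
  of (Fin.cons (fun _ => 1) fun i j =>
    (∏ l ∈ Finset.univ.erase j, (a i - D l)) / ∏ k ∈ Finset.univ.erase i, (a i - a k))

theorem hasFDerivAt_arrowCoord {N : ℕ} (a : Fin N → ℝ) (D : Fin (N + 1) → ℝ) :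
    HasFDerivAt (arrowCoord a) (toLin' (arrowJacobian a D)).toContinuousLinearMap D := by
  have hproj : ∀ j, HasFDerivAt (fun D : Fin (N + 1) → ℝ => D j)
      (ContinuousLinearMap.proj (R := ℝ) (φ := fun _ => ℝ) j) D := fun j => hasFDerivAt_apply j D
  rw [hasFDerivAt_pi']
  refine Fin.cases ?_ fun i => ?_
  · refine ((HasFDerivAt.fun_sum (u := Finset.univ) fun j _ => hproj j).sub_const
      (∑ i, a i)).congr_fderiv ?_
    ext v
    simp [arrowJacobian, mulVec, dotProduct]
  · have h := (HasFDerivAt.finsetProd (u := Finset.univ) (g := fun j (D : Fin (N + 1) → ℝ) => a i - D j)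
      (x := D) fun j _ => (hproj j).const_sub (a i)).neg.mul_const
      (∏ k ∈ Finset.univ.erase i, (a i - a k))⁻¹
    refine h.congr_fderiv ?_
    ext v
    simp [arrowJacobian, mulVec, dotProduct, Finset.mul_sum, div_eq_mul_inv]
    refine Finset.sum_congr rfl fun j _ => ?_
    ring

open Polynomial in
theorem sum_pow_div_mul_prod_eq {N : ℕ} {D : Fin (N + 1) → ℝ} (hD : Function.Injective D)
    {k : ℕ} (hk : k ≤ N) :
    ∑ j, C (D j ^ k / ∏ l ∈ Finset.univ.erase j, (D j - D l)) *
      ∏ l ∈ Finset.univ.erase j, (X - C (D l)) = (X : ℝ[X]) ^ k := by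
  refine eq_of_degrees_lt_of_eval_index_eq (v := D) Finset.univ hD.injOn ?_ ?_ fun j _ => ?_
  · simpa using degree_sum_C_mul_prod_erase_lt
      (fun j => D j ^ k / ∏ l ∈ Finset.univ.erase j, (D j - D l)) D
  · simp only [degree_X_pow, Finset.card_univ, Fintype.card_fin]
    exact_mod_cast Nat.lt_succ_of_le hk
  · simp only [eval_finsetSum, eval_mul, eval_C, eval_prod, eval_sub, eval_X, eval_pow]
    rw [Finset.sum_eq_single j]
    · rw [div_mul_cancel₀ _ (prod_erase_sub_ne_zero hD j)]
    · intro l _ hl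
      rw [Finset.prod_eq_zero (f := fun x => D j - D x)
        (Finset.mem_erase.2 ⟨hl.symm, Finset.mem_univ j⟩) (sub_self _), mul_zero]
    · simp

theorem abs_det_arrowJacobian {N : ℕ} {a : Fin N → ℝ} {D : Fin (N + 1) → ℝ}
    (ha : Function.Injective a) (hD : Function.Injective D) :
    |(arrowJacobian a D).det| = |vdm (N + 1) D| / |vdm N a| := by
  set M : Matrix (Fin (N + 1)) (Fin (N + 1)) ℝ := of (Fin.cons (fun _ => 1) fun i j =>
    ∏ l ∈ Finset.univ.erase j, (a i - D l)) with hM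
  have h1 : arrowJacobian a D = diagonal (Fin.cons 1 fun i =>
      (∏ k ∈ Finset.univ.erase i, (a i - a k))⁻¹) * M := by
    ext i j
    rw [diagonal_mul]
    refine Fin.cases ?_ (fun i => ?_) i
    · simp [arrowJacobian, hM]
    · simp [arrowJacobian, hM, div_eq_inv_mul]
  set R : Matrix (Fin (N + 1)) (Fin (N + 1)) ℝ := of (Fin.cons (fun k => if k = Fin.last N then 1 else 0)
    fun i k => a i ^ (k : ℕ)) with hR
  have h2 : M * (diagonal fun j => (∏ l ∈ Finset.univ.erase j, (D j - D l))⁻¹) * vandermonde D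
      = R := by
    ext i k
    rw [mul_apply]
    simp only [mul_diagonal, vandermonde_apply]
    have hk : (k : ℕ) ≤ N := Nat.lt_succ_iff.1 k.2
    refine Fin.cases ?_ (fun i => ?_) i
    · have h := congrArg (fun p => Polynomial.coeff p N) (sum_pow_div_mul_prod_eq hD hk)
      simp only [Polynomial.finsetSum_coeff, Polynomial.coeff_C_mul, Polynomial.coeff_X_pow] at h
      have hc : ∀ j, (∏ l ∈ Finset.univ.erase j, (Polynomial.X - Polynomial.C (D l))).coeff N = 1 := by
        intro j
        have hm : (∏ l ∈ Finset.univ.erase j, (Polynomial.X - Polynomial.C (D l))).Monic :=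
          Polynomial.monic_prod_of_monic _ _ fun i _ => Polynomial.monic_X_sub_C _
        have := hm.coeff_natDegree
        rwa [Polynomial.natDegree_prod_of_monic _ _ fun i _ => Polynomial.monic_X_sub_C _,
          Finset.sum_congr rfl fun i _ => Polynomial.natDegree_X_sub_C _, Finset.sum_const,
          Finset.card_erase_of_mem (Finset.mem_univ j), Finset.card_univ, Fintype.card_fin,
          smul_eq_mul, mul_one, Nat.add_sub_cancel] at this
      simp only [hc, mul_one] at h
      simp only [hM, hR, of_apply, Fin.cons_zero, one_mul, Fin.ext_iff, Fin.val_last]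
      rw [eq_comm] at h
      simp only [eq_comm (a := (k : ℕ))]
      rw [h]
      exact Finset.sum_congr rfl fun j _ => by rw [div_eq_inv_mul]
    · have h := congrArg (Polynomial.eval (a i)) (sum_pow_div_mul_prod_eq hD hk)
      simp only [Polynomial.eval_finsetSum, Polynomial.eval_mul, Polynomial.eval_C,
        Polynomial.eval_prod, Polynomial.eval_sub, Polynomial.eval_X, Polynomial.eval_pow] at h
      simp only [hM, hR, of_apply, Fin.cons_succ]
      rw [← h]
      exact Finset.sum_congr rfl fun j _ => by ring
  have hRdet : |R.det| = |vdm N a| := by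
    rw [det_succ_row_zero, Finset.sum_eq_single (Fin.last N)]
    · rw [abs_mul, abs_mul, abs_pow, vdm_eq_det]
      have : R.submatrix Fin.succ (Fin.last N).succAbove = vandermonde a := by
        ext i j
        simp [hR, vandermonde_apply]
      rw [this]
      simp [hR]
    · intro k _ hk
      simp [hR, hk]
    · simp
  have hVD : vdm (N + 1) D ≠ 0 := vdm_ne_zero_iff.2 hD
  have hVa : vdm N a ≠ 0 := vdm_ne_zero_iff.2 ha
  have h3 := congrArg (fun A => |det A|) h2
  simp only [det_mul, det_diagonal, abs_mul, hRdet, Finset.prod_inv_distrib, abs_inv,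
    abs_prod_prod_erase_sub, ← vdm_eq_det] at h3
  rw [h1, det_mul, det_diagonal, Fin.prod_univ_succ, abs_mul]
  simp only [Fin.cons_zero, Fin.cons_succ, one_mul, Finset.prod_inv_distrib, abs_inv,
    abs_prod_prod_erase_sub]
  rw [← sq_abs (vdm (N+1) D)] at h3
  rw [← sq_abs (vdm N a)]
  have hVD' := abs_ne_zero.2 hVD
  have hVa' := abs_ne_zero.2 hVa
  field_simp at h3 ⊢
  linarith

/-- Invariance under unitary conjugation. -/
def UnitarilyInvariant {N : ℕ} {β : Type*} (F : Matrix (Fin N) (Fin N) ℂ → β) : Prop :=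
  ∀ U ∈ unitaryGroup (Fin N) ℂ, ∀ X, F (U * X * star U) = F X

theorem UnitarilyInvariant.diagonal_comp_perm {N : ℕ} {β : Type*}
    {F : Matrix (Fin N) (Fin N) ℂ → β} (hF : UnitarilyInvariant F) (d : Fin N → ℂ)
    (σ : Equiv.Perm (Fin N)) : F (diagonal fun i => d (σ i)) = F (diagonal d) := by
  have hs : star ((1 : Matrix (Fin N) (Fin N) ℂ).submatrix σ id)
      = (1 : Matrix (Fin N) (Fin N) ℂ).submatrix id σ := by
    rw [star_eq_conjTranspose, conjTranspose_submatrix, conjTranspose_one]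
  have hm : (1 : Matrix (Fin N) (Fin N) ℂ).submatrix σ id ∈ unitaryGroup (Fin N) ℂ := by
    rw [mem_unitaryGroup_iff, hs]
    ext i j
    simp [mul_apply, one_apply]
  rw [← hF _ hm (diagonal d), hs]
  congr 1
  ext i j
  rw [mul_apply]
  simp only [mul_diagonal, submatrix_apply, one_apply, id_eq, diagonal_apply, ite_mul, one_mul,
    zero_mul, mul_ite, mul_one, mul_zero, Finset.sum_ite_eq',
    Finset.mem_univ, if_true, EmbeddingLike.apply_eq_iff_eq]
  rcases eq_or_ne i j with rfl | h
  · simp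
  · simp [h]

/-- A Hermitian matrix with characteristic polynomial `∏ (x - D j)`, the `D j` distinct, is
unitarily equivalent to `diag D`. -/
theorem UnitarilyInvariant.eq_diagonal {N : ℕ} {β : Type*}
    {F : Matrix (Fin N) (Fin N) ℂ → β} (hF : UnitarilyInvariant F)
    {H : Matrix (Fin N) (Fin N) ℂ} (hH : H.IsHermitian) {D : Fin N → ℝ}
    (hD : Function.Injective D)
    (h : H.charpoly = ∏ j, (Polynomial.X - Polynomial.C (D j : ℂ))) :
    F H = F (diagonal fun i => (D i : ℂ)) := by
  have hroot : ∀ j, ∃ i, hH.eigenvalues i = D j := by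
    intro j
    have h1 := congrArg (Polynomial.eval (D j : ℂ)) (hH.charpoly_eq.symm.trans h)
    simp only [Polynomial.eval_prod, Polynomial.eval_sub, Polynomial.eval_X,
      Polynomial.eval_C] at h1
    rw [Finset.prod_eq_zero (f := fun i => (D j : ℂ) - D i) (Finset.mem_univ j) (sub_self _),
      Finset.prod_eq_zero_iff] at h1
    obtain ⟨i, -, hi⟩ := h1
    refine ⟨i, ?_⟩
    have := sub_eq_zero.1 hi
    exact (Complex.ofReal_injective this).symm
  choose τ hτ using hroot
  have hinj : Function.Injective τ := fun i j hij => hD (by rw [← hτ, ← hτ, hij])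
  have hsp := hH.spectral_theorem
  rw [Unitary.conjStarAlgAut_apply] at hsp
  rw [hsp, hF _ hH.eigenvectorUnitary.2]
  rw [← hF.diagonal_comp_perm _ (Equiv.ofBijective τ (Finite.injective_iff_bijective.1 hinj))]
  congr 2
  funext i
  simp [hτ]

/-- The matrix `[[c, z], [z*, A]]`. -/
noncomputable def border {N : ℕ} (c : ℝ) (z : Fin N → ℂ) (A : Matrix (Fin N) (Fin N) ℂ) :
    Matrix (Fin (N + 1)) (Fin (N + 1)) ℂ :=
  of (Fin.cons (Fin.cons (c : ℂ) z) fun i => Fin.cons (star (z i)) (A i))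

@[simp] theorem border_zero_zero {N : ℕ} (c : ℝ) (z : Fin N → ℂ) (A : Matrix (Fin N) (Fin N) ℂ) :
    border c z A 0 0 = c := rfl

@[simp] theorem border_zero_succ {N : ℕ} (c : ℝ) (z : Fin N → ℂ) (A : Matrix (Fin N) (Fin N) ℂ)
    (j : Fin N) : border c z A 0 j.succ = z j := rfl

@[simp] theorem border_succ_zero {N : ℕ} (c : ℝ) (z : Fin N → ℂ) (A : Matrix (Fin N) (Fin N) ℂ)
    (i : Fin N) : border c z A i.succ 0 = star (z i) := rfl

@[simp] theorem border_succ_succ {N : ℕ} (c : ℝ) (z : Fin N → ℂ) (A : Matrix (Fin N) (Fin N) ℂ)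
    (i j : Fin N) : border c z A i.succ j.succ = A i j := rfl

theorem border_mul_border {N : ℕ} (c : ℝ) (z : Fin N → ℂ) (A B : Matrix (Fin N) (Fin N) ℂ) :
    border c z A * border 1 0 B = of (Fin.cons (Fin.cons (c : ℂ) (z ᵥ* B))
      fun i => Fin.cons (star (z i)) ((A * B) i)) := by
  ext i j
  rw [mul_apply, Fin.sum_univ_succ]
  refine Fin.cases ?_ (fun i => ?_) i <;> refine Fin.cases ?_ (fun j => ?_) j <;>
    simp [mul_apply, vecMul, dotProduct]

theorem star_border {N : ℕ} (c : ℝ) (z : Fin N → ℂ) (A : Matrix (Fin N) (Fin N) ℂ) :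
    star (border c z A) = border c z (star A) := by
  ext i j
  rw [star_apply]
  refine Fin.cases ?_ (fun i => ?_) i <;> refine Fin.cases ?_ (fun j => ?_) j <;>
    simp

theorem border_one_mem_unitaryGroup {N : ℕ} {U : Matrix (Fin N) (Fin N) ℂ}
    (hU : U ∈ unitaryGroup (Fin N) ℂ) : border 1 0 U ∈ unitaryGroup (Fin (N + 1)) ℂ := by
  rw [mem_unitaryGroup_iff, star_border, border_mul_border, mem_unitaryGroup_iff.1 hU]
  ext i j
  refine Fin.cases ?_ (fun i => ?_) i <;> refine Fin.cases ?_ (fun j => ?_) j <;>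
    simp [one_apply, Fin.succ_inj, (Fin.succ_ne_zero _).symm]

theorem border_conj {N : ℕ} (c : ℝ) (z : Fin N → ℂ) (A U : Matrix (Fin N) (Fin N) ℂ) :
    border 1 0 U * border c z A * star (border 1 0 U) = border c (z ᵥ* star U) (U * A * star U) := by
  ext i j
  rw [star_border, mul_assoc, border_mul_border, mul_apply, Fin.sum_univ_succ]
  refine Fin.cases ?_ (fun i => ?_) i <;> refine Fin.cases ?_ (fun j => ?_) j
  · simp
  · simp
  · simp [vecMul, dotProduct, mul_comm]
  · simp only [border_succ_zero, of_apply, Fin.cons_succ, border_succ_succ, mul_assoc]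
    simp [mul_apply]

theorem UnitarilyInvariant.border_conj {N : ℕ} {β : Type*}
    {F : Matrix (Fin (N + 1)) (Fin (N + 1)) ℂ → β} (hF : UnitarilyInvariant F)
    {U : Matrix (Fin N) (Fin N) ℂ} (hU : U ∈ unitaryGroup (Fin N) ℂ) (c : ℝ) (z : Fin N → ℂ)
    (A : Matrix (Fin N) (Fin N) ℂ) :
    F (border c (z ᵥ* star U) (U * A * star U)) = F (border c z A) := by
  rw [← _root_.border_conj, hF _ (border_one_mem_unitaryGroup hU)]

theorem border_isHermitian {N : ℕ} (c : ℝ) (z : Fin N → ℂ) {A : Matrix (Fin N) (Fin N) ℂ}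
    (hA : A.IsHermitian) : (border c z A).IsHermitian := by
  have := star_border c z A
  rwa [star_eq_conjTranspose A, hA.eq] at this

/-- The determinant of an arrowhead matrix. -/
theorem det_arrow {N : ℕ} {K : Type*} [Field K] (d : K) (u v w : Fin N → K) (hw : ∀ i, w i ≠ 0)
    (M : Matrix (Fin (N + 1)) (Fin (N + 1)) K) (h00 : M 0 0 = d) (h0 : ∀ j : Fin N, M 0 j.succ = u j)
    (h1 : ∀ i : Fin N, M i.succ 0 = v i)
    (h2 : ∀ i j : Fin N, M i.succ j.succ = diagonal w i j) :
    M.det = (d - ∑ i, u i * v i / w i) * ∏ i, w i := by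
  set L : Matrix (Fin (N + 1)) (Fin (N + 1)) K :=
    of (Fin.cons (Fin.cons 1 0) fun i => Fin.cons (-(v i / w i)) ((1 : Matrix (Fin N) (Fin N) K) i))
    with hL
  have hLdet : L.det = 1 := by
    rw [det_of_isLowerTriangular L, Fin.prod_univ_succ]
    · simp [hL]
    · intro i j hij
      revert hij
      refine Fin.cases (fun hij => ?_) (fun j => ?_) j
      · exact absurd hij (not_lt.2 (Fin.zero_le i))
      · refine Fin.cases (fun hij => ?_) (fun i hij => ?_) i
        · simp [hL]
        · have : i ≠ j := by rintro rfl; exact lt_irrefl _ hij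
          simp [hL, one_apply, this]
  have hML : ∀ i j, (M * L) i j = of (Fin.cons (Fin.cons (d - ∑ i, u i * v i / w i) u)
      fun i => Fin.cons 0 (diagonal w i)) i j := by
    intro i j
    rw [mul_apply, Fin.sum_univ_succ]
    refine Fin.cases ?_ (fun i => ?_) i <;> refine Fin.cases ?_ (fun j => ?_) j
    · simp [hL, h00, h0, sub_eq_add_neg, mul_div_assoc]
    · simp [hL, h00, h0, one_apply]
    · simp [hL, h1, h2, diagonal_apply, mul_div_cancel₀ _ (hw i)]
    · simp [hL, h1, h2, one_apply]
  rw [← mul_one M.det, ← hLdet, ← det_mul, det_of_isUpperTriangular, Fin.prod_univ_succ]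
  · simp [hML]
  · intro i j hij
    rw [hML]
    revert hij
    refine Fin.cases (fun hij => ?_) (fun i => ?_) i
    · exact absurd hij (by simp)
    · refine Fin.cases (fun _ => by simp) (fun j hij => ?_) j
      have : i ≠ j := by rintro rfl; exact lt_irrefl _ hij
      simp [this]

theorem charpoly_border_diagonal {N : ℕ} {a : Fin N → ℝ} {D : Fin (N + 1) → ℝ}
    (ha : Function.Injective a) {z : Fin N → ℂ}
    (hz : ∀ i, Complex.normSq (z i) = arrowCoord a D i.succ) :
    (border (arrowCoord a D 0) z (diagonal fun i => (a i : ℂ))).charpoly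
      = ∏ j, (Polynomial.X - Polynomial.C (D j : ℂ)) := by
  refine Polynomial.eq_of_infinite_eval_eq _ _ ?_
  have hinf : (Complex.ofReal '' (Set.range a)ᶜ).Infinite :=
    (Set.Finite.infinite_compl (Set.finite_range a)).image Complex.ofReal_injective.injOn
  refine hinf.mono ?_
  rintro _ ⟨x, hx, rfl⟩
  have hxa : ∀ i, x ≠ a i := fun i h => hx ⟨i, h.symm⟩
  have hs := prod_sub_eq_secular ha D x
  change _ = secular (arrowCoord a D 0) (fun i => arrowCoord a D i.succ) a x at hs
  rw [secular_eq_mul _ _ _ hxa] at hs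
  rw [Set.mem_ofPred_eq, eval_charpoly, det_arrow ((x : ℂ) - arrowCoord a D 0) (fun i => -z i)
    (fun i => -star (z i)) (fun i => (x : ℂ) - a i)
    (fun i => by exact_mod_cast sub_ne_zero.2 (hxa i))]
  · simp only [Polynomial.eval_prod, Polynomial.eval_sub, Polynomial.eval_X, Polynomial.eval_C]
    rw [eq_comm]
    have := congrArg Complex.ofReal hs
    push_cast at this
    rw [this]
    congr 2
    refine Finset.sum_congr rfl fun i _ => ?_
    rw [neg_mul_neg, ← hz, Complex.normSq_eq_conj_mul_self, mul_comm]
    rfl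
  · simp
  · intro j; simp [scalar_apply, (Fin.succ_ne_zero _).symm]
  · intro j; simp [scalar_apply]
  · intro i j
    rw [scalar_apply, Matrix.sub_apply, border_succ_succ]
    rcases eq_or_ne i j with rfl | hij
    · simp
    · simp [hij]

theorem UnitarilyInvariant.border_diagonal {N : ℕ} {β : Type*}
    {F : Matrix (Fin (N + 1)) (Fin (N + 1)) ℂ → β} (hF : UnitarilyInvariant F)
    {a : Fin N → ℝ} {D : Fin (N + 1) → ℝ} (h : Interlaces a D) {z : Fin N → ℂ}
    (hz : ∀ i, Complex.normSq (z i) = arrowCoord a D i.succ) :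
    F (border (arrowCoord a D 0) z (diagonal fun i => (a i : ℂ)))
      = F (diagonal fun i => (D i : ℂ)) :=
  hF.eq_diagonal (border_isHermitian _ _
    (isHermitian_diagonal_of_self_adjoint _ (by ext i; simp)))
    h.strictMono_right.injective (charpoly_border_diagonal h.strictMono_left.injective hz)

/-- The real coordinates of an `N×N` Hermitian matrix. -/
abbrev HermCoord (N : ℕ) : Type :=
  (Fin N → ℝ) × ({ p : Fin N × Fin N // p.1 < p.2 } → ℝ × ℝ)

/-- Pairs `i < j` in `Fin (N + 1)`: either `i = 0`, or both are successors. -/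
noncomputable def pairSuccEquiv (N : ℕ) :
    Fin N ⊕ { p : Fin N × Fin N // p.1 < p.2 } ≃
      { p : Fin (N + 1) × Fin (N + 1) // p.1 < p.2 } :=
  Equiv.ofBijective (Sum.elim (fun j => ⟨(0, j.succ), Fin.succ_pos j⟩)
    fun p => ⟨(p.1.1.succ, p.1.2.succ), Fin.succ_lt_succ_iff.2 p.2⟩) (by
    constructor
    · rintro (i | ⟨⟨i, j⟩, h⟩) (i' | ⟨⟨i', j'⟩, h'⟩) hh <;>
        simp_all [(Fin.succ_ne_zero _).symm]
    · rintro ⟨⟨i, j⟩, h⟩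
      obtain ⟨j, rfl⟩ := Fin.exists_succ_eq.2 (Fin.ne_zero_of_lt h)
      rcases eq_or_ne i 0 with rfl | hi
      · exact ⟨Sum.inl j, rfl⟩
      · obtain ⟨i, rfl⟩ := Fin.exists_succ_eq.2 hi
        exact ⟨Sum.inr ⟨(i, j), Fin.succ_lt_succ_iff.1 h⟩, rfl⟩)

/-- The coordinates of `border c z (hermMat N v)`. -/
noncomputable def borderCoord {N : ℕ} (c : ℝ) (z : Fin N → ℂ) (v : HermCoord N) :
    HermCoord (N + 1) :=
  (Fin.cons c v.1,
    fun p => Sum.elim (fun j => ((z j).re, (z j).im)) v.2 ((pairSuccEquiv N).symm p))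

theorem hermMat_borderCoord {N : ℕ} (c : ℝ) (z : Fin N → ℂ) (v : HermCoord N) :
    hermMat (N + 1) (borderCoord c z v) = border c z (hermMat N v) := by
  have h0 : ∀ j : Fin N, (pairSuccEquiv N).symm ⟨(0, j.succ), Fin.succ_pos j⟩ = Sum.inl j :=
    fun j => (Equiv.symm_apply_eq _).2 rfl
  have h1 : ∀ (i j : Fin N) (h : i < j), (pairSuccEquiv N).symm
      ⟨(i.succ, j.succ), Fin.succ_lt_succ_iff.2 h⟩ = Sum.inr ⟨(i, j), h⟩ :=
    fun i j h => (Equiv.symm_apply_eq _).2 rfl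
  ext i j
  refine Fin.cases ?_ (fun i => ?_) i <;> refine Fin.cases ?_ (fun j => ?_) j
  · simp [hermMat, borderCoord]
  · simp [hermMat, borderCoord, h0]
  · simp only [hermMat, borderCoord, of_apply, Fin.not_lt_zero, dite_false, Fin.succ_pos,
      dite_true, h0, Sum.elim_inl, border_succ_zero]
    apply Complex.ext <;> simp
  · rw [border_succ_succ]
    rcases lt_trichotomy i j with h | rfl | h
    · simp [hermMat, borderCoord, h1, h]
    · simp [hermMat, borderCoord]
    · simp [hermMat, borderCoord, h1, h, h.not_gt]

@[fun_prop]
theorem measurable_borderCoord {N : ℕ} {α : Type*} [MeasurableSpace α] {c : α → ℝ}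
    {z : α → Fin N → ℂ} {v : α → HermCoord N} (hc : Measurable c) (hz : Measurable z)
    (hv : Measurable v) : Measurable fun x => borderCoord (c x) (z x) (v x) := by
  refine Measurable.prodMk ?_ ?_
  · refine measurable_pi_lambda _ fun i => ?_
    refine Fin.cases ?_ (fun i => ?_) i
    · simpa using hc
    · simp only [Fin.cons_succ]; fun_prop
  · refine measurable_pi_lambda _ fun p => ?_
    rcases (pairSuccEquiv N).symm p with j | p
    · simp only [Sum.elim_inl]; fun_prop
    · simp only [Sum.elim_inr]; fun_prop

theorem lintegral_hermCoord_succ {N : ℕ} {f : HermCoord (N + 1) → ENNReal} (hf : Measurable f) :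
    ∫⁻ v, f v = ∫⁻ c, ∫⁻ v, ∫⁻ z, f (borderCoord c z v) := by
  have hpair : ∀ {g : ({ p : Fin (N + 1) × Fin (N + 1) // p.1 < p.2 } → ℝ × ℝ) → ENNReal},
      Measurable g → ∫⁻ w, g w = ∫⁻ w' : { p : Fin N × Fin N // p.1 < p.2 } → ℝ × ℝ,
        ∫⁻ z : Fin N → ℂ, g (fun p => Sum.elim (fun j => ((z j).re, (z j).im)) w'
          ((pairSuccEquiv N).symm p)) := by
    intro g hg
    rw [← (volume_measurePreserving_piCongrLeft (fun _ => ℝ × ℝ)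
      (pairSuccEquiv N)).lintegral_comp hg,
      ← (volume_measurePreserving_sumPiEquivProdPi_symm (fun _ => ℝ × ℝ)).lintegral_comp
        (by fun_prop), Measure.volume_eq_prod, lintegral_prod_symm _ (by fun_prop)]
    refine lintegral_congr fun w' => ?_
    rw [← (volume_preserving_pi (fun _ : Fin N =>
      Complex.volume_preserving_equiv_real_prod)).lintegral_comp (by fun_prop)]
    refine lintegral_congr fun z => ?_
    congr 1
    funext p
    obtain ⟨q, rfl⟩ := (pairSuccEquiv N).surjective p
    rw [MeasurableEquiv.coe_piCongrLeft, Equiv.piCongrLeft_apply_apply, Equiv.symm_apply_apply]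
    rcases q with j | q <;> rfl
  have hg : Measurable fun x : Fin (N + 1) → ℝ => ∫⁻ w, f (x, w) := hf.lintegral_prod_right'
  rw [Measure.volume_eq_prod, lintegral_prod _ hf.aemeasurable,
    ← (volume_preserving_piFinSuccAbove (fun _ => ℝ) (0 : Fin (N + 1))).symm.lintegral_comp
      hg, Measure.volume_eq_prod,
    lintegral_prod _ (by fun_prop)]
  refine lintegral_congr fun c => ?_
  rw [Measure.volume_eq_prod (Fin N → ℝ), lintegral_prod]
  swap
  · refine (Measurable.lintegral_prod_right' (ν := (volume : Measure (Fin N → ℂ)))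
      (f := fun x : HermCoord N × (Fin N → ℂ) => f (borderCoord c x.2 x.1)) ?_).aemeasurable
    fun_prop
  refine lintegral_congr fun v => ?_
  rw [hpair (by fun_prop)]
  refine lintegral_congr fun w => lintegral_congr fun z => ?_
  simp only [borderCoord]
  congr 2
  funext i
  refine Fin.cases ?_ (fun i => ?_) i
  · rfl
  · rfl

/-- A linear map that fixes a bounded nonempty open set preserves Haar measure. -/
theorem measurePreserving_of_image_eq {E : Type*} [NormedAddCommGroup E] [NormedSpace ℝ E]
    [MeasurableSpace E] [BorelSpace E] [FiniteDimensional ℝ E] (μ : Measure E)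
    [μ.IsAddHaarMeasure] (L : E →ₗ[ℝ] E) {S : Set E} (hS : IsOpen S) (hne : S.Nonempty)
    (hb : Bornology.IsBounded S) (h : L '' S = S) : MeasurePreserving L μ μ := by
  have h1 := Measure.addHaar_image_linearMap μ L S
  rw [h] at h1
  have hd : ENNReal.ofReal |LinearMap.det L| = 1 :=
    (ENNReal.mul_eq_right (hS.measure_pos μ hne).ne' hb.measure_lt_top.ne).1 h1.symm
  have hd' : |LinearMap.det L| = 1 := by simpa using hd
  refine ⟨L.continuous_of_finiteDimensional.measurable, ?_⟩
  rw [Measure.map_linearMap_addHaar_eq_smul_addHaar μ (by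
    intro h0; rw [h0] at hd'; simp at hd'), abs_inv, hd']
  simp

theorem measurePreserving_vecMul {N : ℕ} {U : Matrix (Fin N) (Fin N) ℂ}
    (hU : U ∈ unitaryGroup (Fin N) ℂ) :
    MeasurePreserving (fun z : Fin N → ℂ => z ᵥ* U) volume volume := by
  have hq : ∀ {U : Matrix (Fin N) (Fin N) ℂ}, U ∈ unitaryGroup (Fin N) ℂ → ∀ z : Fin N → ℂ,
      (z ᵥ* U) ⬝ᵥ star (z ᵥ* U) = z ⬝ᵥ star z := by
    intro U hU z
    rw [star_vecMul, ← dotProduct_mulVec, mulVec_mulVec, ← star_eq_conjTranspose,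
      mem_unitaryGroup_iff.1 hU, one_mulVec]
  have hsum : ∀ z : Fin N → ℂ, (z ⬝ᵥ star z).re = ∑ i, Complex.normSq (z i) := by
    intro z
    simp [dotProduct, Complex.normSq_apply]
  refine measurePreserving_of_image_eq volume ((vecMulLinear U).restrictScalars ℝ)
    (S := {z : Fin N → ℂ | (z ⬝ᵥ star z).re < 1}) ?_ ⟨0, by simp⟩ ?_ ?_
  · refine isOpen_lt ?_ continuous_const
    simp only [hsum]
    have := Complex.continuous_normSq
    fun_prop
  · refine (Metric.isBounded_iff_subset_closedBall 0).2 ⟨1, fun z hz => ?_⟩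
    rw [mem_closedBall_zero_iff, pi_norm_le_iff_of_nonneg zero_le_one]
    intro i
    rw [Set.mem_ofPred_eq, hsum] at hz
    have h1 := Finset.single_le_sum (f := fun i => Complex.normSq (z i))
      (fun i _ => Complex.normSq_nonneg _) (Finset.mem_univ i)
    simp only [Complex.normSq_eq_norm_sq] at h1 hz
    nlinarith [norm_nonneg (z i)]
  · refine Set.Subset.antisymm ?_ fun z hz => ?_
    · rintro _ ⟨z, hz, rfl⟩
      simpa [hq hU] using hz
    · refine ⟨z ᵥ* star U, ?_, ?_⟩
      · simpa [hq (Unitary.star_mem hU)] using hz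
      · change z ᵥ* star U ᵥ* U = z
        rw [vecMul_vecMul, mem_unitaryGroup_iff'.1 hU, vecMul_one]

/-- The coordinates of a Hermitian matrix. -/
noncomputable def toHermCoord {N : ℕ} (X : Matrix (Fin N) (Fin N) ℂ) : HermCoord N :=
  (fun i => (X i i).re, fun p => ((X p.1.1 p.1.2).re, (X p.1.1 p.1.2).im))

theorem toHermCoord_hermMat {N : ℕ} (v : HermCoord N) : toHermCoord (hermMat N v) = v := by
  refine Prod.ext (funext fun i => ?_) (funext fun p => ?_)
  · simp [toHermCoord, hermMat]
  · have := p.2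
    simp [toHermCoord, hermMat, this]

theorem hermMat_isHermitian {N : ℕ} (v : HermCoord N) : (hermMat N v).IsHermitian := by
  ext i j
  rw [conjTranspose_apply]
  rcases lt_trichotomy i j with h | rfl | h
  · simp [hermMat, h, h.not_gt, sub_eq_add_neg]
  · simp [hermMat]
  · simp [hermMat, h, h.not_gt, sub_eq_add_neg]

theorem hermMat_toHermCoord {N : ℕ} {X : Matrix (Fin N) (Fin N) ℂ} (hX : X.IsHermitian) :
    hermMat N (toHermCoord X) = X := by
  ext i j
  have hij := hX.apply i j
  rcases lt_trichotomy i j with h | rfl | h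
  · simp [hermMat, toHermCoord, h, Complex.re_add_im]
  · simpa [hermMat, toHermCoord] using Complex.conj_eq_iff_re.1 hij
  · rw [← hij]
    simp only [hermMat, toHermCoord, of_apply, h, h.not_gt, dite_true, dite_false]
    apply Complex.ext <;> simp

theorem hermMat_diagonal {N : ℕ} (D : Fin N → ℝ) :
    hermMat N (D, 0) = diagonal fun i => (D i : ℂ) := by
  ext i j
  rcases lt_trichotomy i j with h | rfl | h
  · simp [hermMat, h, h.ne]
  · simp [hermMat]
  · simp [hermMat, h, h.not_gt, h.ne']

theorem continuous_hermMat (N : ℕ) : Continuous (hermMat N) := by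
  refine continuous_matrix fun i j => ?_
  rcases lt_trichotomy i j with h | rfl | h
  · simp only [hermMat, of_apply, h, dite_true]; fun_prop
  · simp only [hermMat, of_apply, lt_irrefl, dite_false]; fun_prop
  · simp only [hermMat, of_apply, h, h.not_gt, dite_true, dite_false]; fun_prop

theorem continuous_toHermCoord (N : ℕ) :
    Continuous (toHermCoord : Matrix (Fin N) (Fin N) ℂ → HermCoord N) := by
  unfold toHermCoord
  fun_prop

/-- `hermMat` as a real-linear map. -/
noncomputable def hermMatLinear (N : ℕ) : HermCoord N →ₗ[ℝ] Matrix (Fin N) (Fin N) ℂ where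
  toFun := hermMat N
  map_add' v w := by
    ext i j
    rw [Matrix.add_apply]
    rcases lt_trichotomy i j with h | rfl | h
    · simp [hermMat, h]; ring
    · simp [hermMat]
    · simp [hermMat, h, h.not_gt]; ring
  map_smul' r v := by
    ext i j
    rw [Matrix.smul_apply]
    rcases lt_trichotomy i j with h | rfl | h
    · simp [hermMat, h]; ring
    · simp [hermMat]
    · simp [hermMat, h, h.not_gt]; ring

/-- `toHermCoord` as a real-linear map. -/
noncomputable def toHermCoordLinear (N : ℕ) : Matrix (Fin N) (Fin N) ℂ →ₗ[ℝ] HermCoord N where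
  toFun := toHermCoord
  map_add' X Y := by ext <;> simp [toHermCoord]
  map_smul' r X := by ext <;> simp [toHermCoord]

theorem isHermitian_conj {N : ℕ} {X : Matrix (Fin N) (Fin N) ℂ} (hX : X.IsHermitian)
    (U : Matrix (Fin N) (Fin N) ℂ) : (U * X * star U).IsHermitian := by
  rw [IsHermitian, conjTranspose_mul, conjTranspose_mul, hX.eq, star_eq_conjTranspose,
    conjTranspose_conjTranspose, mul_assoc]

instance isAddHaarMeasure_volume_hermCoord (N : ℕ) :
    (volume : Measure (HermCoord N)).IsAddHaarMeasure := by
  have : (volume : Measure (ℝ × ℝ)).IsAddHaarMeasure :=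
    Measure.prod.instIsAddHaarMeasure volume volume
  exact Measure.prod.instIsAddHaarMeasure volume volume

/-- Unitary conjugation preserves Lebesgue measure on Hermitian matrices. -/
theorem measurePreserving_hermCoord_conj {N : ℕ} {U : Matrix (Fin N) (Fin N) ℂ}
    (hU : U ∈ unitaryGroup (Fin N) ℂ) :
    MeasurePreserving (fun v : HermCoord N => toHermCoord (U * hermMat N v * star U))
      volume volume := by
  have hq : ∀ {U : Matrix (Fin N) (Fin N) ℂ}, U ∈ unitaryGroup (Fin N) ℂ → ∀ v : HermCoord N,
      (hermMat N (toHermCoord (U * hermMat N v * star U)) ^ 2).trace = (hermMat N v ^ 2).trace := by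
    intro U hU v
    rw [hermMat_toHermCoord (isHermitian_conj (hermMat_isHermitian v) U)]
    calc ((U * hermMat N v * star U) ^ 2).trace
        = (U * hermMat N v * (star U * U) * hermMat N v * star U).trace := by
          simp only [pow_two, mul_assoc]
      _ = (hermMat N v ^ 2).trace := by
          rw [mem_unitaryGroup_iff'.1 hU, mul_one, trace_mul_comm, ← mul_assoc, ← mul_assoc,
            mem_unitaryGroup_iff'.1 hU, one_mul, pow_two]
  have hsum : ∀ v : HermCoord N,
      (hermMat N v ^ 2).trace.re = ∑ i, ∑ j, ‖hermMat N v i j‖ ^ 2 := by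
    intro v
    simp only [pow_two (hermMat N v), trace, diag_apply, mul_apply, Complex.re_sum]
    refine Finset.sum_congr rfl fun i _ => Finset.sum_congr rfl fun j _ => ?_
    rw [← (hermMat_isHermitian v).apply i j, ← Complex.normSq_eq_norm_sq]
    simp [Complex.normSq_apply]
  have hle : ∀ (v : HermCoord N), (hermMat N v ^ 2).trace.re < 1 → ∀ i j,
      ‖hermMat N v i j‖ ≤ 1 := by
    intro v hv i j
    rw [hsum] at hv
    have h1 := Finset.single_le_sum (f := fun i => ∑ j, ‖hermMat N v i j‖ ^ 2)
      (fun i _ => Finset.sum_nonneg fun j _ => sq_nonneg _) (Finset.mem_univ i)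
    have h2 := Finset.single_le_sum (f := fun j => ‖hermMat N v i j‖ ^ 2)
      (fun j _ => sq_nonneg _) (Finset.mem_univ j)
    nlinarith [norm_nonneg (hermMat N v i j)]
  refine measurePreserving_of_image_eq volume
    (toHermCoordLinear N ∘ₗ LinearMap.mulRight ℝ (star U) ∘ₗ LinearMap.mulLeft ℝ U ∘ₗ
      hermMatLinear N) (S := {v : HermCoord N | (hermMat N v ^ 2).trace.re < 1}) ?_ ?_ ?_ ?_
  · refine isOpen_lt ?_ continuous_const
    have := continuous_hermMat N
    exact Complex.continuous_re.comp (Continuous.matrix_trace (this.pow 2))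
  · refine ⟨0, ?_⟩
    have : hermMat N 0 = 0 := map_zero (hermMatLinear N)
    simp [this]
  · refine (Metric.isBounded_iff_subset_closedBall 0).2 ⟨1, fun v hv => ?_⟩
    have h := hle v hv
    rw [mem_closedBall_zero_iff, ← toHermCoord_hermMat v]
    refine max_le ?_ ?_
    · refine (pi_norm_le_iff_of_nonneg zero_le_one).2 fun i => ?_
      exact (Complex.abs_re_le_norm _).trans (h i i)
    · refine (pi_norm_le_iff_of_nonneg zero_le_one).2 fun p => max_le ?_ ?_
      · exact (Complex.abs_re_le_norm _).trans (h _ _)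
      · exact (Complex.abs_im_le_norm _).trans (h _ _)
  · refine Set.Subset.antisymm ?_ fun v hv => ?_
    · rintro _ ⟨v, hv, rfl⟩
      exact (congrArg Complex.re (hq hU v)).trans_lt hv
    · refine ⟨toHermCoord (star U * hermMat N v * star (star U)), ?_, ?_⟩
      · exact (congrArg Complex.re (hq (Unitary.star_mem hU) v)).trans_lt hv
      · change toHermCoord (U * hermMat N (toHermCoord _) * star U) = v
        rw [hermMat_toHermCoord (isHermitian_conj (hermMat_isHermitian v) _), star_star,
          mul_assoc, mul_assoc, mul_assoc, mem_unitaryGroup_iff.1 hU, mul_one, ← mul_assoc,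
          mem_unitaryGroup_iff.1 hU, one_mul, toHermCoord_hermMat]

theorem lintegral_comp_normSq {f : ℝ → ENNReal} (hf : Measurable f) :
    ∫⁻ z : ℂ, f (Complex.normSq z) = (NNReal.pi : ENNReal) * ∫⁻ t in Set.Ioi 0, f t := by
  have himg : (fun r : ℝ => r ^ 2) '' Set.Ioi 0 = Set.Ioi 0 := by
    refine Set.Subset.antisymm ?_ fun t (ht : 0 < t) => ⟨√t, Real.sqrt_pos.2 ht, Real.sq_sqrt ht.le⟩
    rintro _ ⟨r, hr, rfl⟩
    exact pow_pos (Set.mem_Ioi.1 hr) 2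
  have hinj : Set.InjOn (fun r : ℝ => r ^ 2) (Set.Ioi 0) := fun r (hr : 0 < r) s (hs : 0 < s) h =>
    (pow_left_inj₀ hr.le hs.le two_ne_zero).1 h
  rw [← himg, lintegral_image_eq_lintegral_abs_deriv_mul measurableSet_Ioi
    (f := fun r : ℝ => r ^ 2) (f' := fun r => 2 * r)
    (fun r _ => by simpa using (hasDerivAt_pow 2 r).hasDerivWithinAt) hinj,
    ← Complex.lintegral_comp_polarCoord_symm]
  have htarget : polarCoord.target = Set.Ioi (0 : ℝ) ×ˢ Set.Ioo (-Real.pi) Real.pi := rfl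
  rw [htarget, Measure.volume_eq_prod, ← Measure.prod_restrict, lintegral_prod,
    ← lintegral_const_mul _ (by fun_prop)]
  · refine setLIntegral_congr_fun measurableSet_Ioi fun r (hr : 0 < r) => ?_
    have : ∀ θ : ℝ, Complex.normSq (Complex.polarCoord.symm (r, θ)) = r ^ 2 := by
      intro θ
      rw [Complex.normSq_eq_norm_sq, Complex.norm_polarCoord_symm, abs_of_pos hr]
    simp only [this, smul_eq_mul, lintegral_const, Measure.restrict_apply_univ, Real.volume_Ioo]
    rw [abs_of_pos (by positivity), ENNReal.ofReal_mul zero_le_two,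
      show Real.pi - -Real.pi = 2 * Real.pi by ring, ENNReal.ofReal_mul zero_le_two,
      show ENNReal.ofReal Real.pi = NNReal.pi from ENNReal.ofReal_coe_nnreal (p := NNReal.pi)]
    ring
  · have h1 : Measurable Complex.polarCoord.symm := by
      have : ⇑Complex.polarCoord.symm = fun p : ℝ × ℝ =>
        (p.1 : ℂ) * (Real.cos p.2 + Real.sin p.2 * Complex.I) :=
        funext Complex.polarCoord_symm_apply
      rw [this]
      fun_prop
    have h2 : Measurable Complex.normSq := Complex.continuous_normSq.measurable
    fun_prop

theorem map_normSq_volume :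
    (volume : Measure ℂ).map Complex.normSq
      = NNReal.pi • (volume : Measure ℝ).restrict (Set.Ioi 0) := by
  refine Measure.ext_of_lintegral _ fun f hf => ?_
  rw [lintegral_map hf Complex.continuous_normSq.measurable, lintegral_comp_normSq hf,
    lintegral_smul_measure]
  rfl

theorem map_pi_normSq_volume (N : ℕ) :
    (volume : Measure (Fin N → ℂ)).map (fun z i => Complex.normSq (z i))
      = (NNReal.pi ^ N) • (volume : Measure (Fin N → ℝ)).restrict {y | ∀ i, 0 < y i} := by
  have : SigmaFinite ((volume : Measure ℂ).map Complex.normSq) := by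
    rw [map_normSq_volume]; infer_instance
  rw [volume_pi, Measure.pi_map_pi fun _ => Complex.continuous_normSq.measurable.aemeasurable]
  refine Measure.pi_eq fun s hs => ?_
  have h0 : {y : Fin N → ℝ | ∀ i, 0 < y i} = Set.univ.pi fun _ => Set.Ioi 0 := by
    ext; simp
  rw [Measure.smul_apply, Measure.restrict_apply (MeasurableSet.univ_pi hs), h0,
    ← Set.pi_inter_distrib, volume_pi_pi, map_normSq_volume]
  simp only [Measure.smul_apply, Measure.restrict_apply (hs _), ENNReal.smul_def, smul_eq_mul,
    Finset.prod_mul_distrib, Finset.prod_const, Finset.card_univ, Fintype.card_fin,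
    ENNReal.coe_pow]

theorem UnitarilyInvariant.border_diagonal_sqrt_normSq {N : ℕ} {β : Type*}
    {F : Matrix (Fin (N + 1)) (Fin (N + 1)) ℂ → β} (hF : UnitarilyInvariant F)
    (c : ℝ) (a : Fin N → ℂ) (z : Fin N → ℂ) :
    F (border c (fun i => ((√(Complex.normSq (z i)) : ℝ) : ℂ)) (diagonal a))
      = F (border c z (diagonal a)) := by
  have : ∀ i, ∃ u : ℂ, ‖u‖ = 1 ∧ (‖z i‖ : ℂ) * u = z i :=
    fun i => ⟨Complex.exp ((z i).arg * Complex.I), Complex.norm_exp_ofReal_mul_I _,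
      Complex.norm_mul_exp_arg_mul_I _⟩
  choose u hu hz using this
  have huu : ∀ i, star (u i) * u i = 1 := fun i => by
    change (starRingEnd ℂ) (u i) * u i = 1
    rw [Complex.conj_mul', hu]; simp
  have hU : diagonal (star u) ∈ unitaryGroup (Fin N) ℂ := by
    rw [mem_unitaryGroup_iff, star_eq_conjTranspose, diagonal_conjTranspose, diagonal_mul_diagonal,
      ← diagonal_one]
    congr 1
    funext i
    simpa using huu i
  rw [← hF.border_conj hU]
  congr 2
  · funext i
    rw [star_eq_conjTranspose, diagonal_conjTranspose, vecMul_diagonal, star_star,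
      ← hz i, Complex.normSq_eq_norm_sq, Real.sqrt_sq (norm_nonneg _)]
    simp [hu]
  · rw [star_eq_conjTranspose, diagonal_conjTranspose, diagonal_mul_diagonal,
      diagonal_mul_diagonal]
    congr 1
    funext i
    rw [star_star, mul_comm, ← mul_assoc, mul_comm (u i), Pi.star_apply, huu, one_mul]

theorem isOpen_interlaces (N : ℕ) :
    IsOpen {p : (Fin N → ℝ) × (Fin (N + 1) → ℝ) | Interlaces p.1 p.2} := by
  simp only [Interlaces, Set.ofPred_forall]
  refine isOpen_iInter_of_finite fun i => IsOpen.and ?_ ?_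
  · exact isOpen_lt (by fun_prop) (by fun_prop)
  · exact isOpen_lt (by fun_prop) (by fun_prop)

theorem measurableSet_interlaces_left {N : ℕ} (a : Fin N → ℝ) :
    MeasurableSet {D | Interlaces a D} :=
  measurable_prodMk_left (isOpen_interlaces N).measurableSet

/-- Integration over the arrowhead matrices with a given diagonal block. -/
theorem lintegral_border_diagonal {N : ℕ} {F : Matrix (Fin (N + 1)) (Fin (N + 1)) ℂ → ENNReal}
    (hF : UnitarilyInvariant F) (hm : Measurable fun v => F (hermMat (N + 1) v))
    {h : ℝ → ENNReal} (hh : Measurable h) {a : Fin N → ℝ} (ha : StrictMono a) :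
    ∫⁻ c, ∫⁻ z, h c * F (border c z (diagonal fun i => (a i : ℂ)))
      = NNReal.pi ^ N * ∫⁻ D in {D | Interlaces a D},
        ENNReal.ofReal (vdm (N + 1) D / vdm N a) *
          (h (∑ i, D i - ∑ i, a i) * F (diagonal fun i => (D i : ℂ))) := by
  have hS : {y : Fin N → ℝ | ∀ i, 0 < y i} = Set.univ.pi fun _ => Set.Ioi 0 := by
    ext; simp
  have hSm : MeasurableSet {y : Fin N → ℝ | ∀ i, 0 < y i} := by
    rw [hS]; exact MeasurableSet.univ_pi fun _ => measurableSet_Ioi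
  set g : ℝ × (Fin N → ℝ) → ENNReal := fun p =>
    h p.1 * F (border p.1 (fun i => ((√(p.2 i) : ℝ) : ℂ)) (diagonal fun i => (a i : ℂ))) with hg
  have hgm : Measurable g := by
    simp only [hg, ← hermMat_diagonal, ← hermMat_borderCoord]
    have : Measurable fun p : ℝ × (Fin N → ℝ) =>
      borderCoord p.1 (fun i => ((√(p.2 i) : ℝ) : ℂ)) ((a, 0) : HermCoord N) := by fun_prop
    exact (hh.comp measurable_fst).mul (hm.comp this)
  have h1 : ∀ c, ∫⁻ z, h c * F (border c z (diagonal fun i => (a i : ℂ)))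
      = NNReal.pi ^ N * ∫⁻ y in {y : Fin N → ℝ | ∀ i, 0 < y i}, g (c, y) := by
    intro c
    have h2 : Measurable fun (z : Fin N → ℂ) i => Complex.normSq (z i) := by
      have := Complex.continuous_normSq.measurable
      fun_prop
    have h3 := lintegral_map (μ := (volume : Measure (Fin N → ℂ)))
      (hgm.comp (measurable_prodMk_left (x := c))) h2
    rw [map_pi_normSq_volume, lintegral_smul_measure] at h3
    simp only [hg, Function.comp_def, hF.border_diagonal_sqrt_normSq] at h3
    rw [← h3]
    simp [ENNReal.smul_def, hg]
  simp only [h1]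
  rw [lintegral_const_mul _ (Measurable.lintegral_prod_right' hgm)]
  congr 1
  have hmp := (volume_preserving_piFinSuccAbove (fun _ => ℝ) (0 : Fin (N + 1)))
  have hset : {y : Fin (N + 1) → ℝ | ∀ i : Fin N, 0 < y i.succ}
      = MeasurableEquiv.piFinSuccAbove (fun _ => ℝ) (0 : Fin (N + 1)) ⁻¹'
        (Set.univ ×ˢ {y : Fin N → ℝ | ∀ i, 0 < y i}) := by
    ext y; simp [Fin.tail]
  calc ∫⁻ c, ∫⁻ y in {y : Fin N → ℝ | ∀ i, 0 < y i}, g (c, y)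
      = ∫⁻ p in Set.univ ×ˢ {y : Fin N → ℝ | ∀ i, 0 < y i}, g p := by
        rw [Measure.volume_eq_prod, ← Measure.prod_restrict, Measure.restrict_univ,
          lintegral_prod _ hgm.aemeasurable]
    _ = ∫⁻ y in {y : Fin (N + 1) → ℝ | ∀ i : Fin N, 0 < y i.succ}, g (y 0, fun i => y i.succ) := by
        rw [hset, ← hmp.setLIntegral_comp_preimage (MeasurableSet.univ.prod hSm) hgm]
        rfl
    _ = _ := by
        rw [← arrowCoord_image ha, lintegral_image_eq_lintegral_abs_det_fderiv_mul volume
          (measurableSet_interlaces_left a)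
          (fun D _ => (hasFDerivAt_arrowCoord a D).hasFDerivWithinAt) (arrowCoord_injOn ha)]
        refine setLIntegral_congr_fun (measurableSet_interlaces_left a) fun D hD => ?_
        have hD' : Interlaces a D := hD
        congr 1
        · rw [ContinuousLinearMap.det, LinearMap.coe_toContinuousLinearMap, LinearMap.det_toLin',
            abs_det_arrowJacobian ha.injective hD'.strictMono_right.injective,
            abs_of_pos (vdm_pos hD'.strictMono_right), abs_of_pos (vdm_pos ha)]
        · simp only [hg]
          rw [hF.border_diagonal hD']
          · rfl
          · intro i
            rw [Complex.normSq_ofReal, Real.mul_self_sqrt (arrowCoord_succ_pos hD' i).le]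

/-- The open Weyl chamber of strictly increasing vectors. -/
def chamber (N : ℕ) : Set (Fin N → ℝ) := {D | StrictMono D}

theorem isOpen_chamber (N : ℕ) : IsOpen (chamber N) := by
  simp only [chamber, StrictMono, Set.ofPred_forall]
  refine isOpen_iInter_of_finite fun i => isOpen_iInter_of_finite fun j =>
    isOpen_iInter_of_finite fun _ => ?_
  exact isOpen_lt (by fun_prop) (by fun_prop)

theorem setLIntegral_interlaces {N : ℕ} {k : (Fin N → ℝ) × (Fin (N + 1) → ℝ) → ENNReal} (a) :
    ∫⁻ D in {D | Interlaces a D}, k (a, D)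
      = ∫⁻ D, {p : (Fin N → ℝ) × (Fin (N + 1) → ℝ) | Interlaces p.1 p.2}.indicator k (a, D) := by
  rw [← lintegral_indicator (measurableSet_interlaces_left a)]
  rfl

theorem setLIntegral_interlaces' {N : ℕ} {k : (Fin N → ℝ) × (Fin (N + 1) → ℝ) → ENNReal} (D) :
    ∫⁻ a in {a | Interlaces a D}, k (a, D)
      = ∫⁻ a, {p : (Fin N → ℝ) × (Fin (N + 1) → ℝ) | Interlaces p.1 p.2}.indicator k (a, D) := by
  rw [← lintegral_indicator]
  · rfl
  · exact measurable_prodMk_right (isOpen_interlaces N).measurableSet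

theorem lintegral_interlaces_swap {N : ℕ} {k : (Fin N → ℝ) × (Fin (N + 1) → ℝ) → ENNReal}
    (hk : Measurable k) :
    ∫⁻ a in chamber N, ∫⁻ D in {D | Interlaces a D}, k (a, D)
      = ∫⁻ D in chamber (N + 1), ∫⁻ a in {a | Interlaces a D}, k (a, D) := by
  have hk' := hk.indicator (isOpen_interlaces N).measurableSet
  simp only [setLIntegral_interlaces, setLIntegral_interlaces']
  rw [setLIntegral_eq_of_support_subset, setLIntegral_eq_of_support_subset]
  · exact lintegral_lintegral_swap (f := fun a D =>
      {p : (Fin N → ℝ) × (Fin (N + 1) → ℝ) | Interlaces p.1 p.2}.indicator k (a, D))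
      hk'.aemeasurable
  all_goals
    intro x hx
    by_contra hn
    refine hx ?_
    dsimp only
    rw [lintegral_eq_zero_of_ae_eq_zero (ae_of_all _ fun y => Set.indicator_of_notMem ?_ _)]
    intro (h : Interlaces _ _)
  · exact hn h.strictMono_right
  · exact hn h.strictMono_left

/-- The weighted volume of the Gelfand–Tsetlin patterns with top row `D`. -/
noncomputable def gtWeight : (N : ℕ) → (Fin N → ℝ) → (Fin N → ℝ) → ENNReal
  | 0, _, _ => 1
  | N + 1, l, D => ∫⁻ a in {a | Interlaces a D},
      ENNReal.ofReal (Real.exp (-(l 0 * (∑ i, D i - ∑ i, a i)))) * gtWeight N (Fin.tail l) a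

theorem measurable_gtWeight : ∀ (N : ℕ) (l : Fin N → ℝ), Measurable (gtWeight N l)
  | 0, _ => measurable_const
  | N + 1, l => by
    have ih := measurable_gtWeight N (Fin.tail l)
    have : gtWeight (N + 1) l = fun D => ∫⁻ a,
        {p : (Fin N → ℝ) × (Fin (N + 1) → ℝ) | Interlaces p.1 p.2}.indicator
          (fun p => ENNReal.ofReal (Real.exp (-(l 0 * (∑ i, p.2 i - ∑ i, p.1 i)))) *
            gtWeight N (Fin.tail l) p.1) (a, D) := by
      funext D
      rw [← setLIntegral_interlaces']
      rfl
    rw [this]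
    refine Measurable.lintegral_prod_left' (Measurable.indicator ?_
      (isOpen_interlaces N).measurableSet)
    fun_prop

theorem lintegral_exp_mul_hermMat (N : ℕ) (l : Fin N → ℝ)
    {F : Matrix (Fin N) (Fin N) ℂ → ENNReal} (hF : UnitarilyInvariant F)
    (hm : Measurable fun v => F (hermMat N v)) :
    ∫⁻ v, ENNReal.ofReal (Real.exp (-∑ i, l i * v.1 i)) * F (hermMat N v)
      = (∏ k ∈ Finset.range N, NNReal.pi ^ k : NNReal) * ∫⁻ D in chamber N,
        ENNReal.ofReal (vdm N D) * gtWeight N l D * F (diagonal fun i => (D i : ℂ)) := by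
  induction N with
  | zero =>
    have hc : chamber 0 = Set.univ := Set.eq_univ_of_forall fun D i => i.elim0
    have h1 : ∀ v : HermCoord 0, F (hermMat 0 v) = F 0 := fun v =>
      congrArg F (Subsingleton.elim _ _)
    have h2 : ∀ D : Fin 0 → ℝ, F (diagonal fun i => (D i : ℂ)) = F 0 := fun v =>
      congrArg F (Subsingleton.elim _ _)
    have h3 : (volume : Measure (HermCoord 0)) Set.univ = 1 := by
      rw [Measure.volume_eq_prod, ← Set.univ_prod_univ, Measure.prod_prod, volume_pi,
        Measure.pi_univ, volume_pi, Measure.pi_univ]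
      simp
    have h4 : (volume : Measure (Fin 0 → ℝ)) Set.univ = 1 := by
      rw [volume_pi, Measure.pi_univ]
      simp
    simp only [h1, h2, hc, vdm, gtWeight, Finset.univ_eq_empty, Finset.sum_empty, neg_zero,
      Real.exp_zero, ENNReal.ofReal_one, one_mul, lintegral_const, Measure.restrict_univ, h3]
    have h5 := (congrArg (F 0 * ·) h4).trans (mul_one _)
    simpa using h5.symm
  | succ N ih =>
    set G : ℝ → Matrix (Fin N) (Fin N) ℂ → ENNReal := fun c A =>
      ∫⁻ z, ENNReal.ofReal (Real.exp (-(l 0 * c))) * F (border c z A) with hG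
    have hGi : ∀ c, UnitarilyInvariant (G c) := by
      intro c U hU A
      have hemb : MeasurableEmbedding fun z : Fin N → ℂ => z ᵥ* star U := by
        refine Continuous.measurableEmbedding (by fun_prop) fun z w h => ?_
        have := congrArg (fun x => x ᵥ* U) h
        simpa [vecMul_vecMul, mem_unitaryGroup_iff'.1 hU] using this
      simp only [hG]
      rw [← (measurePreserving_vecMul (Unitary.star_mem hU)).lintegral_comp_emb hemb]
      simp only [hF.border_conj hU]
    have hexp : Measurable fun c : ℝ => ENNReal.ofReal (Real.exp (-(l 0 * c))) := by fun_prop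
    have hGm : Measurable fun p : ℝ × HermCoord N => G p.1 (hermMat N p.2) := by
      simp only [hG, ← hermMat_borderCoord]
      have h1 : Measurable fun p : (ℝ × HermCoord N) × (Fin N → ℂ) =>
        F (hermMat (N + 1) (borderCoord p.1.1 p.2 p.1.2)) := hm.comp (by fun_prop)
      exact Measurable.lintegral_prod_right' (f := fun p : (ℝ × HermCoord N) × (Fin N → ℂ) =>
        ENNReal.ofReal (Real.exp (-(l 0 * p.1.1))) *
          F (hermMat (N + 1) (borderCoord p.1.1 p.2 p.1.2)))
        ((hexp.comp (by fun_prop)).mul h1)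
    have hGd : Measurable fun p : ℝ × (Fin N → ℝ) => G p.1 (diagonal fun i => (p.2 i : ℂ)) := by
      simp only [← hermMat_diagonal]
      exact hGm.comp (g := fun p : ℝ × HermCoord N => G p.1 (hermMat N p.2))
        (f := fun p : ℝ × (Fin N → ℝ) => (p.1, ((p.2, 0) : HermCoord N))) (by fun_prop)
    have hFd : Measurable fun D : Fin (N + 1) → ℝ => F (diagonal fun i => (D i : ℂ)) := by
      simp only [← hermMat_diagonal]
      exact hm.comp (by fun_prop)
    have hJ := measurable_gtWeight N (Fin.tail l)
    have hV : ∀ n, Measurable (vdm n) := fun n => by unfold vdm; fun_prop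
    have hV' := hV N
    have hV'' := hV (N + 1)
    set K : ENNReal := ((∏ k ∈ Finset.range N, NNReal.pi ^ k : NNReal) : ENNReal) with hK
    set k : (Fin N → ℝ) × (Fin (N + 1) → ℝ) → ENNReal := fun p =>
      ENNReal.ofReal (Real.exp (-(l 0 * (∑ i, p.2 i - ∑ i, p.1 i)))) *
        gtWeight N (Fin.tail l) p.1 * (ENNReal.ofReal (vdm (N + 1) p.2) *
          F (diagonal fun i => (p.2 i : ℂ))) with hk
    have hkm : Measurable k := by
      refine Measurable.mul (by fun_prop) (Measurable.mul (by fun_prop) ?_)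
      exact hFd.comp measurable_snd
    calc ∫⁻ v, ENNReal.ofReal (Real.exp (-∑ i, l i * v.1 i)) * F (hermMat (N + 1) v)
        = ∫⁻ c, ∫⁻ v : HermCoord N, ENNReal.ofReal (Real.exp (-∑ i, Fin.tail l i * v.1 i)) *
            G c (hermMat N v) := by
          have h1 : Measurable fun v : HermCoord (N + 1) =>
              ENNReal.ofReal (Real.exp (-∑ i, l i * v.1 i)) := by fun_prop
          refine (lintegral_hermCoord_succ (h1.mul hm)).trans ?_
          refine lintegral_congr fun c => lintegral_congr fun v => ?_
          simp only [Pi.mul_apply]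
          rw [hG, ← lintegral_const_mul]
          swap
          · simp only [← hermMat_borderCoord]
            exact measurable_const.mul (hm.comp (by fun_prop))
          refine lintegral_congr fun z => ?_
          rw [hermMat_borderCoord, ← mul_assoc, ← ENNReal.ofReal_mul (Real.exp_pos _).le,
            ← Real.exp_add]
          congr 3
          rw [Fin.sum_univ_succ]
          simp [borderCoord, Fin.tail]
      _ = ∫⁻ c, K * ∫⁻ a in chamber N, ENNReal.ofReal (vdm N a) * gtWeight N (Fin.tail l) a *
            G c (diagonal fun i => (a i : ℂ)) := by
          refine lintegral_congr fun c => ?_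
          exact ih (Fin.tail l) (hGi c) (hGm.comp measurable_prodMk_left)
      _ = K * ∫⁻ a in chamber N, ∫⁻ c, ENNReal.ofReal (vdm N a) * gtWeight N (Fin.tail l) a *
            G c (diagonal fun i => (a i : ℂ)) := by
          have hmm : Measurable fun p : ℝ × (Fin N → ℝ) => ENNReal.ofReal (vdm N p.2) *
            gtWeight N (Fin.tail l) p.2 * G p.1 (diagonal fun i => (p.2 i : ℂ)) :=
            Measurable.mul (by fun_prop) hGd
          rw [lintegral_const_mul _ (Measurable.lintegral_prod_right' hmm),
            lintegral_lintegral_swap hmm.aemeasurable]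
      _ = K * ∫⁻ a in chamber N, NNReal.pi ^ N * ∫⁻ D in {D | Interlaces a D}, k (a, D) := by
          congr 1
          refine setLIntegral_congr_fun (isOpen_chamber N).measurableSet fun a ha => ?_
          have ha' : StrictMono a := ha
          have hGa : Measurable fun c => G c (diagonal fun i => (a i : ℂ)) :=
            hGd.comp measurable_prodMk_right
          rw [lintegral_const_mul _ hGa,
            lintegral_border_diagonal hF hm hexp ha', mul_left_comm,
            ← lintegral_const_mul]
          swap
          · exact Measurable.mul (by fun_prop) (Measurable.mul (by fun_prop) hFd)
          congr 1
          refine setLIntegral_congr_fun (measurableSet_interlaces_left a) fun D hD => ?_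
          have hva := vdm_pos ha'
          have : ENNReal.ofReal (vdm N a) * ENNReal.ofReal (vdm (N + 1) D / vdm N a)
              = ENNReal.ofReal (vdm (N + 1) D) := by
            rw [← ENNReal.ofReal_mul hva.le, mul_div_cancel₀ _ hva.ne']
          simp only [hk]
          rw [← this]
          ring
      _ = _ := by
          rw [lintegral_const_mul', lintegral_interlaces_swap hkm,
            Finset.prod_range_succ, ENNReal.coe_mul, mul_assoc, ENNReal.coe_pow]
          · congr 2
            refine setLIntegral_congr_fun (isOpen_chamber _).measurableSet fun D _ => ?_
            simp only [hk]
            rw [lintegral_mul_const _ (by fun_prop), gtWeight]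
            ring
          · exact ENNReal.pow_ne_top ENNReal.coe_ne_top

theorem setOf_interlaces_eq_pi {N : ℕ} (D : Fin (N + 1) → ℝ) :
    {a | Interlaces a D} = Set.univ.pi fun i : Fin N => Set.Ioo (D i.castSucc) (D i.succ) := by
  ext a; simp [Interlaces]

theorem Continuous.integrableOn_interlaces {N : ℕ} {f : (Fin N → ℝ) → ℝ} (hf : Continuous f)
    (D : Fin (N + 1) → ℝ) : IntegrableOn f {a | Interlaces a D} := by
  refine (hf.continuousOn.integrableOn_compact
    (isCompact_univ_pi fun i : Fin N => isCompact_Icc (a := D i.castSucc) (b := D i.succ))).mono_set ?_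
  rw [setOf_interlaces_eq_pi]
  exact Set.pi_mono fun i _ => Set.Ioo_subset_Icc_self

/-- A determinant with a first row of ones, in terms of the differences of its columns. -/
theorem det_cons_one_eq_det_sub {N : ℕ} {R : Type*} [CommRing R] (A : Fin N → Fin (N + 1) → R) :
    (of (Fin.cons (fun _ => 1) A : Fin (N + 1) → Fin (N + 1) → R)).det
      = (of fun i j : Fin N => A i j.succ - A i j.castSucc).det := by
  rw [det_eq_of_forall_col_eq_smul_add_pred (B := of (Fin.cons (Fin.cons 1 0)
    fun i => Fin.cons (A i 0) fun j => A i j.succ - A i j.castSucc)) (fun _ => 1)]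
  · rw [det_succ_row_zero, Fin.sum_univ_succ]
    simp only [of_apply, Fin.cons_zero, Fin.cons_succ, Pi.zero_apply, mul_zero, zero_mul,
      Finset.sum_const_zero, add_zero, Fin.val_zero, pow_zero, one_mul]
    congr 1
  · intro i
    refine Fin.cases ?_ (fun i => ?_) i <;> simp
  · intro i j
    refine Fin.cases ?_ (fun i => ?_) i <;> simp

theorem integral_interlaces_det {N : ℕ} {φ Ψ : Fin N → ℝ → ℝ} (hφ : ∀ i, Continuous (φ i))
    (hΨ : ∀ i x, HasDerivAt (Ψ i) (φ i x) x) {D : Fin (N + 1) → ℝ} (hD : StrictMono D) :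
    ∫ a in {a | Interlaces a D}, (of fun i j => φ i (a j)).det
      = (of (Fin.cons (fun _ => 1) fun i j => Ψ i (D j) :
          Fin (N + 1) → Fin (N + 1) → ℝ)).det := by
  rw [det_cons_one_eq_det_sub]
  simp only [det_apply', of_apply]
  rw [integral_finsetSum]
  · refine Finset.sum_congr rfl fun σ _ => ?_
    rw [integral_const_mul, setOf_interlaces_eq_pi, volume_pi, Measure.restrict_pi_pi,
      integral_fintype_prod_eq_prod (f := fun j => φ (σ j))]
    congr 1
    refine Finset.prod_congr rfl fun j _ => ?_
    rw [← integral_Ioc_eq_integral_Ioo, ← intervalIntegral.integral_of_le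
      (hD.monotone (Fin.castSucc_lt_succ (i := j)).le),
      intervalIntegral.integral_eq_sub_of_hasDerivAt (fun x _ => hΨ (σ j) x)
        ((hφ _).intervalIntegrable _ _)]
  · intro σ _
    have : Continuous fun a : Fin N → ℝ =>
        ((Equiv.Perm.sign σ : ℤ) : ℝ) * ∏ j, φ (σ j) (a j) := by fun_prop
    exact this.integrableOn_interlaces D

theorem gtWeight_succ_eq_ofReal {N : ℕ} {l : Fin (N + 1) → ℝ} {g : (Fin N → ℝ) → ℝ}
    (hg : Continuous g) (h0 : ∀ a, StrictMono a → 0 ≤ g a)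
    (h : ∀ a, StrictMono a → gtWeight N (Fin.tail l) a = ENNReal.ofReal (g a))
    {D : Fin (N + 1) → ℝ} {x : ℝ}
    (hx : ∫ a in {a | Interlaces a D}, Real.exp (-(l 0 * (∑ i, D i - ∑ i, a i))) * g a = x) :
    0 ≤ x ∧ gtWeight (N + 1) l D = ENNReal.ofReal x := by
  have hm : MeasurableSet {a | Interlaces a D} :=
    measurable_prodMk_right (isOpen_interlaces N).measurableSet
  have hnn : ∀ a, Interlaces a D → 0 ≤ Real.exp (-(l 0 * (∑ i, D i - ∑ i, a i))) * g a :=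
    fun a ha => mul_nonneg (Real.exp_pos _).le (h0 a ha.strictMono_left)
  subst hx
  refine ⟨setIntegral_nonneg hm hnn, ?_⟩
  rw [ofReal_integral_eq_lintegral_ofReal, gtWeight]
  · refine setLIntegral_congr_fun hm fun a (ha : Interlaces a D) => ?_
    rw [ENNReal.ofReal_mul (Real.exp_pos _).le, ← h a ha.strictMono_left]
  · exact Continuous.integrableOn_interlaces (by fun_prop) D
  · exact (ae_restrict_iff' hm).2 (ae_of_all _ hnn)

theorem vdm_succ {N : ℕ} (z : Fin (N + 1) → ℝ) :
    vdm (N + 1) z = (∏ j : Fin N, (z j.succ - z 0)) * vdm N (Fin.tail z) := by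
  rw [vdm, Fin.prod_univ_succ, vdm]
  congr 1
  · rw [Fin.Ioi_zero_eq_map, Finset.prod_map]
    rfl
  · refine Finset.prod_congr rfl fun i _ => ?_
    rw [← Fin.map_succEmb_Ioi, Finset.prod_map]
    rfl

theorem gtWeight_eq : ∀ {N : ℕ} {l : Fin N → ℝ}, Function.Injective l → ∀ {D : Fin N → ℝ},
    StrictMono D → 0 ≤ (of fun i j => Real.exp (-l i * D j)).det / vdm N (-l) ∧
      gtWeight N l D = ENNReal.ofReal ((of fun i j => Real.exp (-l i * D j)).det / vdm N (-l))
  | 0, l, _, D, _ => by simp [vdm, gtWeight]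
  | N + 1, l, hl, D, hD => by
    have hl' : Function.Injective (Fin.tail l) := hl.comp (Fin.succ_injective N)
    have ih := fun a ha => @gtWeight_eq N (Fin.tail l) hl' a ha
    refine gtWeight_succ_eq_ofReal (g := fun a =>
      (of fun i j => Real.exp (-Fin.tail l i * a j)).det / vdm N (-Fin.tail l)) ?_
      (fun a ha => (ih a ha).1) (fun a ha => (ih a ha).2) ?_
    · refine Continuous.div_const (Continuous.matrix_det (continuous_matrix fun i j => ?_)) _
      simp only [of_apply]; fun_prop
    · have hne : ∀ i : Fin N, l 0 - l i.succ ≠ 0 :=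
        fun i => sub_ne_zero.2 fun h => absurd (hl h) (Fin.succ_ne_zero i).symm
      have hcol : ∀ a : Fin N → ℝ, Real.exp (-(l 0 * (∑ i, D i - ∑ i, a i))) *
          ((of fun i j => Real.exp (-Fin.tail l i * a j)).det / vdm N (-Fin.tail l))
          = Real.exp (-(l 0 * ∑ i, D i)) / vdm N (-Fin.tail l) *
            (of fun i j => Real.exp ((l 0 - l i.succ) * a j)).det := by
        intro a
        have : (of fun i j : Fin N => Real.exp ((l 0 - l i.succ) * a j)).det
            = Real.exp (l 0 * ∑ i, a i) * (of fun i j => Real.exp (-Fin.tail l i * a j)).det := by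
          rw [Finset.mul_sum, Real.exp_sum, ← det_mul_row]
          congr 1
          ext i j
          simp only [of_apply, ← Real.exp_add, Fin.tail]
          ring_nf
        rw [this, mul_sub, neg_sub, sub_eq_neg_add, Real.exp_add]
        ring
      simp only [hcol]
      rw [integral_const_mul, integral_interlaces_det
        (φ := fun i x => Real.exp ((l 0 - l i.succ) * x))
        (Ψ := fun i x => (l 0 - l i.succ)⁻¹ * Real.exp ((l 0 - l i.succ) * x))
        (fun i => by fun_prop) ?_ hD]
      · have h1 : (of (Fin.cons (fun _ => 1) fun (i : Fin N) j =>
            (l 0 - l i.succ)⁻¹ * Real.exp ((l 0 - l i.succ) * D j) :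
            Fin (N + 1) → Fin (N + 1) → ℝ)).det
            = (∏ i : Fin N, (l 0 - l i.succ)⁻¹) * (Real.exp (l 0 * ∑ i, D i) *
              (of fun i j => Real.exp (-l i * D j)).det) := by
          rw [Finset.mul_sum, Real.exp_sum, ← det_mul_row]
          have : ∏ i : Fin N, (l 0 - l i.succ)⁻¹
              = ∏ i : Fin (N + 1), (Fin.cons 1 fun i : Fin N => (l 0 - l i.succ)⁻¹ :
                Fin (N + 1) → ℝ) i := by
            rw [Fin.prod_univ_succ]; simp
          rw [this, ← det_mul_column]
          congr 1
          ext i j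
          refine Fin.cases ?_ (fun i => ?_) i
          · simp [← Real.exp_add]
          · simp only [of_apply, Fin.cons_succ, ← Real.exp_add]
            ring_nf
        have h2 : vdm (N + 1) (-l) = (∏ i : Fin N, (l 0 - l i.succ)) * vdm N (-Fin.tail l) := by
          rw [vdm_succ]
          congr 1
          refine Finset.prod_congr rfl fun i _ => ?_
          simp only [Pi.neg_apply]; ring
        rw [h1, h2, Finset.prod_inv_distrib, Real.exp_neg]
        have := Real.exp_ne_zero (l 0 * ∑ i, D i)
        field_simp
      · intro i x
        refine ((((hasDerivAt_id x).const_mul (l 0 - l i.succ)).exp).const_mul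
          (l 0 - l i.succ)⁻¹).congr_deriv ?_
        rw [mul_one, mul_comm (Real.exp _), inv_mul_cancel_left₀ (hne i)]
        rfl

theorem gtWeight_zero : ∀ {N : ℕ} {D : Fin N → ℝ}, StrictMono D →
    0 ≤ vdm N D / ∏ k ∈ Finset.range N, (k.factorial : ℝ) ∧
      gtWeight N 0 D = ENNReal.ofReal (vdm N D / ∏ k ∈ Finset.range N, (k.factorial : ℝ))
  | 0, D, _ => by simp [vdm, gtWeight]
  | N + 1, D, hD => by
    have ih := fun a ha => @gtWeight_zero N a ha
    refine gtWeight_succ_eq_ofReal (l := 0) (g := fun a =>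
      vdm N a / ∏ k ∈ Finset.range N, (k.factorial : ℝ)) ?_
      (fun a ha => (ih a ha).1) (fun a ha => (ih a ha).2) ?_
    · unfold vdm; fun_prop
    · simp only [Pi.zero_apply, zero_mul, neg_zero, Real.exp_zero, one_mul]
      rw [integral_div, Finset.prod_range_succ, mul_comm, ← div_div]
      congr 1
      have h1 : ∀ a : Fin N → ℝ, vdm N a = (of fun i j : Fin N => (a j) ^ (i : ℕ)).det := by
        intro a
        rw [vdm_eq_det, ← det_transpose]
        rfl
      simp only [h1]
      rw [integral_interlaces_det (φ := fun i x => x ^ (i : ℕ))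
        (Ψ := fun i x => ((i : ℕ) + 1 : ℝ)⁻¹ * x ^ ((i : ℕ) + 1)) (fun i => by fun_prop) ?_ hD]
      · rw [eq_div_iff (by positivity)]
        have : (N.factorial : ℝ) = ∏ i : Fin (N + 1), (Fin.cons 1 fun i : Fin N => ((i : ℕ) + 1 : ℝ) :
            Fin (N + 1) → ℝ) i := by
          rw [Fin.prod_univ_succ, ← Finset.prod_range_add_one_eq_factorial, ← Fin.prod_univ_eq_prod_range]
          simp
        rw [this, mul_comm, ← det_mul_column, vdm_eq_det, ← det_transpose (vandermonde D)]
        congr 1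
        ext i j
        refine Fin.cases ?_ (fun i => ?_) i
        · simp
        · simp only [of_apply, Fin.cons_succ, transpose_apply, vandermonde_apply, Fin.val_succ]
          have : ((i : ℕ) + 1 : ℝ) ≠ 0 := by positivity
          field_simp
      · intro i x
        refine ((hasDerivAt_pow ((i : ℕ) + 1) x).const_mul ((i : ℕ) + 1 : ℝ)⁻¹).congr_deriv ?_
        have : ((i : ℕ) + 1 : ℝ) ≠ 0 := by positivity
        push_cast
        rw [inv_mul_cancel_left₀ this]

/-- The constant in the Weyl integration formula over the chamber. -/
noncomputable def weylConst (N : ℕ) : NNReal :=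
  (∏ k ∈ Finset.range N, NNReal.pi ^ k) / ∏ k ∈ Finset.range N, (k.factorial : NNReal)

/-- The Weyl integration formula for Hermitian matrices. -/
theorem lintegral_hermMat (N : ℕ) {F : Matrix (Fin N) (Fin N) ℂ → ENNReal}
    (hF : UnitarilyInvariant F) (hm : Measurable fun v => F (hermMat N v)) :
    ∫⁻ v, F (hermMat N v) = weylConst N * ∫⁻ D in chamber N,
        ENNReal.ofReal (vdm N D ^ 2) * F (diagonal fun i => (D i : ℂ)) := by
  have h := lintegral_exp_mul_hermMat N 0 hF hm
  simp only [Pi.zero_apply, zero_mul, Finset.sum_const_zero, neg_zero, Real.exp_zero,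
    ENNReal.ofReal_one, one_mul] at h
  have hc : ((∏ k ∈ Finset.range N, (k.factorial : NNReal) : NNReal) : ℝ) ≠ 0 := by
    push_cast
    exact Finset.prod_ne_zero_iff.2 fun k _ => by positivity
  rw [h, weylConst, div_eq_mul_inv, ENNReal.coe_mul, mul_assoc]
  congr 1
  rw [← lintegral_const_mul' _ _ ENNReal.coe_ne_top]
  refine setLIntegral_congr_fun (isOpen_chamber N).measurableSet fun D hD => ?_
  have hD' : StrictMono D := hD
  rw [(gtWeight_zero hD').2, ← ENNReal.ofReal_mul (vdm_pos hD').le, ← mul_assoc,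
    ← ENNReal.ofReal_coe_nnreal, ← ENNReal.ofReal_mul NNReal.zero_le_coe]
  congr 2
  push_cast
  rw [div_eq_mul_inv]
  ring

theorem ae_linearMap_ne_zero {N : ℕ} {L : (Fin N → ℝ) →ₗ[ℝ] ℝ} (hL : L ≠ 0) :
    ∀ᵐ D : Fin N → ℝ, L D ≠ 0 :=
  measure_mono_null (fun D hD => by simpa using hD)
    (Measure.addHaar_submodule volume (LinearMap.ker L) (by rwa [Ne, LinearMap.ker_eq_top]))

theorem ae_add_smul_ne_zero {N : ℕ} (r : ℝ) :
    ∀ᵐ D : Fin N → ℝ, ∀ i j, i ≠ j → D i + r * D j ≠ 0 := by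
  simp only [ae_all_iff]
  intro i j hij
  refine ae_linearMap_ne_zero (L := LinearMap.proj i + r • LinearMap.proj j) fun h => ?_
  have := LinearMap.congr_fun h (Pi.single i 1)
  simp [hij] at this

theorem ae_injective (N : ℕ) : ∀ᵐ D : Fin N → ℝ, Function.Injective D := by
  filter_upwards [ae_add_smul_ne_zero (N := N) (-1)] with D hD i j hij
  by_contra hne
  exact hD i j hne (by rw [hij]; ring)

theorem existsUnique_perm_strictMono {N : ℕ} {D : Fin N → ℝ} (hD : Function.Injective D) :
    ∃! σ : Equiv.Perm (Fin N), StrictMono (D ∘ σ) := by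
  refine ⟨Tuple.sort D, (Tuple.monotone_sort D).strictMono_of_injective
    (hD.comp (Tuple.sort D).injective), fun σ hσ => ?_⟩
  have hσ' : StrictMono (D ∘ σ) := hσ
  exact Tuple.eq_sort_iff.2 ⟨hσ'.monotone, fun i j hij h => absurd (hσ'.injective h) hij.ne⟩

theorem measurePreserving_comp_perm {N : ℕ} (σ : Equiv.Perm (Fin N)) :
    MeasurePreserving (fun D : Fin N → ℝ => D ∘ σ) volume volume := by
  convert volume_measurePreserving_piCongrLeft (fun _ : Fin N => ℝ) σ.symm using 1
  ext D i
  obtain ⟨i, rfl⟩ := σ.symm.surjective i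
  rw [MeasurableEquiv.coe_piCongrLeft, Equiv.piCongrLeft_apply_apply]
  simp

/-- The integral of a symmetric function is `N!` times its integral over the chamber. -/
theorem lintegral_eq_factorial_mul {N : ℕ} {f : (Fin N → ℝ) → ENNReal} (hf : Measurable f)
    (hs : ∀ (σ : Equiv.Perm (Fin N)) D, f (D ∘ σ) = f D) :
    ∫⁻ D, f D = N.factorial * ∫⁻ D in chamber N, f D := by
  have hm := hf.indicator (isOpen_chamber N).measurableSet
  calc ∫⁻ D, f D = ∫⁻ D, ∑ σ : Equiv.Perm (Fin N), (chamber N).indicator f (D ∘ σ) := by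
        refine lintegral_congr_ae ?_
        filter_upwards [ae_injective N] with D hD
        obtain ⟨σ, hσ, hu⟩ := existsUnique_perm_strictMono hD
        rw [Finset.sum_eq_single σ, Set.indicator_of_mem (show D ∘ σ ∈ chamber N from hσ), hs]
        · intro τ _ hτ
          exact Set.indicator_of_notMem (fun h => hτ (hu τ h)) _
        · simp
    _ = ∑ σ : Equiv.Perm (Fin N), ∫⁻ D, (chamber N).indicator f D := by
        rw [lintegral_finsetSum]
        · exact Finset.sum_congr rfl fun σ _ => (measurePreserving_comp_perm σ).lintegral_comp hm
        · exact fun σ _ => hm.comp (measurePreserving_comp_perm σ).measurable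
    _ = _ := by
        rw [lintegral_indicator (isOpen_chamber N).measurableSet, Finset.sum_const,
          Finset.card_univ, Fintype.card_perm, Fintype.card_fin, nsmul_eq_mul]

theorem vdm_comp_perm {N : ℕ} (D : Fin N → ℝ) (σ : Equiv.Perm (Fin N)) :
    vdm N (D ∘ σ) = (Equiv.Perm.sign σ : ℤ) * vdm N D := by
  rw [vdm_eq_det, vdm_eq_det, ← det_permute]
  rfl

noncomputable instance instMeasurableSpaceUnitaryGroup (N : ℕ) :
    MeasurableSpace (unitaryGroup (Fin N) ℂ) :=
  borel _

instance instBorelSpaceUnitaryGroup (N : ℕ) : BorelSpace (unitaryGroup (Fin N) ℂ) := ⟨rfl⟩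

instance instSecondCountableUnitaryGroup (N : ℕ) :
    SecondCountableTopology (unitaryGroup (Fin N) ℂ) := by
  have : SecondCountableTopology (Matrix (Fin N) (Fin N) ℂ) :=
    inferInstanceAs (SecondCountableTopology (Fin N → Fin N → ℂ))
  exact TopologicalSpace.Subtype.secondCountableTopology _

instance instCompactSpaceUnitaryGroup (N : ℕ) : CompactSpace (unitaryGroup (Fin N) ℂ) := by
  refine isCompact_iff_compactSpace.1 ?_
  refine (isCompact_univ_pi fun _ : Fin N => isCompact_univ_pi fun _ : Fin N =>
    isCompact_closedBall (0 : ℂ) 1).of_isClosed_subset ?_ fun U hU i _ j _ => ?_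
  · have : ((unitaryGroup (Fin N) ℂ : Set (Matrix (Fin N) (Fin N) ℂ))) =
      {U | U * star U = 1} := by
      ext U
      exact mem_unitaryGroup_iff
    exact this ▸ isClosed_eq (by fun_prop) continuous_const
  · simpa using entry_norm_bound_of_unitary hU i j

/-- The Haar probability measure on `U(N)`. -/
noncomputable def haarU (N : ℕ) : Measure (unitaryGroup (Fin N) ℂ) := Measure.haarMeasure ⊤

instance instIsHaarMeasureHaarU (N : ℕ) : (haarU N).IsHaarMeasure :=
  Measure.isHaarMeasure_haarMeasure _

instance instIsProbabilityMeasureHaarU (N : ℕ) : IsProbabilityMeasure (haarU N) :=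
  ⟨Measure.haarMeasure_self (K₀ := (⊤ : TopologicalSpace.PositiveCompacts
    (unitaryGroup (Fin N) ℂ)))⟩

/-- The coordinates of the Hermitian matrix `U* X U`. -/
noncomputable def conjCoord {N : ℕ} (U : unitaryGroup (Fin N) ℂ) (X : Matrix (Fin N) (Fin N) ℂ) :
    HermCoord N :=
  toHermCoord (star (U : Matrix (Fin N) (Fin N) ℂ) * X * U)

theorem Continuous.conjCoord {α : Type*} [TopologicalSpace α] {N : ℕ}
    {f : α → unitaryGroup (Fin N) ℂ} {g : α → Matrix (Fin N) (Fin N) ℂ} (hf : Continuous f)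
    (hg : Continuous g) : Continuous fun a => conjCoord (f a) (g a) := by
  have hf' : Continuous fun a => (f a : Matrix (Fin N) (Fin N) ℂ) :=
    continuous_subtype_val.comp hf
  exact (continuous_toHermCoord N).comp ((hf'.star.mul hg).mul hf')

theorem continuous_conjCoord_hermMat (N : ℕ) :
    Continuous fun p : unitaryGroup (Fin N) ℂ × HermCoord N => conjCoord p.1 (hermMat N p.2) :=
  continuous_fst.conjCoord ((continuous_hermMat N).comp continuous_snd)

theorem continuous_conjCoord_diagonal (N : ℕ) :
    Continuous fun p : unitaryGroup (Fin N) ℂ × (Fin N → ℝ) =>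
      conjCoord p.1 (diagonal fun i => (p.2 i : ℂ)) :=
  continuous_fst.conjCoord (by fun_prop)

theorem hermMat_conjCoord {N : ℕ} (U : unitaryGroup (Fin N) ℂ) {X : Matrix (Fin N) (Fin N) ℂ}
    (hX : X.IsHermitian) :
    hermMat N (conjCoord U X) = star (U : Matrix (Fin N) (Fin N) ℂ) * X * U := by
  have h := hermMat_toHermCoord (isHermitian_conj hX (star (U : Matrix (Fin N) (Fin N) ℂ)))
  rwa [star_star] at h

theorem measurePreserving_conjCoord {N : ℕ} (U : unitaryGroup (Fin N) ℂ) :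
    MeasurePreserving (fun v => conjCoord U (hermMat N v)) volume volume := by
  have h := measurePreserving_hermCoord_conj (Unitary.star_mem U.2)
  rwa [star_star] at h

theorem UnitarilyInvariant.apply_conjCoord {N : ℕ} {β : Type*}
    {F : Matrix (Fin N) (Fin N) ℂ → β} (hF : UnitarilyInvariant F) (U : unitaryGroup (Fin N) ℂ)
    {X : Matrix (Fin N) (Fin N) ℂ} (hX : X.IsHermitian) :
    F (hermMat N (conjCoord U X)) = F X := by
  rw [hermMat_conjCoord U hX]
  simpa using hF _ (Unitary.star_mem U.2) X

/-- The average of `g` over the unitary orbit of `X`. -/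
noncomputable def orbitAverage {N : ℕ} (g : HermCoord N → ENNReal)
    (X : Matrix (Fin N) (Fin N) ℂ) : ENNReal :=
  ∫⁻ U, g (conjCoord U X) ∂haarU N

theorem unitarilyInvariant_orbitAverage {N : ℕ} (g : HermCoord N → ENNReal) :
    UnitarilyInvariant (orbitAverage g) := by
  intro V hV X
  have h : ∀ U : unitaryGroup (Fin N) ℂ, conjCoord U (V * X * star V)
      = conjCoord ((⟨V, hV⟩ : unitaryGroup (Fin N) ℂ)⁻¹ * U) X := by
    intro U
    simp only [conjCoord, UnitaryGroup.inv_val, UnitaryGroup.mul_val, star_mul, star_star,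
      Matrix.mul_assoc]
  simp only [orbitAverage, h]
  exact lintegral_mul_left_eq_self (fun U => g (conjCoord U X)) _

theorem measurable_orbitAverage {N : ℕ} {g : HermCoord N → ENNReal} (hg : Measurable g) :
    Measurable fun v => orbitAverage g (hermMat N v) :=
  (hg.comp (continuous_conjCoord_hermMat N).measurable).lintegral_prod_left'

theorem lintegral_orbitAverage {N : ℕ} {g : HermCoord N → ENNReal} (hg : Measurable g) :
    ∫⁻ v, orbitAverage g (hermMat N v) = ∫⁻ v, g v := by
  simp only [orbitAverage]
  rw [lintegral_lintegral_swap]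
  · simp [(measurePreserving_conjCoord _).lintegral_comp hg]
  · exact (hg.comp ((continuous_conjCoord_hermMat N).comp continuous_swap).measurable).aemeasurable

theorem lintegral_eq_chamber {N : ℕ} {g : HermCoord N → ENNReal} (hg : Measurable g) :
    ∫⁻ v, g v = weylConst N * ∫⁻ D in chamber N,
      ENNReal.ofReal (vdm N D ^ 2) * orbitAverage g (diagonal fun i => (D i : ℂ)) := by
  rw [← lintegral_orbitAverage hg,
    lintegral_hermMat N (unitarilyInvariant_orbitAverage g) (measurable_orbitAverage hg)]

/-- The density of the eigenvalues of a Hermitian matrix. -/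
noncomputable def weylDensity (N : ℕ) (D : Fin N → ℝ) : NNReal :=
  weylConst N / N.factorial * (vdm N D ^ 2).toNNReal

theorem measurable_vdm (N : ℕ) : Measurable (vdm N) := by
  unfold vdm
  fun_prop

theorem measurable_weylDensity (N : ℕ) : Measurable (weylDensity N) := by
  have := measurable_vdm N
  unfold weylDensity
  fun_prop

/-- Polar decomposition of the Lebesgue measure on Hermitian matrices. -/
theorem measurePreserving_conjCoord_diagonal (N : ℕ) :
    MeasurePreserving (fun p : unitaryGroup (Fin N) ℂ × (Fin N → ℝ) =>
      conjCoord p.1 (diagonal fun i => (p.2 i : ℂ)))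
      ((haarU N).prod (volume.withDensity fun D => (weylDensity N D : ENNReal))) volume := by
  have hc := (continuous_conjCoord_diagonal N).measurable
  refine ⟨hc, Measure.ext_of_lintegral _ fun g hg => ?_⟩
  have hgc : Measurable fun p : unitaryGroup (Fin N) ℂ × (Fin N → ℝ) =>
      g (conjCoord p.1 (diagonal fun i => (p.2 i : ℂ))) := hg.comp hc
  have hd : Measurable fun D : Fin N → ℝ => orbitAverage g (diagonal fun i => (D i : ℂ)) :=
    hgc.lintegral_prod_left'
  have hw := (measurable_weylDensity N).coe_nnreal_ennreal
  have hv : Measurable fun D => ENNReal.ofReal (vdm N D ^ 2) :=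
    ((measurable_vdm N).pow_const 2).ennreal_ofReal
  rw [lintegral_map hg hc]
  refine (lintegral_prod_symm _ hgc.aemeasurable).trans ?_
  simp only [← orbitAverage.eq_1]
  rw [lintegral_withDensity_eq_lintegral_mul _ hw hd, lintegral_eq_chamber hg]
  have hN : ((N.factorial : NNReal) : ENNReal) ≠ 0 := by
    simp [Nat.factorial_ne_zero]
  have key := lintegral_eq_factorial_mul (hv.mul hd) fun σ D => by
    simp only [Pi.mul_apply, Function.comp_apply, vdm_comp_perm, mul_pow]
    congr 1
    · rcases Int.units_eq_one_or (Equiv.Perm.sign σ) with h | h <;> simp [h]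
    · exact (unitarilyInvariant_orbitAverage g).diagonal_comp_perm (fun i => (D i : ℂ)) σ
  simp only [Pi.mul_apply] at key ⊢
  simp only [weylDensity, ENNReal.coe_mul, mul_assoc]
  rw [lintegral_const_mul' _ _ ENNReal.coe_ne_top]
  change _ * ∫⁻ D, ENNReal.ofReal (vdm N D ^ 2) * _ = _
  rw [key, ← mul_assoc]
  congr 1
  rw [← ENNReal.coe_natCast, ← ENNReal.coe_mul, div_mul_cancel₀]
  exact_mod_cast Nat.factorial_ne_zero N

/-- The values at the natural numbers of the characteristic polynomial of `X`. -/
noncomputable def charpolyValues {N : ℕ} (X : Matrix (Fin N) (Fin N) ℂ) : ℕ → ℂ :=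
  fun k => (diagonal (fun _ => (k : ℂ)) - X).det

theorem unitarilyInvariant_charpolyValues (N : ℕ) :
    UnitarilyInvariant (charpolyValues (N := N)) := by
  intro U hU X
  have h1 := mem_unitaryGroup_iff.1 hU
  funext k
  have h2 : diagonal (fun _ => (k : ℂ)) - U * X * star U
      = U * (diagonal (fun _ => (k : ℂ)) - X) * star U := by
    rw [← smul_one_eq_diagonal, Matrix.mul_sub, Matrix.sub_mul, Matrix.mul_smul, Matrix.smul_mul,
      Matrix.mul_one, h1]
  rw [charpolyValues, h2, det_mul, det_mul, mul_right_comm, ← det_mul, h1, det_one, one_mul,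
    charpolyValues]

theorem measurable_charpolyValues_hermMat (N : ℕ) :
    Measurable fun v => charpolyValues (hermMat N v) :=
  measurable_pi_lambda _ fun _ =>
    (Continuous.matrix_det (continuous_const.sub (continuous_hermMat N))).measurable

theorem charpolyValues_diagonal {N : ℕ} (D : Fin N → ℝ) (k : ℕ) :
    charpolyValues (diagonal fun i => (D i : ℂ)) k = ((∏ i, ((k : ℝ) - D i) : ℝ) : ℂ) := by
  rw [charpolyValues, diagonal_sub, det_diagonal]
  push_cast
  rfl

theorem injOn_charpolyValues_diagonal (N : ℕ) :
    Set.InjOn (fun D : Fin N → ℝ => charpolyValues (diagonal fun i => (D i : ℂ))) (chamber N) := by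
  intro D hD D' hD' h
  refine strictMono_eq_of_prod_sub_eq hD hD' fun x => ?_
  have hp : (∏ i, (Polynomial.X - Polynomial.C (D i))) =
      ∏ i, (Polynomial.X - Polynomial.C (D' i)) := by
    refine Polynomial.eq_of_infinite_eval_eq _ _
      ((Set.infinite_range_of_injective (Nat.cast_injective (R := ℝ))).mono ?_)
    rintro _ ⟨k, rfl⟩
    have hk := congrFun h k
    simp only [charpolyValues_diagonal] at hk
    simpa [Polynomial.eval_prod] using Complex.ofReal_injective hk
  simpa [Polynomial.eval_prod] using congrArg (Polynomial.eval x) hp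

/-- Two weights on the chamber with equal integrals against all invariant functions agree. -/
theorem ae_eq_of_forall_unitarilyInvariant {N : ℕ} {f g : (Fin N → ℝ) → ENNReal}
    (hf : Measurable f) (hg : Measurable g)
    (h : ∀ F : Matrix (Fin N) (Fin N) ℂ → ENNReal, UnitarilyInvariant F →
      (Measurable fun v => F (hermMat N v)) →
      ∫⁻ D in chamber N, f D * F (diagonal fun i => (D i : ℂ))
        = ∫⁻ D in chamber N, g D * F (diagonal fun i => (D i : ℂ))) :
    f =ᵐ[volume.restrict (chamber N)] g := by
  have hC := (isOpen_chamber N).measurableSet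
  refine ae_eq_of_forall_setLIntegral_eq_of_sigmaFinite hf hg fun S hS _ => ?_
  set p : (Fin N → ℝ) → ℕ → ℂ := fun D => charpolyValues (diagonal fun i => (D i : ℂ))
  have hpm : Measurable p := by
    have hD0 : Measurable fun D : Fin N → ℝ => ((D, 0) : HermCoord N) :=
      measurable_id.prodMk measurable_const
    simpa only [Function.comp_def, hermMat_diagonal] using
      (measurable_charpolyValues_hermMat N).comp hD0
  have hinj := injOn_charpolyValues_diagonal N
  have hT : MeasurableSet (p '' (S ∩ chamber N)) :=
    (hS.inter hC).image_of_measurable_injOn hpm (hinj.mono Set.inter_subset_right)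
  have key := h (fun X => (p '' (S ∩ chamber N)).indicator 1 (charpolyValues X))
    (fun U hU X => by simp only [unitarilyInvariant_charpolyValues N U hU X])
    ((measurable_one.indicator hT).comp (measurable_charpolyValues_hermMat N))
  have hind : ∀ k : (Fin N → ℝ) → ENNReal, ∫⁻ D in chamber N,
      k D * (p '' (S ∩ chamber N)).indicator 1 (charpolyValues (diagonal fun i => (D i : ℂ)))
        = ∫⁻ D in S, k D ∂volume.restrict (chamber N) := by
    intro k
    rw [← lintegral_indicator hS]
    refine setLIntegral_congr_fun hC fun D hD => ?_
    by_cases hDS : D ∈ S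
    · have : p D ∈ p '' (S ∩ chamber N) := ⟨D, ⟨hDS, hD⟩, rfl⟩
      simp only [Set.indicator_of_mem hDS]
      rw [Set.indicator_of_mem this, Pi.one_apply, mul_one]
    · have : p D ∉ p '' (S ∩ chamber N) := by
        rintro ⟨D', ⟨hS', hC'⟩, he⟩
        exact hDS (hinj hC' hD he ▸ hS')
      simp only [Set.indicator_of_notMem hDS]
      rw [Set.indicator_of_notMem this, mul_zero]
  rwa [hind, hind] at key

/-- The Harish-Chandra integral `∫ exp (-tr (diag l * U* diag E U)) dU`. -/
noncomputable def hciz {N : ℕ} (l E : Fin N → ℝ) : ℝ :=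
  ∫ U, Real.exp (-∑ i, l i * (conjCoord U (diagonal fun i => (E i : ℂ))).1 i) ∂haarU N

theorem continuous_hciz {N : ℕ} (l : Fin N → ℝ) : Continuous (hciz l) := by
  have hc := (continuous_conjCoord_diagonal N).comp
    (continuous_swap (X := Fin N → ℝ) (Y := unitaryGroup (Fin N) ℂ))
  have h : Continuous (Function.uncurry fun (E : Fin N → ℝ) (U : unitaryGroup (Fin N) ℂ) =>
      Real.exp (-∑ i, l i * (conjCoord U (diagonal fun i => (E i : ℂ))).1 i)) := by
    refine Real.continuous_exp.comp (Continuous.neg ?_)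
    exact continuous_finsetSum _ fun i _ =>
      continuous_const.mul ((continuous_apply i).comp (continuous_fst.comp hc))
  have := continuous_parametric_integral_of_continuous (μ := haarU N) h isCompact_univ
  rw [Measure.restrict_univ] at this
  exact this

theorem measurable_exp_neg_sum {N : ℕ} (l : Fin N → ℝ) :
    Measurable fun v : HermCoord N => ENNReal.ofReal (Real.exp (-∑ i, l i * v.1 i)) := by
  fun_prop

theorem hciz_nonneg {N : ℕ} (l E : Fin N → ℝ) : 0 ≤ hciz l E :=
  integral_nonneg fun _ => (Real.exp_pos _).le

theorem orbitAverage_exp {N : ℕ} (l E : Fin N → ℝ) :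
    orbitAverage (fun v : HermCoord N => ENNReal.ofReal (Real.exp (-∑ i, l i * v.1 i)))
      (diagonal fun i => (E i : ℂ)) = ENNReal.ofReal (hciz l E) := by
  have hc : Continuous fun U : unitaryGroup (Fin N) ℂ =>
      conjCoord U (diagonal fun i => (E i : ℂ)) := continuous_id.conjCoord continuous_const
  have h : Continuous fun U : unitaryGroup (Fin N) ℂ =>
      Real.exp (-∑ i, l i * (conjCoord U (diagonal fun i => (E i : ℂ))).1 i) := by
    refine Real.continuous_exp.comp (Continuous.neg ?_)
    exact continuous_finsetSum _ fun i _ =>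
      continuous_const.mul ((continuous_apply i).comp (continuous_fst.comp hc))
  rw [hciz, ofReal_integral_eq_lintegral_ofReal
    (h.integrable_of_hasCompactSupport (HasCompactSupport.of_compactSpace _))
    (.of_forall fun _ => (Real.exp_pos _).le)]
  rfl

theorem hciz_comp_perm {N : ℕ} (l E : Fin N → ℝ) (σ : Equiv.Perm (Fin N)) :
    hciz l (E ∘ σ) = hciz l E := by
  have h := (unitarilyInvariant_orbitAverage fun v : HermCoord N =>
    ENNReal.ofReal (Real.exp (-∑ i, l i * v.1 i))).diagonal_comp_perm (fun i => (E i : ℂ)) σ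
  have h' := orbitAverage_exp l (E ∘ σ)
  simp only [Function.comp_apply] at h'
  rw [h, orbitAverage_exp] at h'
  exact ((ENNReal.ofReal_eq_ofReal_iff (hciz_nonneg _ _) (hciz_nonneg _ _)).1 h').symm

theorem lintegral_hciz {N : ℕ} (l : Fin N → ℝ) {F : Matrix (Fin N) (Fin N) ℂ → ENNReal}
    (hF : UnitarilyInvariant F) (hm : Measurable fun v => F (hermMat N v)) :
    ∫⁻ D in chamber N, (weylConst N * ENNReal.ofReal (vdm N D ^ 2) * ENNReal.ofReal (hciz l D)) *
        F (diagonal fun i => (D i : ℂ))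
      = ∫⁻ D in chamber N, ((∏ k ∈ Finset.range N, NNReal.pi ^ k : NNReal) *
        (ENNReal.ofReal (vdm N D) * gtWeight N l D)) * F (diagonal fun i => (D i : ℂ)) := by
  have h1 := lintegral_exp_mul_hermMat N l hF hm
  have h2 := lintegral_eq_chamber ((measurable_exp_neg_sum l).mul hm)
  simp only [Pi.mul_apply] at h2
  rw [h1, ← lintegral_const_mul' _ _ ENNReal.coe_ne_top,
    ← lintegral_const_mul' _ _ ENNReal.coe_ne_top] at h2
  simp only [mul_assoc] at h2 ⊢
  rw [h2]
  refine lintegral_congr fun D => ?_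
  congr 2
  have hD : (diagonal fun i => (D i : ℂ)).IsHermitian :=
    hermMat_diagonal D ▸ hermMat_isHermitian _
  rw [← orbitAverage_exp, orbitAverage, orbitAverage]
  simp only [Pi.mul_apply, hF.apply_conjCoord _ hD]
  rw [lintegral_mul_const]
  exact (measurable_exp_neg_sum l).comp (continuous_id.conjCoord continuous_const).measurable

/-- The Harish-Chandra–Itzykson–Zuber formula. -/
theorem hciz_eq {N : ℕ} {l E : Fin N → ℝ} (hl : Function.Injective l)
    (hE : Function.Injective E) :
    hciz l E = (∏ k ∈ Finset.range N, (k.factorial : ℝ)) *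
      (of fun i j => Real.exp (-l i * E j)).det / (vdm N (-l) * vdm N E) := by
  have hC := isOpen_chamber N
  set P : ℝ := ∏ k ∈ Finset.range N, (k.factorial : ℝ) with hPdef
  have hP : 0 < P := Finset.prod_pos fun k _ => by positivity
  set Q : NNReal := ∏ k ∈ Finset.range N, NNReal.pi ^ k with hQdef
  have hQ : 0 < (Q : ℝ) := NNReal.coe_pos.2 (Finset.prod_pos fun k _ => pow_pos NNReal.pi_pos k)
  have hcW : (weylConst N : ℝ) = Q / P := by
    simp [weylConst, hPdef, hQdef]
  have hvc : Continuous (vdm N) := by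
    unfold vdm
    fun_prop
  have hae := ae_eq_of_forall_unitarilyInvariant
    (f := fun D => weylConst N * ENNReal.ofReal (vdm N D ^ 2) * ENNReal.ofReal (hciz l D))
    (g := fun D => (Q : ENNReal) * (ENNReal.ofReal (vdm N D) * gtWeight N l D))
    (by have := (continuous_hciz l).measurable; have := measurable_vdm N; fun_prop)
    (by have := measurable_gtWeight N l; have := measurable_vdm N; fun_prop)
    fun F hF hm => lintegral_hciz l hF hm
  have hreal : (fun D => (Q / P) * vdm N D ^ 2 * hciz l D) =ᵐ[volume.restrict (chamber N)]
      fun D => Q * (vdm N D * ((of fun i j => Real.exp (-l i * D j)).det / vdm N (-l))) := by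
    filter_upwards [hae, ae_restrict_mem hC.measurableSet] with D hD hDC
    have hD' : StrictMono D := hDC
    obtain ⟨h0, h1⟩ := gtWeight_eq hl hD'
    have h2 := congrArg ENNReal.toReal hD
    rw [h1, ENNReal.toReal_mul, ENNReal.toReal_mul, ENNReal.toReal_mul, ENNReal.toReal_mul,
      ENNReal.toReal_ofReal h0] at h2
    simpa [ENNReal.toReal_ofReal, (vdm_pos hD').le, hciz_nonneg,
      sq_nonneg, hcW] using h2
  have hev := Measure.eqOn_open_of_ae_eq hreal hC
    (by have := continuous_hciz l; fun_prop)
    (by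
      refine Continuous.continuousOn (continuous_const.mul (hvc.mul (Continuous.div_const ?_ _)))
      exact Continuous.matrix_det (by fun_prop))
  have hmain : ∀ D : Fin N → ℝ, StrictMono D → hciz l D = P *
      (of fun i j => Real.exp (-l i * D j)).det / (vdm N (-l) * vdm N D) := by
    intro D hD
    have h := hev (show D ∈ chamber N from hD)
    have hv := (vdm_pos hD).ne'
    have hvl : vdm N (-l) ≠ 0 := vdm_ne_zero_iff.2 fun i j hij => hl (neg_injective hij)
    simp only at h
    field_simp at h ⊢
    linear_combination h
  obtain ⟨σ, hσ, -⟩ := existsUnique_perm_strictMono hE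
  rw [← hciz_comp_perm l E σ, hmain _ hσ, vdm_comp_perm]
  have hdet : (of fun i j => Real.exp (-l i * (E ∘ σ) j)).det
      = (Equiv.Perm.sign σ : ℤ) * (of fun i j => Real.exp (-l i * E j)).det := by
    rw [← det_permute']
    rfl
  rw [hdet]
  rcases Int.units_eq_one_or (Equiv.Perm.sign σ) with h | h <;> simp [h]

theorem trace_diagonal_mul_sq_conjCoord {N : ℕ} (lam D : Fin N → ℝ)
    (U : unitaryGroup (Fin N) ℂ) :
    ((diagonal fun i => (lam i : ℂ)) *
      hermMat N (conjCoord U (diagonal fun i => (D i : ℂ))) ^ 2).trace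
      = ((∑ i, lam i * (conjCoord U (diagonal fun i => ((D i ^ 2 : ℝ) : ℂ))).1 i : ℝ) : ℂ) := by
  have hH : ∀ E : Fin N → ℝ, (diagonal fun i => (E i : ℂ)).IsHermitian := fun E =>
    hermMat_diagonal E ▸ hermMat_isHermitian _
  have hU : (U : Matrix (Fin N) (Fin N) ℂ) * star (U : Matrix (Fin N) (Fin N) ℂ) = 1 :=
    mem_unitaryGroup_iff.1 U.2
  have hsq : hermMat N (conjCoord U (diagonal fun i => (D i : ℂ))) ^ 2
      = hermMat N (conjCoord U (diagonal fun i => ((D i ^ 2 : ℝ) : ℂ))) := by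
    rw [hermMat_conjCoord U (hH D), hermMat_conjCoord U (hH fun i => D i ^ 2), pow_two]
    calc _ = star (U : Matrix (Fin N) (Fin N) ℂ) * (diagonal fun i => (D i : ℂ)) *
          ((U : Matrix (Fin N) (Fin N) ℂ) * star (U : Matrix (Fin N) (Fin N) ℂ)) *
          (diagonal fun i => (D i : ℂ)) * U := by simp only [Matrix.mul_assoc]
      _ = _ := by
        rw [hU, Matrix.mul_one, Matrix.mul_assoc (star _), diagonal_mul_diagonal]
        simp only [pow_two, Complex.ofReal_mul]
  rw [hsq, Matrix.trace]
  push_cast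
  refine Finset.sum_congr rfl fun i _ => ?_
  rw [Matrix.diag_apply, diagonal_mul]
  simp [hermMat]

theorem vdm_sq {N : ℕ} (D : Fin N → ℝ) :
    vdm N (fun i => D i ^ 2) = vdm N D * ∏ i : Fin N, ∏ j ∈ Finset.Ioi i, (D i + D j) := by
  simp only [vdm, ← Finset.prod_mul_distrib]
  exact Finset.prod_congr rfl fun i _ => Finset.prod_congr rfl fun j _ => by ring

theorem vdm_smul {N : ℕ} (c : ℝ) (z : Fin N → ℝ) :
    vdm N (fun i => c * z i) = (∏ i : Fin N, ∏ _j ∈ Finset.Ioi i, c) * vdm N z := by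
  simp only [vdm, ← Finset.prod_mul_distrib]
  exact Finset.prod_congr rfl fun i _ => Finset.prod_congr rfl fun j _ => by ring

theorem sum_sign_mul_exp {N : ℕ} (lam D : Fin N → ℝ) :
    (∑ w : Equiv.Perm (Fin N), ((Equiv.Perm.sign w : ℤ) : ℂ) *
      Complex.exp (-(1 / 2 : ℂ) * ∑ i, (lam i : ℂ) * (D (w i) : ℂ) ^ 2))
      = ((of fun i j => Real.exp (-(lam i / 2) * D j ^ 2)).det : ℝ) := by
  rw [← det_transpose, det_apply']
  push_cast
  refine Finset.sum_congr rfl fun w _ => ?_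
  congr 1
  simp only [transpose_apply, of_apply]
  push_cast
  rw [← Complex.exp_sum, Finset.mul_sum]
  congr 1
  exact Finset.sum_congr rfl fun i _ => by ring

/-- Integration of an invariant function against a Gaussian weight, in eigenvalue coordinates. -/
theorem integral_mul_gaussian {N : ℕ} {Φ : Matrix (Fin N) (Fin N) ℂ → ℂ} (lam : Fin N → ℝ)
    (hΦ : UnitarilyInvariant Φ)
    (hInt : Integrable fun v => Φ (hermMat N v) * Complex.exp (-(1 / 2 : ℂ) *
      ((diagonal fun i => (lam i : ℂ)) * hermMat N v ^ 2).trace)) :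
    ∫ v, Φ (hermMat N v) * Complex.exp (-(1 / 2 : ℂ) *
        ((diagonal fun i => (lam i : ℂ)) * hermMat N v ^ 2).trace)
      = ∫ D : Fin N → ℝ, weylDensity N D • (Φ (diagonal fun i => (D i : ℂ)) *
          (hciz (fun i => lam i / 2) (fun i => D i ^ 2) : ℝ)) := by
  have hmp := measurePreserving_conjCoord_diagonal N
  have hpt : ∀ (U : unitaryGroup (Fin N) ℂ) (D : Fin N → ℝ),
      Φ (hermMat N (conjCoord U (diagonal fun i => (D i : ℂ)))) *
        Complex.exp (-(1 / 2 : ℂ) * ((diagonal fun i => (lam i : ℂ)) *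
          hermMat N (conjCoord U (diagonal fun i => (D i : ℂ))) ^ 2).trace)
      = Φ (diagonal fun i => (D i : ℂ)) * (Real.exp (-∑ i, (lam i / 2) *
          (conjCoord U (diagonal fun i => ((D i ^ 2 : ℝ) : ℂ))).1 i) : ℝ) := by
    intro U D
    rw [trace_diagonal_mul_sq_conjCoord,
      hΦ.apply_conjCoord U (hermMat_diagonal D ▸ hermMat_isHermitian _)]
    congr 1
    rw [Complex.ofReal_exp]
    congr 1
    push_cast
    rw [Finset.mul_sum, ← Finset.sum_neg_distrib]
    exact Finset.sum_congr rfl fun i _ => by ring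
  have hcomp := hmp.integrable_comp_of_integrable hInt
  simp only [Function.comp_def] at hcomp
  have hmap := integral_map hmp.measurable.aemeasurable
    (by rw [hmp.map_eq]; exact hInt.aestronglyMeasurable)
  rw [hmp.map_eq] at hmap
  rw [hmap, integral_prod_symm _ hcomp, integral_withDensity_eq_integral_smul
    (measurable_weylDensity N)]
  refine integral_congr_ae (.of_forall fun D => ?_)
  simp only [hpt, integral_const_mul, integral_complex_ofReal, hciz]

/-- There is a constant `c_N`, depending only on `N`, such that for every
unitary-conjugation-invariant `Φ` and every `Λ = diag(λ)` with positive pairwise distinct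
entries (under the stated integrability assumptions):
`∫_{H_N} Φ(X) e^{−½ tr(ΛX²)} dX
  = c_N ∫_{ℝ^N} Φ(diag D) V(D) · [Σ_{w∈S_N} sgn(w) e^{−½ Σ λ_i D_{w(i)}²}]
      / (V(λ) ∏_{i<j}(D_i + D_j)) dD`. -/
theorem harish_chandra_gaussian_formula (N : ℕ) (hN : 1 ≤ N) :
    ∃ cN : ℂ,
      ∀ (Φ : Matrix (Fin N) (Fin N) ℂ → ℂ) (lam : Fin N → ℝ),
        (∀ U ∈ Matrix.unitaryGroup (Fin N) ℂ, ∀ X, Φ (U * X * star U) = Φ X) →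
        (∀ i, 0 < lam i) →
        Function.Injective lam →
        Integrable (fun v => Φ (hermMat N v) *
          Complex.exp (-(1 / 2 : ℂ) *
            ((Matrix.diagonal fun i => (lam i : ℂ)) * hermMat N v ^ 2).trace)) →
        Integrable (fun D : Fin N → ℝ =>
          Φ (Matrix.diagonal fun i => (D i : ℂ)) * (vdm N D : ℂ) *
            (∑ w : Equiv.Perm (Fin N), ((Equiv.Perm.sign w : ℤ) : ℂ) *
              Complex.exp (-(1 / 2 : ℂ) * ∑ i, (lam i : ℂ) * (D (w i) : ℂ) ^ 2)) *
            ((vdm N lam : ℂ) * ∏ i : Fin N, ∏ j ∈ Finset.Ioi i, ((D i : ℂ) + (D j : ℂ)))⁻¹) →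
        ∫ v, Φ (hermMat N v) *
            Complex.exp (-(1 / 2 : ℂ) *
              ((Matrix.diagonal fun i => (lam i : ℂ)) * hermMat N v ^ 2).trace)
          = cN *
              ∫ D : Fin N → ℝ,
                Φ (Matrix.diagonal fun i => (D i : ℂ)) * (vdm N D : ℂ) *
                  (∑ w : Equiv.Perm (Fin N), ((Equiv.Perm.sign w : ℤ) : ℂ) *
                    Complex.exp (-(1 / 2 : ℂ) * ∑ i, (lam i : ℂ) * (D (w i) : ℂ) ^ 2)) *
                  ((vdm N lam : ℂ) *
                    ∏ i : Fin N, ∏ j ∈ Finset.Ioi i, ((D i : ℂ) + (D j : ℂ)))⁻¹ := by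
  refine ⟨((weylConst N / N.factorial * (∏ k ∈ Finset.range N, (k.factorial : ℝ)) *
    (∏ i : Fin N, ∏ _j ∈ Finset.Ioi i, (-1 / 2))⁻¹ : ℝ) : ℂ), ?_⟩
  intro Φ lam hΦ _ hlam hInt _
  rw [integral_mul_gaussian lam hΦ hInt, ← integral_const_mul]
  refine integral_congr_ae ?_
  filter_upwards [ae_injective N, ae_add_smul_ne_zero (N := N) 1] with D hD hadd
  have hsq : Function.Injective fun i => D i ^ 2 := by
    intro i j hij
    by_contra hne
    rcases sq_eq_sq_iff_eq_or_eq_neg.1 hij with h | h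
    · exact hne (hD h)
    · exact hadd i j hne (by rw [h]; ring)
  have hhalf : Function.Injective fun i => lam i / 2 := fun i j hij => hlam (by simpa using hij)
  have hneg : (-fun i => lam i / 2) = fun i => (-1 / 2 : ℝ) * lam i := by
    funext i
    simp only [Pi.neg_apply]
    ring
  have hV : vdm N D ≠ 0 := vdm_ne_zero_iff.2 hD
  rw [sum_sign_mul_exp, hciz_eq hhalf hsq, hneg, vdm_smul, vdm_sq, NNReal.smul_def, weylDensity,
    Complex.real_smul]
  push_cast [Real.coe_toNNReal _ (sq_nonneg (vdm N D))]
  simp only [mul_inv, div_eq_mul_inv]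
  have hV' : (vdm N D : ℂ) ≠ 0 := by exact_mod_cast hV
  field_simp
end
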